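/- Fix A₀ > 0. There exists a negative number α*, depending only on A₀, such that for every bounded C² domain Ω ⊂ ℝ² with area A₀ and every α ∈ [α*, 0], one has λ₁^α(Ω) ≤ λ₁^α(B), where B is the disk of area A₀; i.e., the disk maximises the first Robin eigenvalue among C² planar domains of fixed area for all sufficiently small negative boundary parameters, uniformly over the class of domains. -/

import Mathlib

open MeasureTheory Metric Filter Asymptotics Real RealInnerProductSpace

noncomputable section

abbrev Eu (d : ℕ) := EuclideanSpace ℝ (Fin d)

/-- The set of Rayleigh quotient values of nonzero Lipschitz test functions for the
Robin problem with boundary parameter `α` on `Ω ⊆ ℝ^d`. -/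
def robinRayleighSet (d : ℕ) (α : ℝ) (Ω : Set (Eu d)) : Set ℝ :=
  { lam : ℝ | ∃ (u : Eu d → ℝ) (K : NNReal),
      LipschitzOnWith K u (closure Ω) ∧
      (∫ x in Ω, (u x) ^ 2) ≠ 0 ∧
      lam = ((∫ x in Ω, ‖fderiv ℝ u x‖ ^ 2)
              + α * ∫ x in frontier Ω, (u x) ^ 2 ∂(μH[(d : ℝ) - 1]))
            / (∫ x in Ω, (u x) ^ 2) }

/-- The first Robin eigenvalue `λ₁^α(Ω)`, defined variationally. -/
def robinEig (d : ℕ) (α : ℝ) (Ω : Set (Eu d)) : ℝ :=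
  sInf (robinRayleighSet d α Ω)

/-- A `C²` Jordan curve in the plane: a periodic, regular, `C²` curve which is
injective on a period. -/
def IsC2JordanCurve (γ : ℝ → Eu 2) : Prop :=
  ContDiff ℝ 2 γ ∧ Function.Periodic γ 1 ∧
  (∀ s ∈ Set.Ico (0 : ℝ) 1, ∀ t ∈ Set.Ico (0 : ℝ) 1, γ s = γ t → s = t) ∧
  ∀ t, deriv γ t ≠ 0

/-- A bounded planar `C²` domain: a bounded open connected set whose boundary is a
finite disjoint union of `C²` Jordan curves. -/
def IsC2Domain (Ω : Set (Eu 2)) : Prop :=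
  IsOpen Ω ∧ IsConnected Ω ∧ Bornology.IsBounded Ω ∧
  ∃ (N : ℕ) (γ : Fin N → ℝ → Eu 2),
    (∀ i, IsC2JordanCurve (γ i)) ∧
    (∀ i j, i ≠ j → Disjoint (Set.range (γ i)) (Set.range (γ j))) ∧
    frontier Ω = ⋃ i, Set.range (γ i)

/-- The unbounded connected component of the complement of the closure of `Ω`. -/
def unboundedPart (Ω : Set (Eu 2)) : Set (Eu 2) :=
  {x | x ∈ (closure Ω)ᶜ ∧ ¬ Bornology.IsBounded (connectedComponentIn (closure Ω)ᶜ x)}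

/-- The outer boundary `Γ₀` of `Ω`: the boundary of the unbounded component of the
complement of the closure of `Ω`. -/
def outerBoundary (Ω : Set (Eu 2)) : Set (Eu 2) :=
  frontier (unboundedPart Ω)

/-- The open region `Ω₀` enclosed by the outer boundary of `Ω`. -/
def innerRegion (Ω : Set (Eu 2)) : Set (Eu 2) :=
  (closure (unboundedPart Ω))ᶜ

/-- The inner radius `R` of the region enclosed by the outer boundary of `Ω`. -/
def innerRadius (Ω : Set (Eu 2)) : ℝ :=
  sSup ((fun x => infDist x (outerBoundary Ω)) '' innerRegion Ω)

/-- The outer perimeter `L₀ = H¹(Γ₀)`. -/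
def outerPerim (Ω : Set (Eu 2)) : ℝ :=
  (μH[1] (outerBoundary Ω)).toReal

/-- `A(t)`, the area of the part of the `t`-neighbourhood of the outer boundary lying
inside `Ω`. -/
def areaFn (Ω : Set (Eu 2)) (t : ℝ) : ℝ :=
  (volume {x ∈ Ω | infDist x (outerBoundary Ω) < t}).toReal

/-- `L(t)`, the length of the part of the level curve at distance `t` from the outer
boundary that lies inside `Ω`. -/
def lenFn (Ω : Set (Eu 2)) (t : ℝ) : ℝ :=
  (μH[1] {x ∈ Ω | infDist x (outerBoundary Ω) = t}).toReal

/-- The entire function `∑ zⁿ / (n! (n + m)!)`; for `m = 0` it satisfies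
`I₀(x) = besselSeries 0 (x² / 4)`. -/
def besselSeries (m : ℕ) (z : ℝ) : ℝ :=
  ∑' n : ℕ, z ^ n / ((n.factorial : ℝ) * ((n + m).factorial : ℝ))

lemma summable_besselSeries (m : ℕ) (z : ℝ) :
    Summable fun n : ℕ => z ^ n / ((n.factorial : ℝ) * ((n + m).factorial : ℝ)) := by
  refine Summable.of_norm_bounded (Real.summable_pow_div_factorial |z|) fun n => ?_
  rw [norm_div, norm_pow, Real.norm_eq_abs, norm_mul, RCLike.norm_natCast, RCLike.norm_natCast]
  have h1 : (1 : ℝ) ≤ ((n + m).factorial : ℝ) := by exact_mod_cast Nat.factorial_pos _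
  have h2 : (0 : ℝ) < (n.factorial : ℝ) := by exact_mod_cast Nat.factorial_pos _
  gcongr
  nlinarith

lemma hasDerivAt_besselSeries (m : ℕ) (z : ℝ) :
    HasDerivAt (besselSeries m) (besselSeries (m + 1) z) z := by
  set r : ℝ := |z| + 1
  have key : HasDerivAt (fun y => ∑' n : ℕ, y ^ n / ((n.factorial : ℝ) * ((n + m).factorial : ℝ)))
      (∑' n : ℕ, (n * z ^ (n - 1)) / ((n.factorial : ℝ) * ((n + m).factorial : ℝ))) z := by
    refine hasDerivAt_tsum_of_isPreconnected
      (u := fun n : ℕ => (n : ℝ) * r ^ (n - 1) / (n.factorial : ℝ))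
      (t := ball (0 : ℝ) r) (y₀ := 0)
      (g' := fun (n : ℕ) (y : ℝ) => (n * y ^ (n - 1)) / ((n.factorial : ℝ) * ((n + m).factorial : ℝ)))
      ?_ isOpen_ball (convex_ball _ _).isPreconnected ?_ ?_ ?_ (summable_besselSeries m 0) ?_
    · rw [← summable_nat_add_iff 1]
      refine (Real.summable_pow_div_factorial r).congr fun n => ?_
      rw [Nat.factorial_succ]
      push_cast
      have h2 : (n.factorial : ℝ) ≠ 0 := by exact_mod_cast Nat.factorial_ne_zero _
      field_simp
    · intro n y _
      exact (hasDerivAt_pow n y).div_const _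
    · intro n y hy
      have hy' : |y| ≤ r := by simpa using (mem_ball.1 hy).le
      rw [norm_div, norm_mul, norm_pow, Real.norm_eq_abs, norm_mul, RCLike.norm_natCast,
        RCLike.norm_natCast, Nat.abs_cast]
      have h1 : (1 : ℝ) ≤ ((n + m).factorial : ℝ) := by exact_mod_cast Nat.factorial_pos _
      have h2 : (0 : ℝ) < (n.factorial : ℝ) := by exact_mod_cast Nat.factorial_pos _
      simp only [Real.norm_eq_abs]
      have : (n.factorial : ℝ) ≤ n.factorial * (n + m).factorial := by nlinarith
      gcongr
    · simp [r]; positivity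
    · simp [r]
  refine HasDerivAt.congr_deriv (f := besselSeries m) key ?_
  rw [Summable.tsum_eq_zero_add (f := fun n : ℕ =>
    (n * z ^ (n - 1)) / ((n.factorial : ℝ) * ((n + m).factorial : ℝ)))]
  · simp only [Nat.cast_zero, zero_mul, zero_div, zero_add]
    refine tsum_congr fun n => ?_
    rw [Nat.factorial_succ, show n + 1 + m = n + (m + 1) by ring]
    push_cast
    have h2 : (n.factorial : ℝ) ≠ 0 := by exact_mod_cast Nat.factorial_ne_zero _
    have h3 : ((n + (m + 1)).factorial : ℝ) ≠ 0 := by exact_mod_cast Nat.factorial_ne_zero _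
    field_simp
  · rw [← summable_nat_add_iff 1]
    refine (summable_besselSeries (m + 1) z).congr fun n => ?_
    rw [Nat.factorial_succ, show n + 1 + m = n + (m + 1) by ring]
    push_cast
    have h2 : (n.factorial : ℝ) ≠ 0 := by exact_mod_cast Nat.factorial_ne_zero _
    have h3 : ((n + (m + 1)).factorial : ℝ) ≠ 0 := by exact_mod_cast Nat.factorial_ne_zero _
    field_simp

lemma besselSeries_zero_eq (z : ℝ) :
    besselSeries 0 z = besselSeries 1 z + z * besselSeries 2 z := by
  have h1 := summable_besselSeries 1 z
  have h2 : HasSum (fun n : ℕ => (n : ℝ) * (z ^ n / ((n.factorial : ℝ) * ((n + 1).factorial : ℝ))))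
      (z * besselSeries 2 z) := by
    rw [← hasSum_nat_add_iff' 1]
    simp only [Finset.sum_range_one, Nat.cast_zero, zero_mul, sub_zero]
    have := ((summable_besselSeries 2 z).hasSum).mul_left z
    refine (congrArg (fun f : ℕ → ℝ => HasSum f (z * besselSeries 2 z)) (funext fun n => ?_)).mpr this
    rw [show n + 1 + 1 = n + 2 by ring, Nat.factorial_succ n]
    push_cast
    have h2 : (n.factorial : ℝ) ≠ 0 := by exact_mod_cast Nat.factorial_ne_zero _
    have h3 : ((n + 2).factorial : ℝ) ≠ 0 := by exact_mod_cast Nat.factorial_ne_zero _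
    field_simp
    ring
  have h3 := h1.hasSum.add h2
  have h4 : besselSeries 1 z = ∑' n : ℕ, z ^ n / ((n.factorial : ℝ) * ((n + 1).factorial : ℝ)) := rfl
  rw [h4, ← h3.tsum_eq]
  refine tsum_congr fun n => ?_
  rw [add_zero, Nat.factorial_succ n]
  push_cast
  have h2 : (n.factorial : ℝ) ≠ 0 := by exact_mod_cast Nat.factorial_ne_zero _
  field_simp
  ring

lemma one_div_factorial_le_besselSeries (m : ℕ) {z : ℝ} (hz : 0 ≤ z) :
    1 / (m.factorial : ℝ) ≤ besselSeries m z := by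
  have := (summable_besselSeries m z).le_tsum 0 (fun n _ => by positivity)
  simpa [besselSeries] using this

lemma continuous_besselSeries (m : ℕ) : Continuous (besselSeries m) :=
  continuous_iff_continuousAt.2 fun z => (hasDerivAt_besselSeries m z).continuousAt

lemma contDiff_besselSeries (m : ℕ) : ContDiff ℝ 1 (besselSeries m) := by
  rw [contDiff_one_iff_deriv]
  refine ⟨fun z => (hasDerivAt_besselSeries m z).differentiableAt, ?_⟩
  rw [show deriv (besselSeries m) = besselSeries (m + 1) from
    funext fun z => (hasDerivAt_besselSeries m z).deriv]
  exact continuous_besselSeries _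

lemma besselSeries_pos (m : ℕ) {z : ℝ} (hz : 0 ≤ z) : 0 < besselSeries m z :=
  lt_of_lt_of_le (by positivity) (one_div_factorial_le_besselSeries m hz)

lemma besselSeries_zero_tangent {x y : ℝ} (hx : 0 ≤ x) (hy : 0 ≤ y) :
    besselSeries 0 x + besselSeries 1 x * (y - x) ≤ besselSeries 0 y := by
  have hmono : MonotoneOn (besselSeries 1) (Set.Ici 0) := by
    refine monotoneOn_of_deriv_nonneg (convex_Ici 0) (continuous_besselSeries 1).continuousOn
      (fun z _ => (hasDerivAt_besselSeries 1 z).differentiableAt.differentiableWithinAt) ?_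
    intro z hz
    rw [interior_Ici] at hz
    rw [(hasDerivAt_besselSeries 1 z).deriv]
    exact (besselSeries_pos _ (le_of_lt hz)).le
  have hconv : ConvexOn ℝ (Set.Ici 0) (besselSeries 0) := by
    refine MonotoneOn.convexOn_of_deriv (convex_Ici 0) (continuous_besselSeries 0).continuousOn
      (fun z _ => (hasDerivAt_besselSeries 0 z).differentiableAt.differentiableWithinAt) ?_
    rw [show deriv (besselSeries 0) = besselSeries 1 from
      funext fun z => (hasDerivAt_besselSeries 0 z).deriv]
    exact hmono.mono interior_subset
  rcases lt_trichotomy x y with h | h | h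
  · have := hconv.le_slope_of_hasDerivAt hx hy h (hasDerivAt_besselSeries 0 x)
    rw [slope_def_field, le_div_iff₀ (by linarith)] at this
    linarith
  · subst h; simp
  · have := hconv.slope_le_of_hasDerivAt hy hx h (hasDerivAt_besselSeries 0 x)
    rw [slope_def_field, div_le_iff₀ (by linarith)] at this
    linarith

/-- Wirtinger's inequality for mean-zero functions with period one. -/
theorem wirtinger_inequality {f f' : ℝ → ℝ} (hf : ∀ x, HasDerivAt f (f' x) x)
    (hf' : Continuous f') (hper : f 1 = f 0) (hmean : ∫ x in (0 : ℝ)..1, f x = 0) :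
    4 * π ^ 2 * ∫ x in (0 : ℝ)..1, f x ^ 2 ≤ ∫ x in (0 : ℝ)..1, f' x ^ 2 := by
  have hfc : Continuous f := continuous_iff_continuousAt.2 fun z => (hf z).continuousAt
  have hL2 : ∀ g : ℝ → ℝ, Continuous g →
      MemLp (fun x => (g x : ℂ)) 2 (volume.restrict (Set.Ioc 0 1)) := by
    intro g hg
    have hg' : Continuous fun x => (g x : ℂ) := Complex.continuous_ofReal.comp hg
    refine (memLp_two_iff_integrable_sq_norm hg'.aestronglyMeasurable).2 ?_
    exact ((hg'.norm.pow 2).integrableOn_Icc (a := (0 : ℝ)) (b := 1)).mono_set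
      Set.Ioc_subset_Icc_self
  have h01 : (0 : ℝ) < 1 := one_pos
  have p1 := hasSum_sq_fourierCoeffOn h01 (hL2 f hfc)
  have p2 := hasSum_sq_fourierCoeffOn h01 (hL2 f' hf')
  have e : ∀ g : ℝ → ℝ, ((1 : ℝ) - 0)⁻¹ • ∫ x in (0 : ℝ)..1, ‖((g x : ℝ) : ℂ)‖ ^ 2
      = ∫ x in (0 : ℝ)..1, g x ^ 2 := by
    intro g
    simp
  rw [e] at p1 p2
  refine hasSum_le (fun n => ?_) (p1.mul_left (4 * π ^ 2)) p2
  by_cases hn : n = 0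
  · subst hn
    have : fourierCoeffOn h01 (fun x => (f x : ℂ)) 0 = 0 := by
      rw [fourierCoeffOn_eq_integral]
      simp only [neg_zero, fourier_zero, one_smul]
      rw [intervalIntegral.integral_ofReal, hmean]
      simp
    rw [this]
    simp only [norm_zero, ne_eq, OfNat.ofNat_ne_zero, not_false_eq_true, zero_pow, mul_zero]
    positivity
  · have hd := fourierCoeffOn_of_hasDerivAt (f := fun x => (f x : ℂ)) (f' := fun x => (f' x : ℂ))
      h01 hn (fun x _ => (hf x).ofReal_comp)
      ((Complex.continuous_ofReal.comp hf').intervalIntegrable _ _)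
    rw [hd, hper]
    simp only [sub_self, mul_zero, zero_sub, norm_mul, norm_div, norm_one, norm_neg]
    have hn1 : (1 : ℝ) ≤ |(n : ℝ)| := by
      rw [← Int.cast_abs]
      exact_mod_cast Int.one_le_abs hn
    simp only [Complex.ofReal_one, Complex.ofReal_zero, sub_zero, norm_one, one_mul]
    rw [mul_pow, ← mul_assoc]
    refine mul_le_of_le_one_left (by positivity) ?_
    simp only [Complex.norm_ofNat, Complex.norm_real, Complex.norm_I, Complex.norm_intCast,
      Real.norm_eq_abs, abs_of_pos Real.pi_pos, mul_one]
    rw [div_pow, one_pow, mul_one_div, div_le_one (by positivity)]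
    have : 1 ≤ |(n : ℝ)| ^ 2 := one_le_pow₀ hn1
    nlinarith [sq_nonneg π]

/-- The planar cross product. -/
def cross (a b : Eu 2) : ℝ := a 0 * b 1 - a 1 * b 0

lemma Eu.norm_sq_eq (a : Eu 2) : ‖a‖ ^ 2 = a 0 ^ 2 + a 1 ^ 2 := by
  rw [EuclideanSpace.norm_sq_eq]; simp

lemma abs_cross_le (a b : Eu 2) : |cross a b| ≤ ‖a‖ * ‖b‖ := by
  refine abs_le_of_sq_le_sq ?_ (by positivity)
  rw [mul_pow, Eu.norm_sq_eq, Eu.norm_sq_eq, cross]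
  nlinarith [sq_nonneg (a 0 * b 0 + a 1 * b 1)]

lemma continuous_cross {X : Type*} [TopologicalSpace X] {f g : X → Eu 2} (hf : Continuous f)
    (hg : Continuous g) : Continuous fun x => cross (f x) (g x) := by
  unfold cross; fun_prop

/-- A `C¹` closed curve of period one and constant speed `ℓ`, with velocity `γ'`. -/
structure ClosedCurve (γ γ' : ℝ → Eu 2) (ℓ : ℝ) : Prop where
  deriv : ∀ t, HasDerivAt γ (γ' t) t
  cont : Continuous γ'
  per : Function.Periodic γ 1
  speed : ∀ t, ‖γ' t‖ = ℓ

/-- The centroid of a closed curve. -/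
def curveMean (γ : ℝ → Eu 2) : Eu 2 := ∫ t in (0 : ℝ)..1, γ t

/-- Twice the signed area enclosed by a closed curve. -/
def curveArea (γ γ' : ℝ → Eu 2) : ℝ := ∫ t in (0 : ℝ)..1, cross (γ t) (γ' t)

lemma hasDerivAt_coord {γ : ℝ → Eu 2} {v : Eu 2} {t : ℝ} (h : HasDerivAt γ v t) (i : Fin 2) :
    HasDerivAt (fun s => γ s i) (v i) t :=
  (EuclideanSpace.proj (𝕜 := ℝ) i).hasFDerivAt.comp_hasDerivAt t h

lemma coord_intervalIntegral {γ : ℝ → Eu 2} (h : Continuous γ) (i : Fin 2) :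
    (∫ t in (0 : ℝ)..1, γ t) i = ∫ t in (0 : ℝ)..1, γ t i :=
  ((EuclideanSpace.proj (𝕜 := ℝ) i).intervalIntegral_comp_comm
    (h.intervalIntegrable 0 1)).symm

namespace ClosedCurve

variable {γ γ' : ℝ → Eu 2} {ℓ : ℝ}

lemma continuous (h : ClosedCurve γ γ' ℓ) : Continuous γ :=
  continuous_iff_continuousAt.2 fun t => (h.deriv t).continuousAt

lemma speed_nonneg (h : ClosedCurve γ γ' ℓ) : 0 ≤ ℓ := h.speed 0 ▸ norm_nonneg _

lemma lipschitz (h : ClosedCurve γ γ' ℓ) (s t : ℝ) : ‖γ t - γ s‖ ≤ ℓ * |t - s| := by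
  have := Convex.norm_image_sub_le_of_norm_hasDerivWithin_le (f := γ) (f' := γ') (s := Set.univ)
    (C := ℓ) (fun x _ => (h.deriv x).hasDerivWithinAt) (fun x _ => (h.speed x).le)
    convex_univ (Set.mem_univ s) (Set.mem_univ t)
  simpa using this

lemma one_eq_zero (h : ClosedCurve γ γ' ℓ) : γ 1 = γ 0 := by
  simpa using h.per 0

lemma integral_cross_const (h : ClosedCurve γ γ' ℓ) (c : Eu 2) :
    ∫ t in (0 : ℝ)..1, cross c (γ' t) = 0 := by
  have h0 : ∀ t ∈ Set.uIcc (0 : ℝ) 1, HasDerivAt (fun t => cross c (γ t)) (cross c (γ' t)) t := by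
    intro t _
    exact ((hasDerivAt_coord (h.deriv t) 1).const_mul (c 0)).sub
      ((hasDerivAt_coord (h.deriv t) 0).const_mul (c 1))
  rw [intervalIntegral.integral_eq_sub_of_hasDerivAt h0
    ((continuous_cross continuous_const h.cont).intervalIntegrable _ _), h.one_eq_zero, sub_self]

lemma integral_cross_sub (h : ClosedCurve γ γ' ℓ) (c : Eu 2) :
    ∫ t in (0 : ℝ)..1, cross (γ t - c) (γ' t) = curveArea γ γ' := by
  have h1 : curveArea γ γ' = curveArea γ γ' - ∫ t in (0 : ℝ)..1, cross c (γ' t) := by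
    rw [h.integral_cross_const, sub_zero]
  rw [h1, curveArea, ← intervalIntegral.integral_sub
      ((continuous_cross h.continuous h.cont).intervalIntegrable _ _)
      ((continuous_cross continuous_const h.cont).intervalIntegrable _ _)]
  congr 1; ext t; simp [cross]; ring

lemma norm_sub_mean_le (h : ClosedCurve γ γ' ℓ) {t : ℝ} (ht : t ∈ Set.Icc (0 : ℝ) 1) :
    ‖γ t - curveMean γ‖ ≤ ℓ := by
  have h1 : γ t - curveMean γ = ∫ s in (0 : ℝ)..1, (γ t - γ s) := by
    rw [intervalIntegral.integral_sub (by simp) (h.continuous.intervalIntegrable _ _)]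
    simp [curveMean]
  rw [h1]
  refine (intervalIntegral.norm_integral_le_of_norm_le_const (C := ℓ) fun s hs => ?_).trans
    (by simp)
  rw [Set.uIoc_of_le zero_le_one] at hs
  refine (h.lipschitz s t).trans (mul_le_of_le_one_right h.speed_nonneg ?_)
  rw [abs_le]; constructor <;> linarith [ht.1, ht.2, hs.1, hs.2]

lemma four_pi_sq_integral_le (h : ClosedCurve γ γ' ℓ) :
    4 * π ^ 2 * ∫ t in (0 : ℝ)..1, ‖γ t - curveMean γ‖ ^ 2 ≤ ℓ ^ 2 := by
  have hc := h.continuous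
  have key : ∀ i : Fin 2, 4 * π ^ 2 * ∫ t in (0 : ℝ)..1, (γ t i - curveMean γ i) ^ 2
      ≤ ∫ t in (0 : ℝ)..1, (γ' t i) ^ 2 := by
    intro i
    refine wirtinger_inequality (f := fun t => γ t i - curveMean γ i) (f' := fun t => γ' t i)
      (fun t => (hasDerivAt_coord (h.deriv t) i).sub_const _) ?_ ?_ ?_
    · have := h.cont; fun_prop
    · simp [h.one_eq_zero]
    · rw [intervalIntegral.integral_sub (Continuous.intervalIntegrable (by fun_prop) _ _)
        (by simp), curveMean, coord_intervalIntegral hc]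
      simp
  have e1 : ∫ t in (0 : ℝ)..1, ‖γ t - curveMean γ‖ ^ 2
      = (∫ t in (0 : ℝ)..1, (γ t 0 - curveMean γ 0) ^ 2)
        + ∫ t in (0 : ℝ)..1, (γ t 1 - curveMean γ 1) ^ 2 := by
    rw [← intervalIntegral.integral_add (Continuous.intervalIntegrable (by fun_prop) _ _)
      (Continuous.intervalIntegrable (by fun_prop) _ _)]
    congr 1; ext t; rw [Eu.norm_sq_eq]; simp
  have e2 : ℓ ^ 2 = (∫ t in (0 : ℝ)..1, (γ' t 0) ^ 2) + ∫ t in (0 : ℝ)..1, (γ' t 1) ^ 2 := by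
    have := h.cont
    rw [← intervalIntegral.integral_add (Continuous.intervalIntegrable (by fun_prop) _ _)
      (Continuous.intervalIntegrable (by fun_prop) _ _)]
    simp_rw [← Eu.norm_sq_eq, h.speed]
    simp
  rw [e1, e2, mul_add]
  exact add_le_add (key 0) (key 1)

lemma two_pi_abs_area_le (h : ClosedCurve γ γ' ℓ) : 2 * π * |curveArea γ γ'| ≤ ℓ ^ 2 := by
  have hc := h.continuous
  have h1 : |curveArea γ γ'| ≤ ∫ t in (0 : ℝ)..1, ‖γ t - curveMean γ‖ * ℓ := by
    rw [← h.integral_cross_sub (curveMean γ)]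
    have hi : Continuous fun t => ‖γ t - curveMean γ‖ * ℓ := by fun_prop
    rw [← Real.norm_eq_abs]
    refine intervalIntegral.norm_integral_le_of_norm_le (μ := volume) zero_le_one
      (ae_of_all volume fun t _ => ?_) (hi.intervalIntegrable _ _)
    rw [← h.speed t]
    exact abs_cross_le _ _
  have h2 : 4 * π * (∫ t in (0 : ℝ)..1, ‖γ t - curveMean γ‖ * ℓ)
      ≤ ∫ t in (0 : ℝ)..1, (4 * π ^ 2 * ‖γ t - curveMean γ‖ ^ 2 + ℓ ^ 2) := by
    rw [← intervalIntegral.integral_const_mul]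
    have hi : Continuous fun t => 4 * π * (‖γ t - curveMean γ‖ * ℓ) := by fun_prop
    have hi' : Continuous fun t => 4 * π ^ 2 * ‖γ t - curveMean γ‖ ^ 2 + ℓ ^ 2 := by fun_prop
    refine intervalIntegral.integral_mono_on zero_le_one
      (hi.intervalIntegrable _ _) (hi'.intervalIntegrable _ _) fun t _ => ?_
    nlinarith [sq_nonneg (2 * π * ‖γ t - curveMean γ‖ - ℓ)]
  rw [intervalIntegral.integral_add (f := fun t => 4 * π ^ 2 * ‖γ t - curveMean γ‖ ^ 2)
    (Continuous.intervalIntegrable (by fun_prop) _ _) (by simp),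
    intervalIntegral.integral_const_mul] at h2
  have h3 := h.four_pi_sq_integral_le
  simp only [intervalIntegral.integral_const, sub_zero, one_smul] at h2
  nlinarith [Real.pi_pos]

end ClosedCurve

lemma sq_four_pi_sq_norm_sub_le {x v : Eu 2} {ℓ ς : ℝ} (hℓ : ‖v‖ = ℓ) (hς : ς ^ 2 = 1)
    (hx : ‖x‖ ≤ ℓ) :
    (4 * π ^ 2 * ‖x‖ ^ 2 - ℓ ^ 2) ^ 2
      ≤ (2 * π + 1) ^ 2 * ℓ ^ 2 * (ℓ ^ 2 + 4 * π ^ 2 * ‖x‖ ^ 2 - 4 * π * (ς * cross x v)) := by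
  have h1 : ς * cross x v ≤ ‖x‖ * ℓ := by
    have h := abs_cross_le x v
    rw [hℓ] at h
    refine (le_abs_self _).trans ?_
    have : |ς| = 1 := by
      rw [← sq_abs] at hς
      nlinarith [abs_nonneg ς]
    rw [abs_mul, this, one_mul]; exact h
  have h2 : (2 * π * ‖x‖ - ℓ) ^ 2
      ≤ ℓ ^ 2 + 4 * π ^ 2 * ‖x‖ ^ 2 - 4 * π * (ς * cross x v) := by
    nlinarith [Real.pi_pos]
  have h3 : (2 * π * ‖x‖ + ℓ) ^ 2 ≤ (2 * π + 1) ^ 2 * ℓ ^ 2 := by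
    rw [← mul_pow]
    have := norm_nonneg x
    refine pow_le_pow_left₀ (by have := hx; have := Real.pi_pos; nlinarith) ?_ 2
    nlinarith [Real.pi_pos]
  calc (4 * π ^ 2 * ‖x‖ ^ 2 - ℓ ^ 2) ^ 2
      = (2 * π * ‖x‖ + ℓ) ^ 2 * (2 * π * ‖x‖ - ℓ) ^ 2 := by ring
    _ ≤ _ := mul_le_mul h3 h2 (sq_nonneg _) (by positivity)

lemma sq_norm_sq_sub_cross_le {x v : Eu 2} {ℓ ς : ℝ} (hℓ : ‖v‖ = ℓ) (hς : ς ^ 2 = 1) :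
    (ℓ ^ 2 - 2 * π * (ς * cross x v)) ^ 2
      ≤ ℓ ^ 2 * (ℓ ^ 2 + 4 * π ^ 2 * ‖x‖ ^ 2 - 4 * π * (ς * cross x v)) := by
  have h : (cross x v) ^ 2 ≤ ‖x‖ ^ 2 * ℓ ^ 2 := by
    rw [← mul_pow, ← hℓ]
    exact sq_le_sq' (by linarith [neg_abs_le (cross x v), abs_cross_le x v])
      ((le_abs_self _).trans (abs_cross_le x v))
  have : (ς * cross x v) ^ 2 = (cross x v) ^ 2 := by rw [mul_pow, hς, one_mul]
  nlinarith [Real.pi_pos, sq_nonneg π, mul_le_mul_of_nonneg_left h (sq_nonneg π)]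

set_option maxHeartbeats 1600000 in
/-- Quantitative stability of the isoperimetric inequality for constant speed curves: weighted
first order moments of an almost optimal curve are controlled linearly by the deficit. -/
lemma curve_stability {R : ℝ} (hR : 0 < R) : ∃ C : ℝ, 0 ≤ C ∧
    ∀ (γ γ' : ℝ → Eu 2) (ℓ ς δ : ℝ), ClosedCurve γ γ' ℓ → ς ^ 2 = 1 → 0 ≤ δ → δ ≤ 2 * π * R →
      |ℓ - 2 * π * R| ≤ 2 * δ → ℓ ^ 2 - 2 * π * (ς * curveArea γ γ') ≤ 6 * π * R * δ →
      |∫ t in (0 : ℝ)..1, (‖γ t - curveMean γ‖ ^ 2 - R ^ 2)| ≤ C * δ ∧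
      ∀ (W : ℝ → ℝ) (B b w : ℝ), Continuous W → 0 ≤ B → |b| ≤ B →
        (∀ s ∈ Set.Icc 0 ((6 * π * R) ^ 2), |W s - w| ≤ B * |s - R ^ 2| ∧
          |W s - w - b * (s - R ^ 2)| ≤ B * (s - R ^ 2) ^ 2) →
        |∫ t in (0 : ℝ)..1, (W (‖γ t - curveMean γ‖ ^ 2) - w) * cross (γ t - curveMean γ) (γ' t)|
          ≤ C * B * δ := by
  have hπ := Real.pi_pos
  set L : ℝ := 6 * π * R with hL
  have hLp : 0 < L := by positivity
  set P : ℝ := (2 * π + 1) ^ 2 * L ^ 2 with hP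
  set K : ℝ := (2 * P * (12 * π * R) + 2 * (16 * π * R) ^ 2 * (2 * π * R)) / (16 * π ^ 4) with hK
  have hPp : 0 < P := by positivity
  have hKp : 0 ≤ K := by positivity
  set C1 : ℝ := (28 * π * R) / (4 * π ^ 2) with hC1
  have hC1p : 0 ≤ C1 := by positivity
  refine ⟨C1 + (L ^ 2 / (2 * π) * C1 + L ^ 2 / (2 * π) * K
    + 1 / (4 * π) * (K + L ^ 2 * (12 * π * R))), by positivity, ?_⟩
  intro γ γ' ℓ ς δ h hς hδ hδR hℓ hdef
  set c := curveMean γ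
  have hc := h.continuous
  have hc' := h.cont
  have hℓ0 := h.speed_nonneg
  have hℓ' := abs_le.1 hℓ
  have hℓL : ℓ ≤ L := by rw [hL]; nlinarith
  set X : ℝ → ℝ := fun t => ‖γ t - c‖ ^ 2 with hX
  have hXc : Continuous X := by fun_prop
  set r : ℝ → ℝ := fun t => cross (γ t - c) (γ' t) with hr
  have hrc : Continuous r := continuous_cross (by fun_prop) h.cont
  set Q : ℝ → ℝ := fun t => ℓ ^ 2 + 4 * π ^ 2 * X t - 4 * π * (ς * r t) with hQ
  have hQc : Continuous Q := by fun_prop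
  set T : ℝ → ℝ := fun t => X t - R ^ 2 with hT
  have hTc : Continuous T := by fun_prop
  have ii : ∀ {f : ℝ → ℝ}, Continuous f → IntervalIntegrable f volume 0 1 :=
    fun hf => hf.intervalIntegrable _ _
  have hxle : ∀ t ∈ Set.Icc (0 : ℝ) 1, ‖γ t - c‖ ≤ ℓ := fun t ht => h.norm_sub_mean_le ht
  have hIX : 4 * π ^ 2 * ∫ t in (0 : ℝ)..1, X t ≤ ℓ ^ 2 := h.four_pi_sq_integral_le
  have hIr : ∫ t in (0 : ℝ)..1, r t = curveArea γ γ' := h.integral_cross_sub c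
  have hIQ : ∫ t in (0 : ℝ)..1, Q t = ℓ ^ 2 + 4 * π ^ 2 * (∫ t in (0 : ℝ)..1, X t)
      - 4 * π * (ς * curveArea γ γ') := by
    rw [← hIr]
    simp only [hQ]
    rw [intervalIntegral.integral_sub (ii (by fun_prop)) (ii (by fun_prop)),
      intervalIntegral.integral_add (ii (by fun_prop)) (ii (by fun_prop)),
      intervalIntegral.integral_const_mul, intervalIntegral.integral_const_mul,
      intervalIntegral.integral_const_mul]
    simp
  have hQ0 : ∀ t, 0 ≤ Q t := by
    intro t
    have := abs_le.1 (abs_cross_le (γ t - c) (γ' t))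
    have h2 : (ς * r t) ^ 2 ≤ X t * ℓ ^ 2 := by
      rw [mul_pow, hς, one_mul, hX, ← h.speed t]
      dsimp only
      rw [← mul_pow]
      exact sq_le_sq' this.1 this.2
    have h3 : 0 ≤ X t := by positivity
    have h4 : (4 * π * (ς * r t)) ^ 2 ≤ (ℓ ^ 2 + 4 * π ^ 2 * X t) ^ 2 := by
      nlinarith [sq_nonneg (ℓ ^ 2 - 4 * π ^ 2 * X t), mul_le_mul_of_nonneg_left h2 (sq_nonneg π)]
    have := abs_le_of_sq_le_sq' h4 (by positivity)
    simp only [hQ]; linarith [this.2]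
  have hIQle : ∫ t in (0 : ℝ)..1, Q t ≤ 12 * π * R * δ := by rw [hIQ]; nlinarith
  have hIQ0 : 0 ≤ ∫ t in (0 : ℝ)..1, Q t :=
    intervalIntegral.integral_nonneg zero_le_one fun t _ => hQ0 t
  have hℓ2 : |ℓ ^ 2 - 4 * π ^ 2 * R ^ 2| ≤ 16 * π * R * δ := by
    have : ℓ ^ 2 - 4 * π ^ 2 * R ^ 2 = (ℓ - 2 * π * R) * (ℓ + 2 * π * R) := by ring
    rw [this, abs_mul, abs_of_nonneg (show 0 ≤ ℓ + 2 * π * R by positivity)]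
    calc _ ≤ 2 * δ * (L + 2 * π * R) := by gcongr
      _ = _ := by rw [hL]; ring
  have hIT : ∫ t in (0 : ℝ)..1, T t = (∫ t in (0 : ℝ)..1, X t) - R ^ 2 := by
    simp only [hT]
    rw [intervalIntegral.integral_sub (ii hXc) (ii (by fun_prop))]
    simp
  have hITle : |∫ t in (0 : ℝ)..1, T t| ≤ C1 * δ := by
    have e : C1 * δ = 28 * π * R * δ / (4 * π ^ 2) := by rw [hC1]; ring
    have h1 := abs_le.1 hℓ2
    rw [hIT, e, abs_le, neg_le, le_div_iff₀ (by positivity), le_div_iff₀ (by positivity)]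
    constructor <;> nlinarith [mul_nonneg (mul_nonneg hπ.le hR.le) hδ]
  have hTsq : ∀ t ∈ Set.Icc (0 : ℝ) 1,
      T t ^ 2 ≤ (2 * P * Q t + 2 * (16 * π * R) ^ 2 * (2 * π * R) * δ) / (16 * π ^ 4) := by
    intro t ht
    rw [le_div_iff₀ (by positivity)]
    have h1 := sq_four_pi_sq_norm_sub_le (h.speed t) hς (hxle t ht)
    have h2 : (2 * π + 1) ^ 2 * ℓ ^ 2 * Q t ≤ P * Q t := by
      have := hQ0 t
      rw [hP]; gcongr
    have h3 : (4 * π ^ 2 * X t - ℓ ^ 2) ^ 2 ≤ P * Q t := h1.trans h2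
    have h4 : (ℓ ^ 2 - 4 * π ^ 2 * R ^ 2) ^ 2 ≤ (16 * π * R) ^ 2 * (2 * π * R) * δ := by
      calc _ ≤ (16 * π * R * δ) ^ 2 := by rw [← sq_abs]; gcongr
        _ = (16 * π * R) ^ 2 * δ * δ := by ring
        _ ≤ (16 * π * R) ^ 2 * (2 * π * R) * δ := by gcongr
    have h5 : T t ^ 2 * (16 * π ^ 4)
        = ((4 * π ^ 2 * X t - ℓ ^ 2) + (ℓ ^ 2 - 4 * π ^ 2 * R ^ 2)) ^ 2 := by
      simp only [hT]; ring
    rw [h5]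
    refine add_sq_le.trans ?_
    linarith
  have hITsq : ∫ t in (0 : ℝ)..1, T t ^ 2 ≤ K * δ := by
    calc ∫ t in (0 : ℝ)..1, T t ^ 2
        ≤ ∫ t in (0 : ℝ)..1,
          (2 * P * Q t + 2 * (16 * π * R) ^ 2 * (2 * π * R) * δ) / (16 * π ^ 4) :=
          intervalIntegral.integral_mono_on zero_le_one (ii (by fun_prop)) (ii (by fun_prop)) hTsq
      _ = (2 * P * (∫ t in (0 : ℝ)..1, Q t) + 2 * (16 * π * R) ^ 2 * (2 * π * R) * δ)
          / (16 * π ^ 4) := by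
          rw [intervalIntegral.integral_div, intervalIntegral.integral_add (ii (by fun_prop))
            (ii (by fun_prop)), intervalIntegral.integral_const_mul]
          simp
      _ ≤ (2 * P * (12 * π * R * δ) + 2 * (16 * π * R) ^ 2 * (2 * π * R) * δ)
          / (16 * π ^ 4) := by gcongr
      _ = K * δ := by rw [hK]; ring
  refine ⟨hITle.trans ?_, ?_⟩
  · refine mul_le_mul_of_nonneg_right ?_ hδ
    exact le_add_of_nonneg_right (by positivity)
  intro W B b w hW hB hb hWs
  have hXL : ∀ t ∈ Set.Icc (0 : ℝ) 1, X t ∈ Set.Icc 0 (L ^ 2) := fun t ht =>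
    ⟨by positivity, pow_le_pow_left₀ (norm_nonneg _) ((hxle t ht).trans hℓL) 2⟩
  have hpt : ∀ t ∈ Set.Icc (0 : ℝ) 1,
      |(W (X t) - w) * r t - ς * (ℓ ^ 2 / (2 * π)) * b * T t|
        ≤ L ^ 2 / (2 * π) * (B * T t ^ 2) + B * (1 / (4 * π) * (T t ^ 2 + L ^ 2 * Q t)) := by
    intro t ht
    obtain ⟨hw1, hw2⟩ := hWs _ (hXL t ht)
    set D : ℝ := ℓ ^ 2 - 2 * π * (ς * r t) with hD
    have hD2 : D ^ 2 ≤ L ^ 2 * Q t := by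
      refine (sq_norm_sq_sub_cross_le (h.speed t) hς).trans ?_
      have := hQ0 t
      change ℓ ^ 2 * Q t ≤ _
      gcongr
    have hς1 : |ς| = 1 := by
      rw [← sq_abs] at hς
      nlinarith [abs_nonneg ς]
    have e1 : (W (X t) - w) * r t - ς * (ℓ ^ 2 / (2 * π)) * b * T t
        = ς * (ℓ ^ 2 / (2 * π) * (W (X t) - w - b * T t)) - ς * ((W (X t) - w) * (D / (2 * π))) := by
      have : r t = ς ^ 2 * r t := by rw [hς, one_mul]
      rw [hD]
      field_simp
      linear_combination (2 * π * (W (X t) - w)) * this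
    rw [e1]
    refine (abs_sub _ _).trans ?_
    rw [abs_mul, abs_mul ς, hς1, one_mul, one_mul, abs_mul, abs_mul, abs_div D,
      abs_of_pos (show 0 < 2 * π by positivity), abs_of_nonneg (show 0 ≤ ℓ ^ 2 / (2 * π) by positivity)]
    refine add_le_add ?_ ?_
    · gcongr
    · calc |W (X t) - w| * (|D| / (2 * π)) ≤ (B * |T t|) * (|D| / (2 * π)) := by
            gcongr
        _ = B * (1 / (4 * π) * (2 * |T t| * |D|)) := by field_simp; ring
        _ ≤ B * (1 / (4 * π) * (T t ^ 2 + L ^ 2 * Q t)) := by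
            gcongr
            nlinarith [sq_nonneg (|T t| - |D|), sq_abs (T t), sq_abs D]
  have hF : Continuous fun t => (W (X t) - w) * r t := by fun_prop
  have hG : Continuous fun t =>
      L ^ 2 / (2 * π) * (B * T t ^ 2) + B * (1 / (4 * π) * (T t ^ 2 + L ^ 2 * Q t)) := by fun_prop
  have hsum : |∫ t in (0 : ℝ)..1, ((W (X t) - w) * r t - ς * (ℓ ^ 2 / (2 * π)) * b * T t)|
      ≤ ∫ t in (0 : ℝ)..1,
        (L ^ 2 / (2 * π) * (B * T t ^ 2) + B * (1 / (4 * π) * (T t ^ 2 + L ^ 2 * Q t))) := by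
    refine (intervalIntegral.abs_integral_le_integral_abs zero_le_one).trans ?_
    exact intervalIntegral.integral_mono_on zero_le_one (ii (by fun_prop)) (ii hG) hpt
  rw [intervalIntegral.integral_sub (ii hF) (ii (by fun_prop)),
    intervalIntegral.integral_const_mul] at hsum
  have hG' : ∫ t in (0 : ℝ)..1,
        (L ^ 2 / (2 * π) * (B * T t ^ 2) + B * (1 / (4 * π) * (T t ^ 2 + L ^ 2 * Q t)))
      = L ^ 2 / (2 * π) * (B * ∫ t in (0 : ℝ)..1, T t ^ 2)
        + B * (1 / (4 * π) * ((∫ t in (0 : ℝ)..1, T t ^ 2) + L ^ 2 * ∫ t in (0 : ℝ)..1, Q t)) := by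
    rw [intervalIntegral.integral_add (ii (by fun_prop)) (ii (by fun_prop)),
      intervalIntegral.integral_const_mul, intervalIntegral.integral_const_mul,
      intervalIntegral.integral_const_mul, intervalIntegral.integral_const_mul,
      intervalIntegral.integral_add (ii (by fun_prop)) (ii (by fun_prop)),
      intervalIntegral.integral_const_mul]
  rw [hG'] at hsum
  have hlin : |ς * (ℓ ^ 2 / (2 * π)) * b * ∫ t in (0 : ℝ)..1, T t|
      ≤ L ^ 2 / (2 * π) * B * (C1 * δ) := by
    have hς1 : |ς| = 1 := by
      rw [← sq_abs] at hς
      nlinarith [abs_nonneg ς]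
    rw [abs_mul, abs_mul, abs_mul, hς1, one_mul,
      abs_of_nonneg (show 0 ≤ ℓ ^ 2 / (2 * π) by positivity)]
    gcongr
  have hmain := (abs_sub_abs_le_abs_sub _ _).trans hsum
  have : L ^ 2 / (2 * π) * (B * ∫ t in (0 : ℝ)..1, T t ^ 2)
        + B * (1 / (4 * π) * ((∫ t in (0 : ℝ)..1, T t ^ 2) + L ^ 2 * ∫ t in (0 : ℝ)..1, Q t))
      ≤ L ^ 2 / (2 * π) * (B * (K * δ))
        + B * (1 / (4 * π) * (K * δ + L ^ 2 * (12 * π * R * δ))) := by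
    gcongr
  calc _ ≤ L ^ 2 / (2 * π) * B * (C1 * δ) + (L ^ 2 / (2 * π) * (B * (K * δ))
        + B * (1 / (4 * π) * (K * δ + L ^ 2 * (12 * π * R * δ)))) := by linarith
    _ = (L ^ 2 / (2 * π) * C1 + L ^ 2 / (2 * π) * K
        + 1 / (4 * π) * (K + L ^ 2 * (12 * π * R))) * B * δ := by ring
    _ ≤ _ := by
        rw [mul_assoc, mul_assoc _ B]
        exact mul_le_mul_of_nonneg_right (le_add_of_nonneg_left hC1p) (by positivity)

/-- A `C²` Jordan curve has a constant speed parametrisation. -/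
lemma IsC2JordanCurve.exists_constant_speed {γ : ℝ → Eu 2} (h : IsC2JordanCurve γ) :
    ∃ (η η' : ℝ → Eu 2) (ℓ : ℝ), ClosedCurve η η' ℓ ∧ 0 < ℓ ∧
      Set.InjOn η (Set.Ico 0 1) ∧ Set.range η = Set.range γ := by
  obtain ⟨hC, hper, hinj, hreg⟩ := h
  have hd : ∀ t, HasDerivAt γ (deriv γ t) t := fun t =>
    ((hC.differentiable (by norm_num)) t).hasDerivAt
  have hv : Continuous (deriv γ) := hC.continuous_deriv (by norm_num)
  have hvper : ∀ t, deriv γ (t + 1) = deriv γ t := by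
    intro t
    rw [← deriv_comp_add_const]
    congr 1
    exact funext hper
  set n : ℝ → ℝ := fun t => ‖deriv γ t‖ with hn
  have hnc : Continuous n := hv.norm
  have hnpos : ∀ t, 0 < n t := fun t => norm_pos_iff.2 (hreg t)
  have hnper : Function.Periodic n 1 := fun t => by simp only [hn, hvper]
  set L : ℝ := ∫ t in (0 : ℝ)..1, n t with hL
  have hLpos : 0 < L :=
    intervalIntegral.intervalIntegral_pos_of_pos (hnc.intervalIntegrable _ _) hnpos zero_lt_one
  set s : ℝ → ℝ := fun t => (∫ u in (0 : ℝ)..t, n u) / L with hs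
  have hsd : ∀ t, HasDerivAt s (n t / L) t := fun t =>
    (intervalIntegral.integral_hasDerivAt_right (hnc.intervalIntegrable _ _)
      (hnc.stronglyMeasurableAtFilter _ _) hnc.continuousAt).div_const L
  have hsmono : StrictMono s := strictMono_of_hasDerivAt_pos hsd fun t => div_pos (hnpos t) hLpos
  have hs0 : s 0 = 0 := by simp [hs]
  have hs1 : ∀ t, s (t + 1) = s t + 1 := by
    intro t
    have : ∫ u in (0 : ℝ)..(t + 1), n u = (∫ u in (0 : ℝ)..t, n u) + L := by
      rw [← intervalIntegral.integral_add_adjacent_intervals (b := t)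
        (hnc.intervalIntegrable _ _) (hnc.intervalIntegrable _ _),
        hnper.intervalIntegral_add_eq t 0, zero_add]
    simp only [hs]
    rw [this, add_div, div_self hLpos.ne']
  have hsz : ∀ k : ℕ, s k = k ∧ s (-k) = -k := by
    intro k
    induction k with
    | zero => simp [hs0]
    | succ k ih =>
      push_cast
      refine ⟨by rw [hs1, ih.1], ?_⟩
      have := hs1 (-(k + 1 : ℝ))
      rw [show -(k + 1 : ℝ) + 1 = -k by ring, ih.2] at this
      linarith
  have hscont : Continuous s := continuous_iff_continuousAt.2 fun t => (hsd t).continuousAt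
  have hsurj : Function.Surjective s := by
    refine hscont.surjective ?_ ?_
    · refine tendsto_atTop.2 fun b => ?_
      obtain ⟨k, hk⟩ := exists_nat_ge b
      filter_upwards [eventually_ge_atTop (k : ℝ)] with x hx
      exact hk.trans ((hsz k).1.symm.le.trans (hsmono.monotone hx))
    · refine tendsto_atBot.2 fun b => ?_
      obtain ⟨k, hk⟩ := exists_nat_ge (-b)
      filter_upwards [eventually_le_atBot (-k : ℝ)] with x hx
      exact (hsmono.monotone hx).trans ((hsz k).2.le.trans (by linarith))
  let e := hsmono.orderIsoOfSurjective s hsurj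
  have hse : ∀ x, s (e.symm x) = x := fun x => e.apply_symm_apply x
  have hσc : Continuous e.symm := e.symm.continuous
  have hσd : ∀ x, HasDerivAt e.symm (n (e.symm x) / L)⁻¹ x := fun x =>
    HasDerivAt.of_local_left_inverse hσc.continuousAt (hsd _)
      (div_pos (hnpos _) hLpos).ne' (Eventually.of_forall hse)
  have hσ1 : ∀ x, e.symm (x + 1) = e.symm x + 1 := by
    intro x
    apply hsmono.injective
    rw [hs1, hse, hse]
  have hσ0 : e.symm 0 = 0 := hsmono.injective (by rw [hse, hs0])
  refine ⟨γ ∘ e.symm, fun x => (n (e.symm x) / L)⁻¹ • deriv γ (e.symm x), L, ⟨?_, ?_, ?_, ?_⟩,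
    hLpos, ?_, ?_⟩
  · exact fun x => (hd _).scomp x (hσd x)
  · have : Continuous fun x => (n (e.symm x) / L)⁻¹ :=
      ((hnc.comp hσc).div_const L).inv₀ fun x => (div_pos (hnpos _) hLpos).ne'
    exact this.smul (hv.comp hσc)
  · intro x
    simp only [Function.comp, hσ1]
    exact hper _
  · intro x
    have h1 := hnpos (e.symm x)
    rw [norm_smul, norm_inv, Real.norm_of_nonneg (by positivity)]
    change (n (e.symm x) / L)⁻¹ * n (e.symm x) = L
    field_simp
  · have hI : ∀ x ∈ Set.Ico (0 : ℝ) 1, e.symm x ∈ Set.Ico (0 : ℝ) 1 := by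
      intro x hx
      constructor
      · rw [← hσ0]; exact e.symm.monotone hx.1
      · have := e.symm.strictMono hx.2
        rw [show (1 : ℝ) = 0 + 1 by ring, hσ1, hσ0] at this
        linarith
    intro x hx y hy hxy
    exact e.symm.injective (hinj _ (hI x hx) _ (hI y hy) hxy)
  · exact e.symm.surjective.range_comp γ

/-- A bounded planar domain whose boundary is a disjoint union of constant speed Jordan curves. -/
structure CurveDomain (Ω : Set (Eu 2)) {N : ℕ} (γ γ' : Fin N → ℝ → Eu 2) (ℓ : Fin N → ℝ) :
    Prop where
  isOpen : IsOpen Ω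
  isConnected : IsConnected Ω
  isBounded : Bornology.IsBounded Ω
  curve : ∀ i, ClosedCurve (γ i) (γ' i) (ℓ i)
  pos : ∀ i, 0 < ℓ i
  inj : ∀ i, Set.InjOn (γ i) (Set.Ico 0 1)
  disj : ∀ i j, i ≠ j → Disjoint (Set.range (γ i)) (Set.range (γ j))
  frontier_eq : frontier Ω = ⋃ i, Set.range (γ i)

lemma IsC2Domain.exists_curveDomain {Ω : Set (Eu 2)} (h : IsC2Domain Ω) :
    ∃ (N : ℕ) (γ γ' : Fin N → ℝ → Eu 2) (ℓ : Fin N → ℝ), CurveDomain Ω γ γ' ℓ := by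
  obtain ⟨ho, hc, hb, N, γ, hγ, hd, hf⟩ := h
  choose η η' ℓ hη hℓ hi hr using fun i => (hγ i).exists_constant_speed
  exact ⟨N, η, η', ℓ, ho, hc, hb, hη, hℓ, hi, fun i j hij => by
    rw [hr, hr]; exact hd i j hij, by simp only [hr, hf]⟩

lemma volume_le_of_antilipschitz_on {γ : ℝ → Eu 2} {J : Set ℝ} {c : ℝ} (hc : 0 < c)
    (h : ∀ s ∈ J, ∀ t ∈ J, c * |t - s| ≤ ‖γ t - γ s‖) :
    ENNReal.ofReal c * volume J ≤ μH[1] (γ '' J) := by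
  have hinj : Set.InjOn γ J := by
    intro s hs t ht hst
    have := h s hs t ht
    rw [hst, sub_self, norm_zero] at this
    have h2 : |t - s| = 0 := le_antisymm (by nlinarith) (abs_nonneg _)
    linarith [abs_eq_zero.1 h2]
  have hinv : ∀ s ∈ J, Function.invFunOn γ J (γ s) = s := fun s hs =>
    hinj.leftInvOn_invFunOn hs
  have hL : LipschitzOnWith (Real.toNNReal c⁻¹) (Function.invFunOn γ J) (γ '' J) := by
    refine LipschitzOnWith.of_dist_le_mul ?_
    rintro _ ⟨s, hs, rfl⟩ _ ⟨t, ht, rfl⟩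
    rw [hinv s hs, hinv t ht, Real.coe_toNNReal _ (by positivity), dist_eq_norm, dist_eq_norm,
      inv_mul_eq_div, le_div_iff₀ hc, Real.norm_eq_abs, mul_comm]
    exact h t ht s hs
  have h1 := hL.hausdorffMeasure_image_le (d := 1) zero_le_one
  have h2 : Function.invFunOn γ J '' (γ '' J) = J := by
    rw [Set.image_image]
    exact (Set.image_congr hinv).trans (Set.image_id' J)
  rw [h2, hausdorffMeasure_real, ENNReal.rpow_one] at h1
  calc ENNReal.ofReal c * volume J
      ≤ ENNReal.ofReal c * (ENNReal.ofReal c⁻¹ * μH[1] (γ '' J)) := by gcongr; exact h1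
    _ = μH[1] (γ '' J) := by
      rw [← mul_assoc, ← ENNReal.ofReal_mul hc.le, mul_inv_cancel₀ hc.ne']
      simp

namespace ClosedCurve

variable {γ γ' : ℝ → Eu 2} {ℓ : ℝ}

lemma range_eq_image (h : ClosedCurve γ γ' ℓ) : Set.range γ = γ '' Set.Ico 0 1 := by
  refine Set.Subset.antisymm ?_ (Set.image_subset_range _ _)
  rintro _ ⟨x, rfl⟩
  obtain ⟨y, hy, hxy⟩ := h.per.exists_mem_Ico₀ one_pos x
  exact ⟨y, hy, hxy.symm⟩

lemma lipschitzWith (h : ClosedCurve γ γ' ℓ) : LipschitzWith ℓ.toNNReal γ := by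
  refine LipschitzWith.of_dist_le_mul fun s t => ?_
  rw [Real.coe_toNNReal _ h.speed_nonneg, dist_eq_norm, dist_eq_norm]
  exact h.lipschitz t s

lemma le_hausdorffMeasure_image (h : ClosedCurve γ γ' ℓ) (hinj : Set.InjOn γ (Set.Ico 0 1))
    {c : ℝ} (hc : 0 < c) (hcℓ : c < ℓ) {A : Set ℝ} (hA : MeasurableSet A)
    (hA1 : A ⊆ Set.Ico 0 1) : ENNReal.ofReal c * volume A ≤ μH[1] (γ '' A) := by
  obtain ⟨d, hd, hunif⟩ := Metric.uniformContinuousOn_iff.1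
    ((isCompact_Icc (a := (0 : ℝ)) (b := 1)).uniformContinuousOn_of_continuous
      h.cont.continuousOn) (ℓ - c) (by linarith)
  obtain ⟨n, hn⟩ := exists_nat_gt d⁻¹
  have hnpos : (0 : ℝ) < n := (inv_pos.2 hd).trans hn
  set J : ℕ → Set ℝ := fun k => A ∩ (fun t : ℝ => ⌊n * t⌋₊) ⁻¹' {k} with hJ
  have hJm : ∀ k, MeasurableSet (J k) := fun k =>
    hA.inter ((Nat.measurable_floor.comp (measurable_const_mul (n : ℝ))) (measurableSet_singleton k))
  have hJu : ⋃ k, J k = A := by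
    rw [hJ, ← Set.inter_iUnion]
    exact Set.inter_eq_left.2 fun t _ => Set.mem_iUnion.2 ⟨_, rfl⟩
  have hJd : Pairwise (Function.onFun Disjoint J) := by
    intro k l hkl
    refine Set.disjoint_left.2 fun t ht ht' => hkl ?_
    exact ht.2.symm.trans ht'.2
  have hanti : ∀ k, ∀ s ∈ J k, ∀ t ∈ J k, c * |t - s| ≤ ‖γ t - γ s‖ := by
    intro k s hs t ht
    have hs1 := hA1 hs.1
    have ht1 := hA1 ht.1
    have hst : |t - s| < d := by
      have e1 : (⌊n * s⌋₊ : ℝ) = k := by exact_mod_cast hs.2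
      have e2 : (⌊n * t⌋₊ : ℝ) = k := by exact_mod_cast ht.2
      have a1 := Nat.floor_le (mul_nonneg hnpos.le hs1.1)
      have a2 := Nat.lt_floor_add_one (n * s)
      have a3 := Nat.floor_le (mul_nonneg hnpos.le ht1.1)
      have a4 := Nat.lt_floor_add_one (n * t)
      rw [e1] at a1 a2
      rw [e2] at a3 a4
      have a5 : n * |t - s| < 1 := by
        rw [← abs_of_pos hnpos, ← abs_mul, abs_lt]
        constructor <;> nlinarith
      have a6 : 1 < n * d := by
        rw [inv_lt_iff_one_lt_mul₀ hd] at hn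
        linarith
      nlinarith
    have hconv : Convex ℝ (Set.uIcc s t) := convex_uIcc s t
    have hmv := hconv.norm_image_sub_le_of_norm_hasDerivWithin_le
      (f := fun x => γ x - x • γ' s) (f' := fun x => γ' x - γ' s) (C := ℓ - c)
      (fun x _ => by
        have := ((h.deriv x).sub ((hasDerivAt_id x).smul_const (γ' s))).hasDerivWithinAt
          (s := Set.uIcc s t)
        rwa [one_smul] at this)
      (fun x hx => by
        have hxI : x ∈ Set.Icc (0 : ℝ) 1 :=
          (Set.uIcc_subset_Icc ⟨hs1.1, hs1.2.le⟩ ⟨ht1.1, ht1.2.le⟩) hx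
        rw [← dist_eq_norm]
        refine (hunif x hxI s ⟨hs1.1, hs1.2.le⟩ ?_).le
        rw [Real.dist_eq]
        exact (Set.abs_sub_left_of_mem_uIcc hx).trans_lt hst)
      Set.left_mem_uIcc Set.right_mem_uIcc
    have e : γ t - γ s = (γ t - t • γ' s - (γ s - s • γ' s)) + (t - s) • γ' s := by
      rw [sub_smul]; abel
    have h2 : ‖(t - s) • γ' s‖ = ℓ * |t - s| := by
      rw [norm_smul, h.speed, Real.norm_eq_abs, mul_comm]
    have h3 := norm_sub_norm_le ((t - s) • γ' s) (-(γ t - t • γ' s - (γ s - s • γ' s)))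
    rw [e, add_comm]
    rw [norm_neg, sub_neg_eq_add, h2] at h3
    rw [Real.norm_eq_abs] at hmv
    linarith
  calc ENNReal.ofReal c * volume A = ENNReal.ofReal c * ∑' k, volume (J k) := by
        rw [← measure_iUnion hJd hJm, hJu]
    _ = ∑' k, ENNReal.ofReal c * volume (J k) := ENNReal.tsum_mul_left.symm
    _ ≤ ∑' k, μH[1] (γ '' J k) :=
        ENNReal.tsum_le_tsum fun k => volume_le_of_antilipschitz_on hc (hanti k)
    _ = μH[1] (⋃ k, γ '' J k) := by
        refine (measure_iUnion ?_ fun k => ?_).symm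
        · intro k l hkl
          refine Set.disjoint_left.2 ?_
          rintro _ ⟨s, hs, rfl⟩ ⟨t, ht, hst⟩
          have := hinj (hA1 ht.1) (hA1 hs.1) hst
          subst this
          exact Set.disjoint_left.1 (hJd hkl) hs ht
        · exact (hJm k).image_of_continuousOn_injOn h.continuous.continuousOn
            (hinj.mono (Set.inter_subset_left.trans hA1))
    _ = μH[1] (γ '' A) := by rw [← Set.image_iUnion, hJu]

/-- Arc length measure on a constant speed Jordan curve is the push-forward of Lebesgue measure. -/
lemma hausdorffMeasure_restrict_range (h : ClosedCurve γ γ' ℓ) (hℓ : 0 < ℓ)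
    (hinj : Set.InjOn γ (Set.Ico 0 1)) :
    (μH[1] : Measure (Eu 2)).restrict (Set.range γ)
      = ENNReal.ofReal ℓ • (volume.restrict (Set.Ico 0 1)).map γ := by
  have hm : Measurable γ := h.continuous.measurable
  ext S hS
  rw [Measure.restrict_apply hS, Measure.smul_apply, Measure.map_apply hm hS,
    Measure.restrict_apply (hm hS), smul_eq_mul]
  have e : S ∩ Set.range γ = γ '' (γ ⁻¹' S ∩ Set.Ico 0 1) := by
    rw [h.range_eq_image, Set.inter_comm (γ ⁻¹' S), Set.image_inter_preimage, Set.inter_comm]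
  rw [e]
  refine le_antisymm ?_ ?_
  · have := (h.lipschitzWith.lipschitzOnWith (s := γ ⁻¹' S ∩ Set.Ico 0 1)).hausdorffMeasure_image_le
      (d := 1) zero_le_one
    rw [hausdorffMeasure_real, ENNReal.rpow_one] at this
    exact this
  · set V := volume (γ ⁻¹' S ∩ Set.Ico 0 1)
    have hb : ∀ c ∈ Set.Ioo 0 ℓ,
        ENNReal.ofReal c * V ≤ μH[1] (γ '' (γ ⁻¹' S ∩ Set.Ico 0 1)) := fun c hc =>
      h.le_hausdorffMeasure_image hinj hc.1 hc.2 ((hm hS).inter measurableSet_Ico)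
        Set.inter_subset_right
    have hV : V ≠ ⊤ := ((measure_mono Set.inter_subset_right).trans_lt (by simp)).ne
    have ht : Tendsto (fun c => ENNReal.ofReal c * V) (nhdsWithin ℓ (Set.Iio ℓ))
        (nhds (ENNReal.ofReal ℓ * V)) :=
      (ENNReal.Tendsto.mul_const (ENNReal.continuous_ofReal.tendsto ℓ) (Or.inr hV)).mono_left
        nhdsWithin_le_nhds
    refine le_of_tendsto ht ?_
    filter_upwards [Ioo_mem_nhdsLT hℓ] with c hc using hb c hc

end ClosedCurve

lemma ClosedCurve.integral_range {γ γ' : ℝ → Eu 2} {ℓ : ℝ} (h : ClosedCurve γ γ' ℓ) (hℓ : 0 < ℓ)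
    (hinj : Set.InjOn γ (Set.Ico 0 1)) {f : Eu 2 → ℝ} (hf : Continuous f) :
    IntegrableOn f (Set.range γ) μH[1] ∧
      ∫ x in Set.range γ, f x ∂μH[1] = ℓ * ∫ t in (0 : ℝ)..1, f (γ t) := by
  have hm := h.continuous.measurable
  have hi : IntegrableOn (fun t => f (γ t)) (Set.Ico 0 1) volume :=
    ((hf.comp h.continuous).integrableOn_Icc).mono_set Set.Ico_subset_Icc_self
  rw [IntegrableOn, h.hausdorffMeasure_restrict_range hℓ hinj]
  constructor
  · refine Integrable.smul_measure ?_ ENNReal.ofReal_ne_top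
    exact (integrable_map_measure hf.aestronglyMeasurable hm.aemeasurable).2 hi
  · rw [integral_smul_measure, integral_map hm.aemeasurable hf.aestronglyMeasurable,
      ENNReal.toReal_ofReal hℓ.le, integral_Ico_eq_integral_Ioc,
      ← intervalIntegral.integral_of_le zero_le_one, smul_eq_mul]

namespace CurveDomain

variable {Ω : Set (Eu 2)} {N : ℕ} {γ γ' : Fin N → ℝ → Eu 2} {ℓ : Fin N → ℝ}

lemma isCompact_range (h : CurveDomain Ω γ γ' ℓ) (i : Fin N) : IsCompact (Set.range (γ i)) := by
  rw [(h.curve i).range_eq_image]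
  have : γ i '' Set.Ico 0 1 = γ i '' Set.Icc 0 1 := by
    rw [← (h.curve i).range_eq_image]
    refine Set.Subset.antisymm ?_ (Set.image_subset_range _ _)
    rw [(h.curve i).range_eq_image]
    exact Set.image_mono Set.Ico_subset_Icc_self
  rw [this]
  exact isCompact_Icc.image (h.curve i).continuous

lemma integral_frontier (h : CurveDomain Ω γ γ' ℓ) {f : Eu 2 → ℝ} (hf : Continuous f) :
    ∫ x in frontier Ω, f x ∂μH[1] = ∑ i, ℓ i * ∫ t in (0 : ℝ)..1, f (γ i t) := by
  rw [h.frontier_eq, integral_iUnion_fintype]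
  · exact Finset.sum_congr rfl fun i _ => ((h.curve i).integral_range (h.pos i) (h.inj i) hf).2
  · exact fun i => (h.isCompact_range i).measurableSet
  · exact fun i j hij => h.disj i j hij
  · exact fun i => ((h.curve i).integral_range (h.pos i) (h.inj i) hf).1

end CurveDomain

/-- The identification of `ℝ × ℝ` with the Euclidean plane. -/
def euEquiv : ℝ × ℝ ≃ᵐ Eu 2 :=
  (MeasurableEquiv.finTwoArrow (α := ℝ)).symm.trans (MeasurableEquiv.toLp 2 (Fin 2 → ℝ))

@[simp] lemma euEquiv_apply_zero (p : ℝ × ℝ) : euEquiv p 0 = p.1 := rfl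

@[simp] lemma euEquiv_apply_one (p : ℝ × ℝ) : euEquiv p 1 = p.2 := rfl

lemma measurePreserving_euEquiv : MeasurePreserving euEquiv :=
  ((volume_preserving_finTwoArrow ℝ).symm _).trans (PiLp.volume_preserving_toLp (Fin 2))

/-- The linear map with columns `a` and `b`. -/
def columnMap (a b : Eu 2) : ℝ × ℝ →L[ℝ] ℝ × ℝ :=
  (Matrix.toLin (Module.Basis.finTwoProd ℝ) (Module.Basis.finTwoProd ℝ)
    !![a 0, b 0; a 1, b 1]).toContinuousLinearMap

lemma columnMap_apply (a b : Eu 2) (p : ℝ × ℝ) :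
    columnMap a b p = (p.1 * a 0 + p.2 * b 0, p.1 * a 1 + p.2 * b 1) := by
  simp [columnMap, Matrix.toLin_finTwoProd_apply, mul_comm]

lemma det_columnMap (a b : Eu 2) : (columnMap a b).det = cross a b := by
  simp [columnMap, ContinuousLinearMap.det, Matrix.det_fin_two, cross]
  ring

/-- Tubular coordinates along a curve in a fixed transversal direction. -/
def tube (γ : ℝ → Eu 2) (v : Eu 2) (p : ℝ × ℝ) : Eu 2 := γ p.1 + p.2 • v

lemma hasFDerivAt_euEquiv_symm_tube {γ : ℝ → Eu 2} {w v : Eu 2} {p : ℝ × ℝ}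
    (h : HasDerivAt γ w p.1) :
    HasFDerivAt (fun q => euEquiv.symm (tube γ v q)) (columnMap w v) p := by
  have h1 : ∀ i : Fin 2, HasFDerivAt (fun q : ℝ × ℝ => tube γ v q i)
      (w i • ContinuousLinearMap.fst ℝ ℝ ℝ + v i • ContinuousLinearMap.snd ℝ ℝ ℝ) p := by
    intro i
    have a : HasFDerivAt (fun q : ℝ × ℝ => γ q.1 i) (w i • ContinuousLinearMap.fst ℝ ℝ ℝ) p :=
      (hasDerivAt_coord h i).comp_hasFDerivAt p hasFDerivAt_fst
    have b : HasFDerivAt (fun q : ℝ × ℝ => q.2 * v i) (v i • ContinuousLinearMap.snd ℝ ℝ ℝ) p :=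
      hasFDerivAt_snd.mul_const (v i)
    exact a.add b
  refine ((h1 0).prodMk (h1 1)).congr_fderiv ?_
  refine ContinuousLinearMap.ext fun q => ?_
  rw [columnMap_apply]
  simp [mul_comm]

lemma integral_image_tube {γ γ' : ℝ → Eu 2} {v : Eu 2} {Q : Set (ℝ × ℝ)} (hQ : MeasurableSet Q)
    (hγ : ∀ t, HasDerivAt γ (γ' t) t) (hinj : Set.InjOn (tube γ v) Q)
    (hpos : ∀ p ∈ Q, 0 < cross (γ' p.1) v) (f : Eu 2 → ℝ) :
    ∫ x in tube γ v '' Q, f x = ∫ p in Q, cross (γ' p.1) v * f (tube γ v p) := by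
  have e : tube γ v '' Q = euEquiv '' ((fun q => euEquiv.symm (tube γ v q)) '' Q) := by
    rw [Set.image_image]; simp
  rw [e, measurePreserving_euEquiv.setIntegral_image_emb euEquiv.measurableEmbedding,
    integral_image_eq_integral_abs_det_fderiv_smul volume hQ
      (fun p _ => (hasFDerivAt_euEquiv_symm_tube (hγ p.1)).hasFDerivWithinAt)
      (fun p hp q hq hpq => hinj hp hq (euEquiv.symm.injective hpq))]
  refine setIntegral_congr_fun hQ fun p hp => ?_
  simp [det_columnMap, abs_of_pos (hpos p hp)]

lemma ClosedCurve.eq_of_abs_sub_lt_one {γ γ' : ℝ → Eu 2} {ℓ : ℝ} (h : ClosedCurve γ γ' ℓ)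
    (hinj : Set.InjOn γ (Set.Ico 0 1)) {s t : ℝ} (hst : γ s = γ t) (hlt : |s - t| < 1) : s = t := by
  have hf : ∀ x, γ (Int.fract x) = γ x := fun x => by
    have := h.per.sub_int_mul_eq (x := x) ⌊x⌋
    rwa [mul_one] at this
  have h1 : Int.fract s = Int.fract t :=
    hinj ⟨Int.fract_nonneg s, Int.fract_lt_one s⟩ ⟨Int.fract_nonneg t, Int.fract_lt_one t⟩
      (by rw [hf, hf, hst])
  obtain ⟨z, hz⟩ := Int.fract_eq_fract.1 h1
  rw [hz] at hlt
  have : |z| < 1 := by exact_mod_cast hlt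
  rw [Int.abs_lt_one_iff] at this
  rw [this] at hz
  simpa [sub_eq_zero] using hz

lemma continuous_tube {γ : ℝ → Eu 2} (hγ : Continuous γ) (v : Eu 2) : Continuous (tube γ v) := by
  unfold tube; fun_prop

/-- The open set covered by tubular coordinates of width `δ` around the parameter `t₀`. -/
def tubeSet (γ : ℝ → Eu 2) (v : Eu 2) (t₀ δ : ℝ) : Set (Eu 2) :=
  tube γ v '' (Set.Ioo (t₀ - δ) (t₀ + δ) ×ˢ Set.Ioo (-δ) δ)

/-- Tubular coordinates that straighten the boundary of `Ω` near `γ t₀`. -/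
structure IsPatch (Ω : Set (Eu 2)) (γ γ' : ℝ → Eu 2) (v : Eu 2) (t₀ δ : ℝ) : Prop where
  pos : 0 < δ
  lt_half : δ < 1 / 2
  cross_pos : ∀ t ∈ Set.Icc (t₀ - δ) (t₀ + δ), 0 < cross (γ' t) v
  inj : Set.InjOn (tube γ v) (Set.Icc (t₀ - δ) (t₀ + δ) ×ˢ Set.univ)
  isOpen : IsOpen (tubeSet γ v t₀ δ)
  eq_zero : ∀ p ∈ Set.Icc (t₀ - δ) (t₀ + δ) ×ˢ Set.Icc (-δ) δ, tube γ v p ∈ frontier Ω → p.2 = 0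

lemma injOn_tube {γ γ' : ℝ → Eu 2} {v : Eu 2} {a b : ℝ} (hγ : ∀ t, HasDerivAt γ (γ' t) t)
    (hpos : ∀ t ∈ Set.Icc a b, 0 < cross (γ' t) v) :
    Set.InjOn (tube γ v) (Set.Icc a b ×ˢ Set.univ) := by
  have hd : ∀ t, HasDerivAt (fun t => cross (γ t) v) (cross (γ' t) v) t := fun t =>
    ((hasDerivAt_coord (hγ t) 0).mul_const (v 1)).sub ((hasDerivAt_coord (hγ t) 1).mul_const (v 0))
  have hmono : StrictMonoOn (fun t => cross (γ t) v) (Set.Icc a b) := by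
    refine strictMonoOn_of_deriv_pos (convex_Icc a b)
      (fun t _ => (hd t).continuousAt.continuousWithinAt) fun t ht => ?_
    rw [(hd t).deriv]
    exact hpos t (interior_subset ht)
  rintro ⟨t, s⟩ ⟨ht, -⟩ ⟨t', s'⟩ ⟨ht', -⟩ h
  have hc : ∀ (t s : ℝ), cross (tube γ v (t, s)) v = cross (γ t) v := by
    intro t s; simp [cross, tube]; ring
  have h1 : t = t' := by
    refine hmono.injOn ht ht' ?_
    have := congrArg (fun x => cross x v) h
    simpa only [hc] using this
  subst h1
  have hv : v ≠ 0 := by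
    rintro rfl
    simpa [cross] using hpos t ht
  have h2 : s • v = s' • v := by simpa [tube] using h
  rw [smul_left_injective ℝ hv h2]

lemma isOpen_tubeSet {γ γ' : ℝ → Eu 2} {v : Eu 2} {t₀ δ : ℝ} (hγ : ∀ t, HasDerivAt γ (γ' t) t)
    (hγ' : Continuous γ') (hpos : ∀ t ∈ Set.Icc (t₀ - δ) (t₀ + δ), 0 < cross (γ' t) v) :
    IsOpen (tubeSet γ v t₀ δ) := by
  have hcont : Continuous γ := continuous_iff_continuousAt.2 fun t => (hγ t).continuousAt
  rw [isOpen_iff_mem_nhds]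
  rintro _ ⟨p, hp, rfl⟩
  have hp' : cross (γ' p.1) v ≠ 0 := (hpos p.1 ⟨hp.1.1.le, hp.1.2.le⟩).ne'
  set T : ℝ × ℝ → (ℝ × ℝ →L[ℝ] Eu 2) := fun q =>
    (ContinuousLinearMap.fst ℝ ℝ ℝ).smulRight (γ' q.1) +
      (ContinuousLinearMap.snd ℝ ℝ ℝ).smulRight v with hT
  have hd : ∀ q, HasFDerivAt (tube γ v) (T q) q := by
    intro q
    have a : HasFDerivAt (fun q : ℝ × ℝ => γ q.1)
        ((ContinuousLinearMap.fst ℝ ℝ ℝ).smulRight (γ' q.1)) q := by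
      have := (hγ q.1).hasFDerivAt.comp q (hasFDerivAt_fst (𝕜 := ℝ) (E := ℝ) (F := ℝ) (p := q))
      refine this.congr_fderiv (ContinuousLinearMap.ext fun x => ?_)
      simp
    have b : HasFDerivAt (fun q : ℝ × ℝ => q.2 • v)
        ((ContinuousLinearMap.snd ℝ ℝ ℝ).smulRight v) q :=
      hasFDerivAt_snd.smul_const v
    exact a.add b
  have hTc : Continuous T := by
    rw [hT]
    have h0 : Continuous fun q : ℝ × ℝ => γ' q.1 := hγ'.comp continuous_fst
    refine Continuous.add ?_ continuous_const
    exact ((ContinuousLinearMap.smulRightL ℝ (ℝ × ℝ) (Eu 2))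
      (ContinuousLinearMap.fst ℝ ℝ ℝ)).continuous.comp h0
  have hs : HasStrictFDerivAt (tube γ v) (T p) p :=
    hasStrictFDerivAt_of_hasFDerivAt_of_continuousAt (Eventually.of_forall hd) hTc.continuousAt
  have hsurj : (T p).range = ⊤ := by
    rw [LinearMap.range_eq_top]
    intro y
    refine ⟨(cross y v / cross (γ' p.1) v, cross (γ' p.1) y / cross (γ' p.1) v), ?_⟩
    ext i
    fin_cases i <;> simp [hT] <;> field_simp <;> simp [cross] <;> ring
  rw [← hs.map_nhds_eq_of_surj hsurj]
  exact image_mem_map ((isOpen_Ioo.prod isOpen_Ioo).mem_nhds hp)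

lemma CurveDomain.exists_isPatch {Ω : Set (Eu 2)} {N : ℕ} {γ γ' : Fin N → ℝ → Eu 2}
    {ℓ : Fin N → ℝ} (h : CurveDomain Ω γ γ' ℓ) (i : Fin N) (t₀ : ℝ) :
    ∃ v δ, IsPatch Ω (γ i) (γ' i) v t₀ δ ∧
      ∀ j ≠ i, Disjoint (tubeSet (γ i) v t₀ δ) (Set.range (γ j)) := by
  have hi := h.curve i
  set v : Eu 2 := !₂[-(γ' i t₀ 1), γ' i t₀ 0] with hv
  have hv0 : 0 < cross (γ' i t₀) v := by
    have : cross (γ' i t₀) v = ‖γ' i t₀‖ ^ 2 := by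
      rw [Eu.norm_sq_eq]; simp [cross, hv]; ring
    rw [this, hi.speed]
    exact pow_pos (h.pos i) 2
  have hcc : Continuous fun t => cross (γ' i t) v := continuous_cross hi.cont continuous_const
  obtain ⟨ε, hε, hε'⟩ := Metric.mem_nhds_iff.1 (hcc.continuousAt.eventually (lt_mem_nhds hv0))
  set δ₁ : ℝ := min (ε / 2) (1 / 4) with hδ₁
  have hδ₁pos : 0 < δ₁ := by positivity
  have hδ₁4 : δ₁ ≤ 1 / 4 := min_le_right _ _
  have hδ₁ε : δ₁ < ε := (min_le_left _ _).trans_lt (by linarith)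
  have hpos : ∀ t ∈ Set.Icc (t₀ - δ₁) (t₀ + δ₁), 0 < cross (γ' i t) v := by
    intro t ht
    refine hε' ?_
    rw [mem_ball, Real.dist_eq, abs_lt]
    constructor <;> linarith [ht.1, ht.2]
  have hinj := injOn_tube hi.deriv hpos
  set K : Set (Eu 2) := (⋃ j ∈ ({j | j ≠ i} : Set (Fin N)), Set.range (γ j)) ∪
    γ i '' Set.Icc (t₀ + δ₁) (t₀ - δ₁ + 1) with hK
  have hKc : IsClosed K := by
    refine ((Set.toFinite _).isClosed_biUnion fun j _ => (h.isCompact_range j).isClosed).union ?_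
    exact (isCompact_Icc.image hi.continuous).isClosed
  have hK0 : γ i t₀ ∉ K := by
    rintro (h1 | ⟨t, ht, h1⟩)
    · simp only [Set.mem_iUnion] at h1
      obtain ⟨j, hj, h1⟩ := h1
      exact Set.disjoint_left.1 (h.disj j i hj) h1 ⟨t₀, rfl⟩
    · have := hi.eq_of_abs_sub_lt_one (h.inj i) h1 (by
        rw [abs_lt]; constructor <;> linarith [ht.1, ht.2])
      linarith [ht.1]
  obtain ⟨ρ, hρ, hρ'⟩ := Metric.isOpen_iff.1 hKc.isOpen_compl _ hK0
  set δ : ℝ := min δ₁ (ρ / (2 * (ℓ i + ‖v‖ + 1))) with hδ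
  have hℓ := h.pos i
  have hδpos : 0 < δ := by positivity
  have hδδ₁ : δ ≤ δ₁ := min_le_left _ _
  have hsub : Set.Icc (t₀ - δ) (t₀ + δ) ⊆ Set.Icc (t₀ - δ₁) (t₀ + δ₁) :=
    Set.Icc_subset_Icc (by linarith) (by linarith)
  have hball : ∀ p ∈ Set.Icc (t₀ - δ) (t₀ + δ) ×ˢ Set.Icc (-δ) δ, tube (γ i) v p ∉ K := by
    rintro ⟨t, s⟩ ⟨ht, hs⟩
    dsimp only at ht hs
    refine hρ' ?_
    rw [mem_ball, dist_eq_norm, tube]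
    have e : γ i t + s • v - γ i t₀ = (γ i t - γ i t₀) + s • v := by abel
    have h1 := hi.lipschitz t₀ t
    have h2 : |t - t₀| ≤ δ := by rw [abs_le]; constructor <;> linarith [ht.1, ht.2]
    have h3 : |s| ≤ δ := abs_le.2 hs
    have h4 : δ ≤ ρ / (2 * (ℓ i + ‖v‖ + 1)) := min_le_right _ _
    rw [le_div_iff₀ (by positivity)] at h4
    calc ‖γ i t + s • v - γ i t₀‖ ≤ ℓ i * |t - t₀| + |s| * ‖v‖ := by
          rw [e]
          refine (norm_add_le _ _).trans (add_le_add h1 ?_)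
          rw [norm_smul, Real.norm_eq_abs]
      _ ≤ ℓ i * δ + δ * ‖v‖ := by gcongr
      _ < ρ := by nlinarith
  refine ⟨v, δ, ⟨hδpos, by linarith, fun t ht => hpos t (hsub ht),
    hinj.mono (Set.prod_mono hsub subset_rfl),
    isOpen_tubeSet hi.deriv hi.cont fun t ht => hpos t (hsub ht), ?_⟩, ?_⟩
  · rintro ⟨t, s⟩ hp hfr
    have hnK := hball _ hp
    rw [h.frontier_eq] at hfr
    obtain ⟨j, hj⟩ := Set.mem_iUnion.1 hfr
    by_cases hji : j = i
    · subst hji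
      obtain ⟨u, hu⟩ := hj
      obtain ⟨u', hu', huu⟩ := hi.per.exists_mem_Ico one_pos u (t₀ - δ₁)
      rw [hu] at huu
      rcases lt_or_ge u' (t₀ + δ₁) with h1 | h1
      · have hp1 : (t, s) ∈ Set.Icc (t₀ - δ₁) (t₀ + δ₁) ×ˢ (Set.univ : Set ℝ) := ⟨hsub hp.1, trivial⟩
        have hp2 : (u', (0 : ℝ)) ∈ Set.Icc (t₀ - δ₁) (t₀ + δ₁) ×ˢ (Set.univ : Set ℝ) :=
          ⟨⟨hu'.1, h1.le⟩, trivial⟩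
        have := hinj hp1 hp2 (by rw [huu]; simp [tube])
        exact (Prod.ext_iff.1 this).2
      · exact absurd (Or.inr ⟨u', ⟨h1, hu'.2.le⟩, huu.symm⟩) hnK
    · exact absurd (Or.inl (Set.mem_biUnion (show j ∈ {j | j ≠ i} from hji) hj)) hnK
  · intro j hj
    refine Set.disjoint_left.2 ?_
    rintro _ ⟨p, hp, rfl⟩ hx
    exact hball p ⟨Set.Ioo_subset_Icc_self hp.1, Set.Ioo_subset_Icc_self hp.2⟩
      (Or.inl (Set.mem_biUnion (show j ∈ {j | j ≠ i} from hj) hx))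

lemma ClosedCurve.velocity_periodic {γ γ' : ℝ → Eu 2} {ℓ : ℝ} (h : ClosedCurve γ γ' ℓ) :
    Function.Periodic γ' 1 := by
  intro t
  have h1 : HasDerivAt (fun s => γ (s + 1)) (γ' (t + 1)) t := (h.deriv (t + 1)).comp_add_const t 1
  rw [show (fun s => γ (s + 1)) = γ from funext h.per] at h1
  exact h1.unique (h.deriv t)

lemma cross_smul_decomp (a v w : Eu 2) : cross a v • w = cross w v • a + cross a w • v := by
  ext i
  fin_cases i <;> simp [cross] <;> ring

lemma hasDerivAt_tube_fst {γ : ℝ → Eu 2} {a v : Eu 2} {t : ℝ} (h : HasDerivAt γ a t)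
    {f : Eu 2 → ℝ} (hf : Differentiable ℝ f) (s : ℝ) :
    HasDerivAt (fun t => f (tube γ v (t, s))) (fderiv ℝ f (tube γ v (t, s)) a) t := by
  have h1 : HasDerivAt (fun t => tube γ v (t, s)) a t := h.add_const (s • v)
  exact (hf _).hasFDerivAt.comp_hasDerivAt t h1

lemma hasDerivAt_tube_snd {γ : ℝ → Eu 2} {v : Eu 2} {t : ℝ}
    {f : Eu 2 → ℝ} (hf : Differentiable ℝ f) (s : ℝ) :
    HasDerivAt (fun s => f (tube γ v (t, s))) (fderiv ℝ f (tube γ v (t, s)) v) s := by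
  have h1 : HasDerivAt (fun s => tube γ v (t, s)) v s := by
    simpa [tube] using ((hasDerivAt_id s).smul_const v).const_add (γ t)
  exact (hf _).hasFDerivAt.comp_hasDerivAt s h1

namespace IsPatch

variable {Ω : Set (Eu 2)} {γ γ' : ℝ → Eu 2} {v : Eu 2} {t₀ δ ℓ : ℝ}

lemma eq_zero_of_eq_endpoint (h : IsPatch Ω γ γ' v t₀ δ) {f : Eu 2 → ℝ}
    (hf : ∀ x ∉ tubeSet γ v t₀ δ, f x = 0) {p : ℝ × ℝ}
    (hp : p ∈ Set.Icc (t₀ - δ) (t₀ + δ) ×ˢ Set.univ)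
    (hp' : p ∉ Set.Ioo (t₀ - δ) (t₀ + δ) ×ˢ Set.Ioo (-δ) δ) : f (tube γ v p) = 0 := by
  refine hf _ ?_
  rintro ⟨q, hq, hqp⟩
  have := h.inj ⟨Set.Ioo_subset_Icc_self hq.1, trivial⟩ hp hqp
  exact hp' (this ▸ hq)

lemma integral_strip (hp : IsPatch Ω γ γ' v t₀ δ) (hc : ClosedCurve γ γ' ℓ) {f : Eu 2 → ℝ}
    (hf : ContDiff ℝ 1 f) (hf0 : ∀ x ∉ tubeSet γ v t₀ δ, f x = 0) (w : Eu 2) {a b : ℝ}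
    (hab : a ≤ b) :
    ∫ x in tube γ v '' (Set.Ioo (t₀ - δ) (t₀ + δ) ×ˢ Set.Ioo a b), fderiv ℝ f x w
      = ∫ t in Set.Ioo (t₀ - δ) (t₀ + δ),
          cross (γ' t) w * (f (tube γ v (t, b)) - f (tube γ v (t, a))) := by
  have hd : Differentiable ℝ f := hf.differentiable (by norm_num)
  have hδ := hp.pos
  set I := Set.Ioo (t₀ - δ) (t₀ + δ) with hI
  have hIc : I ⊆ Set.Icc (t₀ - δ) (t₀ + δ) := Set.Ioo_subset_Icc_self
  have hcont := hc.continuous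
  have hcont' := hc.cont
  have htc := continuous_tube hcont v
  have hfd : Continuous (fderiv ℝ f) := hf.continuous_fderiv (by norm_num)
  have hD1 : Continuous fun p : ℝ × ℝ => fderiv ℝ f (tube γ v p) (γ' p.1) :=
    (hfd.comp htc).clm_apply (hcont'.comp continuous_fst)
  have hD2 : Continuous fun p : ℝ × ℝ => fderiv ℝ f (tube γ v p) v :=
    (hfd.comp htc).clm_apply continuous_const
  have hcr : Continuous fun p : ℝ × ℝ => cross (γ' p.1) w :=
    continuous_cross (hcont'.comp continuous_fst) continuous_const
  rw [integral_image_tube (measurableSet_Ioo.prod measurableSet_Ioo) hc.deriv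
    (hp.inj.mono (Set.prod_mono hIc (Set.subset_univ _))) fun p hp' => hp.cross_pos _ (hIc hp'.1)]
  have e : ∀ p : ℝ × ℝ, cross (γ' p.1) v * fderiv ℝ f (tube γ v p) w
      = cross w v * fderiv ℝ f (tube γ v p) (γ' p.1)
        + cross (γ' p.1) w * fderiv ℝ f (tube γ v p) v := by
    intro p
    rw [← smul_eq_mul, ← map_smul, cross_smul_decomp, map_add, map_smul, map_smul]; rfl
  have ion : ∀ {g : ℝ × ℝ → ℝ}, Continuous g → IntegrableOn g (I ×ˢ Set.Ioo a b) := fun hg =>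
    (hg.continuousOn.integrableOn_compact (isCompact_Icc.prod isCompact_Icc)).mono_set
      (Set.prod_mono hIc Set.Ioo_subset_Icc_self)
  simp_rw [e]
  rw [integral_add (ion (by fun_prop)) (ion (by fun_prop))]
  have z1 : ∫ p in I ×ˢ Set.Ioo a b, cross w v * fderiv ℝ f (tube γ v p) (γ' p.1) = 0 := by
    rw [integral_const_mul, Measure.volume_eq_prod, ← Measure.prod_restrict, integral_prod_symm]
    · have : ∀ s : ℝ, ∫ t in I, fderiv ℝ f (tube γ v (t, s)) (γ' t) = 0 := by
        intro s
        rw [hI, ← integral_Ioc_eq_integral_Ioo, ← intervalIntegral.integral_of_le (by linarith),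
          intervalIntegral.integral_eq_sub_of_hasDerivAt
            (fun t _ => hasDerivAt_tube_fst (hc.deriv t) hd s)
            ((hD1.comp (Continuous.prodMk_left s)).intervalIntegrable _ _),
          hp.eq_zero_of_eq_endpoint hf0 ⟨⟨by simp; linarith, by simp⟩, trivial⟩ (by simp),
          hp.eq_zero_of_eq_endpoint hf0 ⟨⟨by simp, by simp; linarith⟩, trivial⟩ (by simp), sub_self]
      simp [this]
    · rw [Measure.prod_restrict, ← Measure.volume_eq_prod]
      exact ion hD1
  rw [z1, zero_add, Measure.volume_eq_prod, setIntegral_prod _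
    (by rw [← Measure.volume_eq_prod]; exact ion (by fun_prop))]
  refine setIntegral_congr_fun measurableSet_Ioo fun t _ => ?_
  dsimp only
  rw [integral_const_mul, ← integral_Ioc_eq_integral_Ioo, ← intervalIntegral.integral_of_le hab,
    intervalIntegral.integral_eq_sub_of_hasDerivAt (fun s _ => hasDerivAt_tube_snd hd s)
      ((hD2.comp (Continuous.prodMk_right t)).intervalIntegrable _ _)]

end IsPatch

lemma subset_or_disjoint_of_disjoint_frontier {X : Type*} [TopologicalSpace X] {S Ω : Set X}
    (hS : IsPreconnected S) (h : Disjoint S (frontier Ω)) : S ⊆ Ω ∨ Disjoint S Ω := by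
  by_contra! hcon
  obtain ⟨h1, h2⟩ := hcon
  rw [Set.not_disjoint_iff] at h2
  obtain ⟨x, hx, hxΩ⟩ := h2
  obtain ⟨y, hy, hyΩ⟩ := Set.not_subset.1 h1
  have hmem : ∀ z ∈ S, z ∈ closure Ω → z ∈ interior Ω := fun z hz hc => by
    by_contra hi
    exact Set.disjoint_left.1 h hz ⟨hc, hi⟩
  obtain ⟨z, -, hz1, hz2⟩ := hS (interior Ω) (closure Ω)ᶜ isOpen_interior
    isClosed_closure.isOpen_compl
    (fun z hz => or_iff_not_imp_right.2 fun hc => hmem z hz (not_not.1 hc))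
    ⟨x, hx, hmem x hx (subset_closure hxΩ)⟩
    ⟨y, hy, fun hc => hyΩ (interior_subset (hmem y hy hc))⟩
  exact hz2 (interior_subset_closure hz1)

namespace IsPatch

variable {Ω : Set (Eu 2)} {γ γ' : ℝ → Eu 2} {v : Eu 2} {t₀ δ ℓ : ℝ}

lemma strip_subset_or_disjoint (hp : IsPatch Ω γ γ' v t₀ δ) (hc : Continuous γ) {a b : ℝ}
    (ha : -δ ≤ a) (hb : b ≤ δ) (h0 : (0 : ℝ) ∉ Set.Ioo a b) :
    tube γ v '' (Set.Ioo (t₀ - δ) (t₀ + δ) ×ˢ Set.Ioo a b) ⊆ Ω ∨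
      Disjoint (tube γ v '' (Set.Ioo (t₀ - δ) (t₀ + δ) ×ˢ Set.Ioo a b)) Ω := by
  refine subset_or_disjoint_of_disjoint_frontier
    ((isPreconnected_Ioo.prod isPreconnected_Ioo).image _ (continuous_tube hc v).continuousOn) ?_
  refine Set.disjoint_left.2 ?_
  rintro _ ⟨p, hp1, rfl⟩ hfr
  have hs : p.2 ∈ Set.Icc (-δ) δ := ⟨ha.trans hp1.2.1.le, hp1.2.2.le.trans hb⟩
  have := hp.eq_zero p ⟨Set.Ioo_subset_Icc_self hp1.1, hs⟩ hfr
  exact h0 (this ▸ hp1.2)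

lemma inter_tubeSet (hp : IsPatch Ω γ γ' v t₀ δ) (hΩ : IsOpen Ω) (hfr : ∀ t, γ t ∈ frontier Ω) :
    Ω ∩ tubeSet γ v t₀ δ
      = (Ω ∩ tube γ v '' (Set.Ioo (t₀ - δ) (t₀ + δ) ×ˢ Set.Ioo 0 δ)) ∪
        (Ω ∩ tube γ v '' (Set.Ioo (t₀ - δ) (t₀ + δ) ×ˢ Set.Ioo (-δ) 0)) := by
  have hδ := hp.pos
  rw [← Set.inter_union_distrib_left]
  refine Set.Subset.antisymm ?_ (Set.inter_subset_inter_right _ (Set.union_subset ?_ ?_))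
  · rintro _ ⟨hxΩ, p, hp1, rfl⟩
    refine ⟨hxΩ, ?_⟩
    rcases lt_trichotomy p.2 0 with h | h | h
    · exact Or.inr ⟨p, ⟨hp1.1, hp1.2.1, h⟩, rfl⟩
    · exfalso
      have : tube γ v p = γ p.1 := by simp [tube, h]
      rw [this] at hxΩ
      have h2 := hfr p.1
      rw [hΩ.frontier_eq] at h2
      exact h2.2 hxΩ
    · exact Or.inl ⟨p, ⟨hp1.1, h, hp1.2.2⟩, rfl⟩
  · exact Set.image_mono (Set.prod_mono_right (Set.Ioo_subset_Ioo_left (by linarith)))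
  · exact Set.image_mono (Set.prod_mono_right (Set.Ioo_subset_Ioo_right hδ.le))

lemma disjoint_strips (hp : IsPatch Ω γ γ' v t₀ δ) :
    Disjoint (tube γ v '' (Set.Ioo (t₀ - δ) (t₀ + δ) ×ˢ Set.Ioo 0 δ))
      (tube γ v '' (Set.Ioo (t₀ - δ) (t₀ + δ) ×ˢ Set.Ioo (-δ) 0)) := by
  refine Set.disjoint_left.2 ?_
  rintro _ ⟨p, hp1, rfl⟩ ⟨q, hq, hqp⟩
  have := hp.inj ⟨Set.Ioo_subset_Icc_self hq.1, trivial⟩ ⟨Set.Ioo_subset_Icc_self hp1.1, trivial⟩ hqp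
  subst this
  exact lt_asymm hq.2.2 hp1.2.1

lemma measurableSet_strip (hp : IsPatch Ω γ γ' v t₀ δ) (hc : Continuous γ) (a b : ℝ) :
    MeasurableSet (tube γ v '' (Set.Ioo (t₀ - δ) (t₀ + δ) ×ˢ Set.Ioo a b)) :=
  (measurableSet_Ioo.prod measurableSet_Ioo).image_of_continuousOn_injOn
    (continuous_tube hc v).continuousOn
    (hp.inj.mono (Set.prod_mono Set.Ioo_subset_Icc_self (Set.subset_univ _)))

lemma integral_period (hp : IsPatch Ω γ γ' v t₀ δ) (hc : ClosedCurve γ γ' ℓ)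
    (hinj : Set.InjOn γ (Set.Ico 0 1)) (hfr : ∀ t, γ t ∈ frontier Ω) {f : Eu 2 → ℝ}
    (hf0 : ∀ x ∉ tubeSet γ v t₀ δ, f x = 0) {g : Eu 2 → ℝ} :
    ∫ t in Set.Ioo (t₀ - δ) (t₀ + δ), f (γ t) * g (γ' t)
      = ∫ t in (0 : ℝ)..1, f (γ t) * g (γ' t) := by
  have hδ := hp.pos
  have hδ2 := hp.lt_half
  have hper : Function.Periodic (fun t => f (γ t) * g (γ' t)) 1 := by
    intro t
    simp only [hc.per t, hc.velocity_periodic t]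
  have h1 := hper.intervalIntegral_add_eq 0 (t₀ - 1 / 2)
  rw [zero_add] at h1
  rw [h1, intervalIntegral.integral_of_le (by linarith)]
  refine (setIntegral_eq_of_subset_of_forall_sdiff_eq_zero measurableSet_Ioc ?_ ?_).symm
  · intro t ht
    exact ⟨by linarith [ht.1], by linarith [ht.2]⟩
  · rintro t ⟨ht, htI⟩
    rw [hf0 (γ t), zero_mul]
    rintro ⟨p, hp1, hpt⟩
    have h0 := hp.eq_zero p ⟨Set.Ioo_subset_Icc_self hp1.1, Set.Ioo_subset_Icc_self hp1.2⟩
      (hpt ▸ hfr t)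
    have h2 : γ p.1 = γ t := by rw [← hpt]; simp [tube, h0]
    have h3 := hc.eq_of_abs_sub_lt_one hinj h2 (by
      rw [abs_lt]; constructor <;> linarith [hp1.1.1, hp1.1.2, ht.1, ht.2])
    exact htI (h3 ▸ hp1.1)

/-- The divergence theorem in a boundary patch. -/
lemma exists_sign (hp : IsPatch Ω γ γ' v t₀ δ) (hc : ClosedCurve γ γ' ℓ)
    (hinj : Set.InjOn γ (Set.Ico 0 1)) (hΩ : IsOpen Ω) (hfr : ∀ t, γ t ∈ frontier Ω) :
    ∃ σ : ℝ, |σ| ≤ 1 ∧ ∀ f : Eu 2 → ℝ, ContDiff ℝ 1 f → HasCompactSupport f →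
      tsupport f ⊆ tubeSet γ v t₀ δ → ∀ w,
      ∫ x in Ω, fderiv ℝ f x w = σ * ∫ t in (0 : ℝ)..1, f (γ t) * cross w (γ' t) := by
  have hδ := hp.pos
  set I := Set.Ioo (t₀ - δ) (t₀ + δ) with hI
  set P := tube γ v '' (I ×ˢ Set.Ioo 0 δ) with hP
  set M := tube γ v '' (I ×ˢ Set.Ioo (-δ) 0) with hM
  have hPm : MeasurableSet P := hp.measurableSet_strip hc.continuous 0 δ
  have hMm : MeasurableSet M := hp.measurableSet_strip hc.continuous (-δ) 0
  have key : ∀ f : Eu 2 → ℝ, ContDiff ℝ 1 f → HasCompactSupport f →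
      tsupport f ⊆ tubeSet γ v t₀ δ → ∀ w,
      (∫ x in Ω, fderiv ℝ f x w
        = (∫ x in Ω ∩ P, fderiv ℝ f x w) + ∫ x in Ω ∩ M, fderiv ℝ f x w) ∧
      (∫ x in P, fderiv ℝ f x w = ∫ t in (0 : ℝ)..1, f (γ t) * cross w (γ' t)) ∧
      (∫ x in M, fderiv ℝ f x w = -∫ t in (0 : ℝ)..1, f (γ t) * cross w (γ' t)) := by
    intro f hf hfc hfs w
    have hf0 : ∀ x ∉ tubeSet γ v t₀ δ, f x = 0 := fun x hx =>
      image_eq_zero_of_notMem_tsupport fun h => hx (hfs h)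
    have h_int : Integrable fun x => fderiv ℝ f x w := by
      refine Continuous.integrable_of_hasCompactSupport
        ((hf.continuous_fderiv (by norm_num)).clm_apply continuous_const) ?_
      exact hfc.fderiv_apply ℝ w
    have hper := hp.integral_period hc hinj hfr hf0 (g := cross w)
    refine ⟨?_, ?_, ?_⟩
    · rw [← setIntegral_union ((hp.disjoint_strips).mono Set.inter_subset_right
        Set.inter_subset_right) (hΩ.measurableSet.inter hMm) h_int.integrableOn h_int.integrableOn,
        ← hp.inter_tubeSet hΩ hfr]
      refine setIntegral_eq_of_subset_of_forall_sdiff_eq_zero hΩ.measurableSet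
        Set.inter_subset_left ?_
      rintro x ⟨hx, hx'⟩
      have : fderiv ℝ f x = 0 := by
        by_contra h
        exact hx' ⟨hx, hfs (support_fderiv_subset ℝ h)⟩
      simp [this]
    · rw [hP, hp.integral_strip hc hf hf0 w hδ.le, ← hper]
      refine setIntegral_congr_fun measurableSet_Ioo fun t ht => ?_
      rw [hp.eq_zero_of_eq_endpoint hf0 ⟨Set.Ioo_subset_Icc_self ht, trivial⟩ (by simp)]
      simp [tube, cross]; ring
    · rw [hM, hp.integral_strip hc hf hf0 w (by linarith), ← hper, ← integral_neg]
      refine setIntegral_congr_fun measurableSet_Ioo fun t ht => ?_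
      rw [hp.eq_zero_of_eq_endpoint hf0 (p := (t, -δ)) ⟨Set.Ioo_subset_Icc_self ht, trivial⟩
        (by simp)]
      simp [tube, cross]; ring
  have hPs := hp.strip_subset_or_disjoint hc.continuous (a := 0) (b := δ) (by linarith) le_rfl
    (by simp)
  have hMs := hp.strip_subset_or_disjoint hc.continuous (a := -δ) (b := 0) le_rfl hδ.le (by simp)
  have hin : ∀ S : Set (Eu 2), S ⊆ Ω → Ω ∩ S = S := fun S h => Set.inter_eq_right.2 h
  have hout : ∀ S : Set (Eu 2), Disjoint S Ω → Ω ∩ S = ∅ := fun S h => by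
    rw [Set.inter_comm]; exact h.inter_eq
  rcases hPs with h1 | h1 <;> rcases hMs with h2 | h2
  · refine ⟨0, by simp, fun f hf hfc hfs w => ?_⟩
    obtain ⟨k1, k2, k3⟩ := key f hf hfc hfs w
    rw [k1, hin P h1, hin M h2, k2, k3]; ring
  · refine ⟨1, by simp, fun f hf hfc hfs w => ?_⟩
    obtain ⟨k1, k2, k3⟩ := key f hf hfc hfs w
    rw [k1, hin P h1, hout M h2, k2]; simp
  · refine ⟨-1, by simp, fun f hf hfc hfs w => ?_⟩
    obtain ⟨k1, k2, k3⟩ := key f hf hfc hfs w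
    rw [k1, hout P h1, hin M h2, k3]; simp
  · refine ⟨0, by simp, fun f hf hfc hfs w => ?_⟩
    obtain ⟨k1, k2, k3⟩ := key f hf hfc hfs w
    rw [k1, hout P h1, hout M h2]; simp

end IsPatch

lemma exists_smooth_partition {K : Set (Eu 2)} (hK : IsCompact K) (U : Eu 2 → Set (Eu 2))
    (hU : ∀ x ∈ K, IsOpen (U x) ∧ x ∈ U x) :
    ∃ (t : Finset (Eu 2)) (χ : t → Eu 2 → ℝ), (∀ k : t, (k : Eu 2) ∈ K) ∧
      (∀ k, ContDiff ℝ 1 (χ k) ∧ HasCompactSupport (χ k) ∧ tsupport (χ k) ⊆ U k ∧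
        ∀ x, 0 ≤ χ k x) ∧ ∀ x ∈ K, ∑ k, χ k x = 1 := by
  have hU' : ∀ x ∈ K, IsOpen (U x ∩ ball x 1) := fun x hx => (hU x hx).1.inter isOpen_ball
  obtain ⟨t, htK, ht⟩ := hK.elim_nhds_subcover (fun x => U x ∩ ball x 1)
    (fun x hx => (hU' x hx).mem_nhds ⟨(hU x hx).2, mem_ball_self one_pos⟩)
  obtain ⟨ρ, hρ⟩ := SmoothPartitionOfUnity.exists_isSubordinate (modelWithCornersSelf ℝ (Eu 2))
    hK.isClosed (fun k : t => U k ∩ ball (k : Eu 2) 1) (fun k => hU' k (htK k k.2))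
    (by simpa [Set.iUnion_subtype] using ht)
  refine ⟨t, fun k => ρ k, fun k => htK k k.2, fun k => ⟨?_, ?_, ?_, ?_⟩, fun x hx => ?_⟩
  · exact (ρ k).contMDiff.contDiff.of_le (by exact_mod_cast le_top)
  · refine HasCompactSupport.of_support_subset_isCompact (isCompact_closedBall (k : Eu 2) 1) ?_
    exact (subset_tsupport _).trans ((hρ k).trans (Set.inter_subset_right.trans
      ball_subset_closedBall))
  · exact (hρ k).trans Set.inter_subset_left
  · exact fun x => ρ.nonneg k x
  · rw [← ρ.sum_eq_one hx, finsum_eq_sum_of_fintype]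

namespace IsPatch

variable {Ω : Set (Eu 2)} {γ γ' : ℝ → Eu 2} {v : Eu 2} {t₀ δ ℓ : ℝ}

lemma mem_tubeSet (hp : IsPatch Ω γ γ' v t₀ δ) {t : ℝ} (ht : t ∈ Set.Ioo (t₀ - δ) (t₀ + δ)) :
    γ t ∈ tubeSet γ v t₀ δ :=
  ⟨(t, 0), ⟨ht, by simp [hp.pos]⟩, by simp [tube]⟩

lemma integral_cross_pos (hp : IsPatch Ω γ γ' v t₀ δ) (hc : ClosedCurve γ γ' ℓ)
    (hinj : Set.InjOn γ (Set.Ico 0 1)) (hfr : ∀ t, γ t ∈ frontier Ω) {f : Eu 2 → ℝ}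
    (hf : Continuous f) (hf0 : ∀ x ∉ tubeSet γ v t₀ δ, f x = 0) (hfn : ∀ x, 0 ≤ f x) {t : ℝ}
    (ht : t ∈ Set.Ioo (t₀ - δ) (t₀ + δ)) (hft : 0 < f (γ t)) :
    0 < ∫ t in (0 : ℝ)..1, f (γ t) * cross (γ' t) v := by
  have hδ := hp.pos
  have hcc := hc.cont
  have hcc' := hc.continuous
  rw [← hp.integral_period hc hinj hfr hf0 (g := fun z => cross z v), ← integral_Ioc_eq_integral_Ioo,
    ← intervalIntegral.integral_of_le (by linarith)]
  have hct : Continuous fun t => f (γ t) * cross (γ' t) v :=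
    (hf.comp hcc').mul (continuous_cross hcc continuous_const)
  refine intervalIntegral.integral_pos (by linarith) hct.continuousOn (fun s hs => ?_) ⟨t, ?_, ?_⟩
  · exact mul_nonneg (hfn _) (hp.cross_pos s ⟨hs.1.le, hs.2⟩).le
  · exact ⟨ht.1.le, ht.2.le⟩
  · exact mul_pos hft (hp.cross_pos t ⟨ht.1.le, ht.2.le⟩)

end IsPatch

namespace CurveDomain

variable {Ω : Set (Eu 2)} {N : ℕ} {γ γ' : Fin N → ℝ → Eu 2} {ℓ : Fin N → ℝ}

lemma mem_frontier (h : CurveDomain Ω γ γ' ℓ) (i : Fin N) (t : ℝ) : γ i t ∈ frontier Ω := by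
  rw [h.frontier_eq]
  exact Set.mem_iUnion.2 ⟨i, t, rfl⟩

/-- The orientation sign of a boundary curve is constant along the curve. -/
lemma exists_sign (h : CurveDomain Ω γ γ' ℓ) (i : Fin N) :
    ∃ σ : ℝ, |σ| ≤ 1 ∧ ∀ t₀, ∃ U, IsOpen U ∧ γ i t₀ ∈ U ∧
      (∀ j ≠ i, Disjoint U (Set.range (γ j))) ∧
      ∀ f : Eu 2 → ℝ, ContDiff ℝ 1 f → HasCompactSupport f → tsupport f ⊆ U → ∀ w,
        ∫ x in Ω, fderiv ℝ f x w = σ * ∫ t in (0 : ℝ)..1, f (γ i t) * cross w (γ' i t) := by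
  have hc := h.curve i
  choose v δ hp hd using h.exists_isPatch i
  choose σ hσ hσf using fun t => (hp t).exists_sign hc (h.inj i) h.isOpen (h.mem_frontier i)
  have hmem : ∀ t, γ i t ∈ tubeSet (γ i) (v t) t (δ t) := fun t =>
    (hp t).mem_tubeSet ⟨by linarith [(hp t).pos], by linarith [(hp t).pos]⟩
  have hloc : IsLocallyConstant σ := by
    rw [IsLocallyConstant.iff_eventually_eq]
    intro t
    have h1 : ∀ᶠ s in nhds t, s ∈ Set.Ioo (t - δ t) (t + δ t) :=
      Ioo_mem_nhds (by linarith [(hp t).pos]) (by linarith [(hp t).pos])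
    filter_upwards [h1] with s hs
    obtain ⟨f, hfs, hfc, hf, hfr, hf1⟩ := exists_contDiff_tsupport_subset (n := 1)
      (((hp t).isOpen.inter (hp s).isOpen).mem_nhds ⟨(hp t).mem_tubeSet hs, hmem s⟩)
    have hft : tsupport f ⊆ tubeSet (γ i) (v t) t (δ t) := hfs.trans Set.inter_subset_left
    have e1 := hσf t f hf hfc hft (v t)
    have e2 := hσf s f hf hfc (hfs.trans Set.inter_subset_right) (v t)
    have hpos := (hp t).integral_cross_pos hc (h.inj i) (h.mem_frontier i) hf.continuous
      (fun x hx => image_eq_zero_of_notMem_tsupport fun h => hx (hft h))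
      (fun x => (hfr ⟨x, rfl⟩).1) hs (by rw [hf1]; exact one_pos)
    have e3 : ∫ r in (0 : ℝ)..1, f (γ i r) * cross (v t) (γ' i r)
        = -∫ r in (0 : ℝ)..1, f (γ i r) * cross (γ' i r) (v t) := by
      rw [← intervalIntegral.integral_neg]
      congr 1; funext r; simp [cross]; ring
    rw [e1, e3] at e2
    exact (mul_right_cancel₀ (neg_ne_zero.2 hpos.ne') e2).symm
  refine ⟨σ 0, hσ 0, fun t => ⟨_, (hp t).isOpen, hmem t, hd t, ?_⟩⟩
  rw [hloc.apply_eq_of_isPreconnected isPreconnected_univ (Set.mem_univ 0) (Set.mem_univ t)]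
  exact hσf t

/-- The Gauss–Green formula on a domain bounded by finitely many closed curves. -/
lemma exists_gauss_green (h : CurveDomain Ω γ γ' ℓ) :
    ∃ σ : Fin N → ℝ, (∀ i, |σ i| ≤ 1) ∧ ∀ f : Eu 2 → ℝ, ContDiff ℝ 1 f → ∀ w,
      ∫ x in Ω, fderiv ℝ f x w
        = ∑ i, σ i * ∫ t in (0 : ℝ)..1, f (γ i t) * cross w (γ' i t) := by
  choose σ hσ U hUo hUm hUd hUf using h.exists_sign
  refine ⟨σ, hσ, ?_⟩
  have hloc : ∀ x ∈ closure Ω, ∃ V, IsOpen V ∧ x ∈ V ∧ ∀ f : Eu 2 → ℝ, ContDiff ℝ 1 f →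
      HasCompactSupport f → tsupport f ⊆ V → ∀ w, ∫ x in Ω, fderiv ℝ f x w
        = ∑ i, σ i * ∫ t in (0 : ℝ)..1, f (γ i t) * cross w (γ' i t) := by
    intro x hx
    by_cases hxΩ : x ∈ Ω
    · refine ⟨Ω, h.isOpen, hxΩ, fun f hf hfc hfs w => ?_⟩
      have hf0 : ∀ i t, f (γ i t) = 0 := fun i t => image_eq_zero_of_notMem_tsupport fun hm => by
        have := h.mem_frontier i t
        rw [h.isOpen.frontier_eq] at this
        exact this.2 (hfs hm)
      simp only [hf0, zero_mul, intervalIntegral.integral_zero, mul_zero, Finset.sum_const_zero]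
      have hcd : Continuous fun x => fderiv ℝ f x w :=
        (hf.continuous_fderiv (by norm_num)).clm_apply continuous_const
      have e1 : ∫ x in Ω, fderiv ℝ f x w = ∫ x, fderiv ℝ f x w := by
        refine setIntegral_eq_integral_of_forall_compl_eq_zero fun y hy => ?_
        have : fderiv ℝ f y = 0 := by
          by_contra hne
          exact hy (hfs (support_fderiv_subset ℝ hne))
        simp [this]
      rw [e1]
      have e2 := integral_mul_fderiv_eq_neg_fderiv_mul_of_integrable (μ := (volume : Measure (Eu 2)))
        (f := fun _ : Eu 2 => (1 : ℝ)) (g := f) (v := w) (by simp)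
        (by simpa using hcd.integrable_of_hasCompactSupport (hfc.fderiv_apply ℝ w))
        (by simpa using hf.continuous.integrable_of_hasCompactSupport hfc)
        (fun _ _ => differentiableAt_const _)
        (fun x _ => hf.differentiable (by norm_num) x)
      simpa using e2
    · have hfr : x ∈ frontier Ω := by rw [h.isOpen.frontier_eq]; exact ⟨hx, hxΩ⟩
      rw [h.frontier_eq] at hfr
      obtain ⟨i, t, rfl⟩ := Set.mem_iUnion.1 hfr
      refine ⟨U i t, hUo i t, hUm i t, fun f hf hfc hfs w => ?_⟩
      rw [hUf i t f hf hfc hfs w]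
      symm
      refine Finset.sum_eq_single i (fun j _ hj => ?_) (by simp)
      have hf0 : ∀ s, f (γ j s) = 0 := fun s => image_eq_zero_of_notMem_tsupport fun hm =>
        Set.disjoint_left.1 (hUd i t j hj) (hfs hm) ⟨s, rfl⟩
      simp [hf0]
  choose! V hVo hVm hVf using hloc
  have hK : IsCompact (closure Ω) := h.isBounded.isCompact_closure
  obtain ⟨t, χ, htK, hχ, hsum⟩ := exists_smooth_partition hK V fun x hx => ⟨hVo x hx, hVm x hx⟩
  intro f hf w
  have hfk : ∀ k, ContDiff ℝ 1 (fun x => χ k x * f x) := fun k => (hχ k).1.mul hf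
  have hfkc : ∀ k, HasCompactSupport (fun x => χ k x * f x) := fun k => (hχ k).2.1.mul_right
  have hfks : ∀ k, tsupport (fun x => χ k x * f x) ⊆ V k := fun k =>
    (tsupport_mul_subset_left (f := χ k) (g := f)).trans (hχ k).2.2.1
  have hk := fun k : t => hVf k (htK k) _ (hfk k) (hfkc k) (hfks k) w
  have e1 : ∫ x in Ω, fderiv ℝ f x w = ∫ x in Ω, ∑ k, fderiv ℝ (fun x => χ k x * f x) x w := by
    refine setIntegral_congr_fun h.isOpen.measurableSet fun x hx => ?_
    have : f =ᶠ[nhds x] fun x => ∑ k, χ k x * f x := by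
      filter_upwards [h.isOpen.mem_nhds hx] with y hy
      rw [← Finset.sum_mul, hsum y (subset_closure hy), one_mul]
    rw [this.fderiv_eq, fderiv_fun_sum fun k _ => (hfk k).differentiable (by norm_num) x]
    simp
  have e2 : ∀ i, ∫ t in (0 : ℝ)..1, f (γ i t) * cross w (γ' i t)
      = ∑ k, ∫ t in (0 : ℝ)..1, (χ k (γ i t) * f (γ i t)) * cross w (γ' i t) := by
    intro i
    have hc := (h.curve i).continuous
    have hc' := (h.curve i).cont
    rw [← intervalIntegral.integral_finsetSum]
    · refine intervalIntegral.integral_congr fun t _ => ?_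
      rw [← Finset.sum_mul, ← Finset.sum_mul, hsum _ (h.mem_frontier i t).1, one_mul]
    · intro k _
      have : Continuous fun t => (χ k (γ i t) * f (γ i t)) * cross w (γ' i t) :=
        ((hfk k).continuous.comp hc).mul (continuous_cross continuous_const hc')
      exact this.intervalIntegrable _ _
  rw [e1, integral_finsetSum]
  · rw [Finset.sum_congr rfl fun k _ => hk k, Finset.sum_comm]
    refine Finset.sum_congr rfl fun i _ => ?_
    rw [e2 i, Finset.mul_sum]
  · intro k _
    have hcd : Continuous fun x => fderiv ℝ (fun x => χ k x * f x) x w :=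
      ((hfk k).continuous_fderiv (by norm_num)).clm_apply continuous_const
    exact (hcd.integrable_of_hasCompactSupport ((hfkc k).fderiv_apply ℝ w)).integrableOn

end CurveDomain

lemma deriv_comp_line {E : Type*} [NormedAddCommGroup E] [NormedSpace ℝ E] (F : E → ℝ) (x v : E)
    (s : ℝ) : deriv (fun s : ℝ => F (x + s • v)) s = lineDeriv ℝ F (x + s • v) v := by
  have : (fun r : ℝ => F (x + s • v + r • v)) = fun r => (fun s : ℝ => F (x + s • v)) (s + r) := by
    funext r
    simp [add_smul, add_assoc]
  rw [lineDeriv, this, deriv_comp_const_add (fun s : ℝ => F (x + s • v)), add_zero]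

lemma abs_sub_le_integral_lineDeriv {E : Type*} [NormedAddCommGroup E] [NormedSpace ℝ E]
    {F : E → ℝ} {K : NNReal} (hF : LipschitzWith K F) (x v : E) {a b : ℝ} (hab : a ≤ b) :
    |F (x + b • v) - F (x + a • v)| ≤ ∫ s in Set.Ioo a b, |lineDeriv ℝ F (x + s • v) v| := by
  have hg : LipschitzWith (K * ‖v‖₊) fun s : ℝ => F (x + s • v) := by
    refine hF.comp (LipschitzWith.of_dist_le_mul fun s r => ?_)
    rw [dist_add_left, dist_eq_norm, ← sub_smul, norm_smul, ← dist_eq_norm, mul_comm]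
    rfl
  have h1 := (hg.lipschitzOnWith (s := Set.uIcc a b)).absolutelyContinuousOnInterval.integral_deriv_eq_sub
  rw [← h1]
  refine (intervalIntegral.abs_integral_le_integral_abs hab).trans_eq ?_
  rw [intervalIntegral.integral_of_le hab, integral_Ioc_eq_integral_Ioo]
  simp only [deriv_comp_line]

lemma integrableOn_abs_lineDeriv {F : Eu 2 → ℝ} {K : NNReal} (hF : LipschitzWith K F) (v : Eu 2)
    {S : Set (Eu 2)} (hS : volume S ≠ ⊤) : IntegrableOn (fun x => |lineDeriv ℝ F x v|) S := by
  refine Integrable.mono' (g := fun _ => K * ‖v‖) (integrableOn_const hS) ?_ ?_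
  · exact (measurable_lineDeriv hF.continuous).norm.aestronglyMeasurable
  · refine ae_of_all _ fun x => ?_
    rw [norm_abs_eq_norm]
    exact norm_lineDeriv_le_of_lipschitz ℝ hF

namespace IsPatch

variable {Ω : Set (Eu 2)} {γ γ' : ℝ → Eu 2} {v : Eu 2} {t₀ δ ℓ : ℝ}

lemma integral_cross_mul_abs_le (hp : IsPatch Ω γ γ' v t₀ δ) (hc : ClosedCurve γ γ' ℓ)
    (hΩ : volume Ω ≠ ⊤) {a b : ℝ} (hab : a ≤ b)
    (hS : tube γ v '' (Set.Ioo (t₀ - δ) (t₀ + δ) ×ˢ Set.Ioo a b) ⊆ Ω) {F : Eu 2 → ℝ} {K : NNReal}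
    (hF : LipschitzWith K F)
    (hFab : ∀ t ∈ Set.Ioo (t₀ - δ) (t₀ + δ), |F (γ t)| = |F (γ t + b • v) - F (γ t + a • v)|) :
    ∫ t in Set.Ioo (t₀ - δ) (t₀ + δ), cross (γ' t) v * |F (γ t)|
      ≤ ∫ x in Ω, |lineDeriv ℝ F x v| := by
  have hcc := hc.cont
  have hcc' := hc.continuous
  set I := Set.Ioo (t₀ - δ) (t₀ + δ)
  have hQ : MeasurableSet (I ×ˢ Set.Ioo a b) := measurableSet_Ioo.prod measurableSet_Ioo
  have hcont : Continuous fun t => cross (γ' t) v := continuous_cross hcc continuous_const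
  have h_int : IntegrableOn
      (fun p : ℝ × ℝ => cross (γ' p.1) v * |lineDeriv ℝ F (tube γ v p) v|) (I ×ˢ Set.Ioo a b) := by
    have hfin : volume (I ×ˢ Set.Ioo a b) ≠ ⊤ := by
      rw [Measure.volume_eq_prod, Measure.prod_prod]
      exact ENNReal.mul_ne_top measure_Ioo_lt_top.ne measure_Ioo_lt_top.ne
    refine Integrable.mono' (g := fun _ => ℓ * ‖v‖ * (K * ‖v‖)) (integrableOn_const hfin) ?_ ?_
    · refine ((hcont.comp continuous_fst).measurable.mul ?_).aestronglyMeasurable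
      exact (measurable_lineDeriv hF.continuous).norm.comp (continuous_tube hcc' v).measurable
    · refine ae_of_all _ fun p => ?_
      rw [norm_mul, norm_abs_eq_norm]
      refine mul_le_mul ?_ (norm_lineDeriv_le_of_lipschitz ℝ hF) (norm_nonneg _)
        (mul_nonneg hc.speed_nonneg (norm_nonneg _))
      have := abs_cross_le (γ' p.1) v
      rwa [hc.speed] at this
  have e : ∫ x in tube γ v '' (I ×ˢ Set.Ioo a b), |lineDeriv ℝ F x v|
      = ∫ t in I, ∫ s in Set.Ioo a b, cross (γ' t) v * |lineDeriv ℝ F (tube γ v (t, s)) v| := by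
    rw [integral_image_tube hQ hc.deriv
      (hp.inj.mono (Set.prod_mono Set.Ioo_subset_Icc_self (Set.subset_univ _)))
      (fun p hp' => hp.cross_pos _ (Set.Ioo_subset_Icc_self hp'.1)), Measure.volume_eq_prod,
      setIntegral_prod _ (by rw [← Measure.volume_eq_prod]; exact h_int)]
  calc _ ≤ ∫ t in I, ∫ s in Set.Ioo a b, cross (γ' t) v * |lineDeriv ℝ F (tube γ v (t, s)) v| := by
        refine setIntegral_mono_on ?_ ?_ measurableSet_Ioo fun t ht => ?_
        · have : Continuous fun t => cross (γ' t) v * |F (γ t)| :=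
            hcont.mul (hF.continuous.comp hcc').abs
          exact (this.integrableOn_Icc (a := t₀ - δ) (b := t₀ + δ)).mono_set Set.Ioo_subset_Icc_self
        · have := h_int
          rw [IntegrableOn, Measure.volume_eq_prod, ← Measure.prod_restrict] at this
          exact this.integral_prod_left
        · rw [integral_const_mul, hFab t ht]
          exact mul_le_mul_of_nonneg_left (abs_sub_le_integral_lineDeriv hF (γ t) v hab)
            (hp.cross_pos t (Set.Ioo_subset_Icc_self ht)).le
    _ ≤ _ := by
        rw [← e]
        exact setIntegral_mono_set (integrableOn_abs_lineDeriv hF v hΩ)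
          (ae_of_all _ fun _ => abs_nonneg _) (LE.le.eventuallyLE hS)

/-- A local trace inequality. -/
lemma exists_trace_bound (hp : IsPatch Ω γ γ' v t₀ δ) (hc : ClosedCurve γ γ' ℓ)
    (hinj : Set.InjOn γ (Set.Ico 0 1)) (hΩ : IsOpen Ω) (hΩf : volume Ω ≠ ⊤)
    (hfr : ∀ t, γ t ∈ frontier Ω) :
    ∃ C, 0 ≤ C ∧ ∀ (F : Eu 2 → ℝ) (K : NNReal), LipschitzWith K F →
      (∀ x ∉ tubeSet γ v t₀ δ, F x = 0) →
      ∫ t in (0 : ℝ)..1, F (γ t) ≤ C * ∫ x in Ω, |lineDeriv ℝ F x v| := by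
  have hδ := hp.pos
  have hcc := hc.cont
  have hcc' := hc.continuous
  have hcont : Continuous fun t => cross (γ' t) v := continuous_cross hcc continuous_const
  obtain ⟨c, hc0, hcle⟩ : ∃ c, 0 < c ∧ ∀ t ∈ Set.Icc (t₀ - δ) (t₀ + δ), c ≤ cross (γ' t) v := by
    obtain ⟨s, hs, hmin⟩ := isCompact_Icc.exists_isMinOn
      (Set.nonempty_Icc.2 (by linarith : t₀ - δ ≤ t₀ + δ)) hcont.continuousOn
    exact ⟨_, hp.cross_pos s hs, fun t ht => hmin ht⟩
  have hmain : ∀ (F : Eu 2 → ℝ) (K : NNReal), LipschitzWith K F →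
      (∀ x ∉ tubeSet γ v t₀ δ, F x = 0) →
      ∫ t in Set.Ioo (t₀ - δ) (t₀ + δ), cross (γ' t) v * |F (γ t)|
        ≤ ∫ x in Ω, |lineDeriv ℝ F x v| := by
    intro F K hF hF0
    have hend : ∀ t ∈ Set.Ioo (t₀ - δ) (t₀ + δ), ∀ s, s ∉ Set.Ioo (-δ) δ → F (γ t + s • v) = 0 :=
      fun t ht s hs => hp.eq_zero_of_eq_endpoint hF0 (p := (t, s))
        ⟨Set.Ioo_subset_Icc_self ht, trivial⟩ fun h => hs h.2
    have hne : (Ω ∩ tubeSet γ v t₀ δ).Nonempty := by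
      rw [Set.inter_comm]
      exact mem_closure_iff.1 (hfr t₀).1 _ hp.isOpen
        (hp.mem_tubeSet ⟨by linarith, by linarith⟩)
    rw [hp.inter_tubeSet hΩ hfr, Set.union_nonempty] at hne
    rcases hne with hne | hne
    · have hs := (hp.strip_subset_or_disjoint hcc' (a := 0) (b := δ) (by linarith) le_rfl
        (by simp)).resolve_right fun hd => by
          rw [Set.inter_comm, hd.inter_eq] at hne; exact Set.not_nonempty_empty hne
      refine hp.integral_cross_mul_abs_le hc hΩf hδ.le hs hF fun t ht => ?_
      rw [hend t ht δ (by simp)]; simp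
    · have hs := (hp.strip_subset_or_disjoint hcc' (a := -δ) (b := 0) le_rfl hδ.le
        (by simp)).resolve_right fun hd => by
          rw [Set.inter_comm, hd.inter_eq] at hne; exact Set.not_nonempty_empty hne
      refine hp.integral_cross_mul_abs_le hc hΩf (by linarith) hs hF fun t ht => ?_
      rw [hend t ht (-δ) (by simp)]; simp
  refine ⟨c⁻¹, (inv_pos.2 hc0).le, fun F K hF hF0 => ?_⟩
  have hFc : Continuous fun t => |F (γ t)| := (hF.continuous.comp hcc').abs
  have h1 := hp.integral_period hc hinj hfr hF0 (g := fun _ => 1)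
  simp only [mul_one] at h1
  rw [← h1, ← div_eq_inv_mul, le_div_iff₀' hc0]
  refine le_trans ?_ (hmain F K hF hF0)
  rw [← integral_const_mul]
  refine setIntegral_mono_on ?_ ?_ measurableSet_Ioo fun t ht => ?_
  · have : Continuous fun t => c * F (γ t) := (hF.continuous.comp hcc').const_mul c
    exact (this.integrableOn_Icc (a := t₀ - δ) (b := t₀ + δ)).mono_set Set.Ioo_subset_Icc_self
  · exact ((hcont.mul hFc).integrableOn_Icc (a := t₀ - δ) (b := t₀ + δ)).mono_set
      Set.Ioo_subset_Icc_self
  · exact (mul_le_mul_of_nonneg_left (le_abs_self _) hc0.le).trans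
      (mul_le_mul_of_nonneg_right (hcle t (Set.Ioo_subset_Icc_self ht)) (abs_nonneg _))

end IsPatch

lemma LipschitzWith.mul_of_bounded {X : Type*} [PseudoMetricSpace X] {f g : X → ℝ} {K L : NNReal}
    (hf : LipschitzWith K f) (hg : LipschitzWith L g) {A B : NNReal} (hA : ∀ x, |f x| ≤ A)
    (hB : ∀ x, |g x| ≤ B) : LipschitzWith (A * L + B * K) fun x => f x * g x := by
  refine LipschitzWith.of_dist_le_mul fun x y => ?_
  have h1 := hf.dist_le_mul x y
  have h2 := hg.dist_le_mul x y
  rw [Real.dist_eq] at h1 h2 ⊢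
  calc |f x * g x - f y * g y| = |f x * (g x - g y) + g y * (f x - f y)| := by ring_nf
    _ ≤ |f x| * |g x - g y| + |g y| * |f x - f y| := by
        rw [← abs_mul, ← abs_mul]; exact abs_add_le _ _
    _ ≤ A * (L * dist x y) + B * (K * dist x y) := by gcongr; exacts [hA x, hB y]
    _ = _ := by push_cast; ring

lemma integrableOn_norm_fderiv_pow {F : Eu 2 → ℝ} {K : NNReal} (hF : LipschitzWith K F)
    {S : Set (Eu 2)} (hS : volume S ≠ ⊤) (n : ℕ) :
    IntegrableOn (fun x => ‖fderiv ℝ F x‖ ^ n) S := by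
  refine Integrable.mono' (g := fun _ => (K : ℝ) ^ n) (integrableOn_const hS) ?_ ?_
  · exact ((measurable_fderiv ℝ F).norm.pow_const n).aestronglyMeasurable
  · refine ae_of_all _ fun x => ?_
    rw [norm_pow, norm_norm]
    exact pow_le_pow_left₀ (norm_nonneg _) (norm_fderiv_le_of_lipschitz ℝ hF) n

lemma integrableOn_of_bounded_continuous {f : Eu 2 → ℝ} (hf : Continuous f)
    {S : Set (Eu 2)} (hS : Bornology.IsBounded S) : IntegrableOn f S :=
  (hf.continuousOn.integrableOn_compact hS.isCompact_closure).mono_set subset_closure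

lemma exists_bounded_lipschitz_extension {u : Eu 2 → ℝ} {K : NNReal} {Ω : Set (Eu 2)}
    (hΩ : Bornology.IsBounded Ω) (hu : LipschitzOnWith K u (closure Ω)) :
    ∃ w : Eu 2 → ℝ, LipschitzWith K w ∧ (∃ M : NNReal, ∀ x, |w x| ≤ M) ∧
      Set.EqOn u w (closure Ω) := by
  obtain ⟨g, hg, hug⟩ := hu.extend_real
  obtain ⟨M, hM⟩ := hΩ.isCompact_closure.exists_bound_of_continuousOn hg.continuous.continuousOn
  refine ⟨fun x => max (-(M.toNNReal : ℝ)) (min (M.toNNReal : ℝ) (g x)),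
    (hg.const_min _).const_max _, ⟨M.toNNReal, fun x => ?_⟩, fun x hx => ?_⟩
  · have := M.toNNReal.coe_nonneg
    exact abs_le.2 ⟨le_max_left _ _, max_le (by linarith) (min_le_left _ _)⟩
  · have h1 := abs_le.1 ((hM x hx).trans (Real.le_coe_toNNReal M))
    change u x = max _ _
    rw [hug hx, min_eq_right h1.2, max_eq_right h1.1]

lemma setIntegral_norm_fderiv_congr {u w : Eu 2 → ℝ} {Ω : Set (Eu 2)} (hΩ : IsOpen Ω)
    (h : Set.EqOn u w Ω) : ∫ x in Ω, ‖fderiv ℝ u x‖ ^ 2 = ∫ x in Ω, ‖fderiv ℝ w x‖ ^ 2 := by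
  refine setIntegral_congr_fun hΩ.measurableSet fun x hx => ?_
  have : u =ᶠ[nhds x] w := by
    filter_upwards [hΩ.mem_nhds hx] with y hy using h hy
  change ‖fderiv ℝ u x‖ ^ 2 = ‖fderiv ℝ w x‖ ^ 2
  rw [this.fderiv_eq]

/-- Lower bounds on Rayleigh quotients only need bounded globally Lipschitz test functions. -/
lemma le_of_mem_robinRayleighSet {Ω : Set (Eu 2)} (hΩ : IsOpen Ω) (hb : Bornology.IsBounded Ω)
    {α m : ℝ} (H : ∀ (w : Eu 2 → ℝ) (K M : NNReal), LipschitzWith K w → (∀ x, |w x| ≤ M) →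
      m * ∫ x in Ω, w x ^ 2
        ≤ (∫ x in Ω, ‖fderiv ℝ w x‖ ^ 2) + α * ∫ x in frontier Ω, w x ^ 2 ∂μH[1])
    {q : ℝ} (hq : q ∈ robinRayleighSet 2 α Ω) : m ≤ q := by
  obtain ⟨u, K, hu, hne, rfl⟩ := hq
  obtain ⟨w, hw, ⟨M, hM⟩, he⟩ := exists_bounded_lipschitz_extension hb hu
  have hd : (((2 : ℕ) : ℝ) - 1) = 1 := by norm_num
  have e1 : ∫ x in Ω, u x ^ 2 = ∫ x in Ω, w x ^ 2 :=
    setIntegral_congr_fun hΩ.measurableSet fun x hx => by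
      rw [he (subset_closure hx)]
  have e2 : ∫ x in frontier Ω, u x ^ 2 ∂μH[1] = ∫ x in frontier Ω, w x ^ 2 ∂μH[1] :=
    setIntegral_congr_fun isClosed_frontier.measurableSet fun x hx => by
      rw [he (frontier_subset_closure hx)]
  rw [hd, setIntegral_norm_fderiv_congr hΩ (he.mono subset_closure), e2]
  rw [e1] at hne ⊢
  have hpos : 0 < ∫ x in Ω, w x ^ 2 :=
    lt_of_le_of_ne (integral_nonneg fun _ => sq_nonneg _) (Ne.symm hne)
  rw [le_div_iff₀ hpos]
  exact H w K M hw hM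

namespace CurveDomain

variable {Ω : Set (Eu 2)} {N : ℕ} {γ γ' : Fin N → ℝ → Eu 2} {ℓ : Fin N → ℝ}

lemma volume_ne_top (h : CurveDomain Ω γ γ' ℓ) : volume Ω ≠ ⊤ := h.isBounded.measure_lt_top.ne

lemma exists_local_trace_bound (h : CurveDomain Ω γ γ' ℓ) {x : Eu 2} (hx : x ∈ frontier Ω) :
    ∃ V, IsOpen V ∧ x ∈ V ∧ ∃ C, 0 ≤ C ∧ ∀ (F : Eu 2 → ℝ) (K : NNReal), LipschitzWith K F →
      (∀ x ∉ V, F x = 0) →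
      ∑ i, ℓ i * ∫ t in (0 : ℝ)..1, F (γ i t) ≤ C * ∫ x in Ω, ‖fderiv ℝ F x‖ := by
  rw [h.frontier_eq] at hx
  obtain ⟨i, t, rfl⟩ := Set.mem_iUnion.1 hx
  obtain ⟨v, δ, hp, hd⟩ := h.exists_isPatch i t
  obtain ⟨C, hC, hCF⟩ := hp.exists_trace_bound (h.curve i) (h.inj i) h.isOpen h.volume_ne_top
    (h.mem_frontier i)
  refine ⟨_, hp.isOpen, hp.mem_tubeSet ⟨by linarith [hp.pos], by linarith [hp.pos]⟩,
    ℓ i * (C * ‖v‖), mul_nonneg (h.pos i).le (mul_nonneg hC (norm_nonneg _)), fun F K hF hF0 => ?_⟩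
  rw [Finset.sum_eq_single i (fun j _ hj => ?_) (by simp)]
  · have h2 : ∫ x in Ω, |lineDeriv ℝ F x v| ≤ ‖v‖ * ∫ x in Ω, ‖fderiv ℝ F x‖ := by
      rw [← integral_const_mul]
      have hi := integrableOn_norm_fderiv_pow hF h.volume_ne_top 1
      simp only [pow_one] at hi
      refine setIntegral_mono_ae (integrableOn_abs_lineDeriv hF v h.volume_ne_top)
        (hi.const_mul _) ?_
      filter_upwards [hF.ae_differentiableAt (μ := volume)] with y hy
      rw [hy.lineDeriv_eq_fderiv, mul_comm]
      exact (fderiv ℝ F y).le_opNorm v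
    calc _ ≤ ℓ i * (C * (‖v‖ * ∫ x in Ω, ‖fderiv ℝ F x‖)) := by
          have := (h.pos i).le
          gcongr
          exact (hCF F K hF hF0).trans (by gcongr)
      _ = _ := by ring
  · have : ∀ s, F (γ j s) = 0 := fun s => hF0 _ fun hm => Set.disjoint_left.1 (hd j hj) hm ⟨s, rfl⟩
    simp [this]

/-- The trace inequality for bounded Lipschitz functions. -/
lemma exists_trace_bound (h : CurveDomain Ω γ γ' ℓ) :
    ∃ C, 0 ≤ C ∧ ∀ (u : Eu 2 → ℝ) (K M : NNReal), LipschitzWith K u → (∀ x, |u x| ≤ M) →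
      ∫ x in frontier Ω, u x ^ 2 ∂μH[1]
        ≤ C * ∫ x in Ω, (u x ^ 2 + 2 * |u x| * ‖fderiv ℝ u x‖) := by
  choose! V hVo hVm C hC hCF using fun x (hx : x ∈ frontier Ω) => h.exists_local_trace_bound hx
  have hK : IsCompact (frontier Ω) :=
    h.isBounded.isCompact_closure.of_isClosed_subset isClosed_frontier frontier_subset_closure
  obtain ⟨t, χ, htK, hχ, hsum⟩ := exists_smooth_partition hK V fun x hx => ⟨hVo x hx, hVm x hx⟩
  have hLip : ∀ k, ∃ L : NNReal, LipschitzWith L (χ k) := fun k =>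
    (hχ k).1.lipschitzWith_of_hasCompactSupport (hχ k).2.1 (by norm_num)
  choose L hL using hLip
  have hBd : ∀ k, ∃ B : NNReal, ∀ x, |χ k x| ≤ B := fun k => by
    obtain ⟨B, hB⟩ := (hχ k).2.1.exists_bound_of_continuous (hχ k).1.continuous
    exact ⟨B.toNNReal, fun x => (hB x).trans (Real.le_coe_toNNReal B)⟩
  choose B hB using hBd
  refine ⟨∑ k : t, C k * (B k + L k), Finset.sum_nonneg fun k _ =>
    mul_nonneg (hC k (htK k)) (by positivity), fun u K M hu hM => ?_⟩
  have hu2 : LipschitzWith (M * K + M * K) fun x => u x * u x := hu.mul_of_bounded hu hM hM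
  have hM2 : ∀ x, |u x * u x| ≤ (M * M : NNReal) := fun x => by
    rw [abs_mul, NNReal.coe_mul]
    exact mul_le_mul (hM x) (hM x) (abs_nonneg _) M.coe_nonneg
  have hF : ∀ k, ∃ K', LipschitzWith K' fun x => χ k x * (u x * u x) := fun k =>
    ⟨_, (hL k).mul_of_bounded hu2 (hB k) hM2⟩
  choose K' hF using hF
  have hF0 : ∀ k : t, ∀ x ∉ V k, χ k x * (u x * u x) = 0 := fun k x hx => by
    rw [image_eq_zero_of_notMem_tsupport fun hm => hx ((hχ k).2.2.1 hm), zero_mul]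
  have h_int : IntegrableOn (fun x => u x ^ 2 + 2 * |u x| * ‖fderiv ℝ u x‖) Ω := by
    refine (integrableOn_of_bounded_continuous (hu.continuous.pow 2) h.isBounded).add ?_
    refine Integrable.mono' (g := fun _ => 2 * M * K) (integrableOn_const h.volume_ne_top) ?_ ?_
    · exact ((hu.continuous.abs.measurable.const_mul 2).mul
        (measurable_fderiv ℝ u).norm).aestronglyMeasurable
    · refine ae_of_all _ fun x => ?_
      rw [norm_mul, norm_mul, norm_abs_eq_norm, norm_norm]
      have := norm_fderiv_le_of_lipschitz ℝ hu (x₀ := x)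
      have := hM x
      simp only [Real.norm_eq_abs, abs_two] at *
      gcongr
  have hk : ∀ k : t, ∑ i, ℓ i * ∫ s in (0 : ℝ)..1, χ k (γ i s) * (u (γ i s) * u (γ i s))
      ≤ C k * (B k + L k) * ∫ x in Ω, (u x ^ 2 + 2 * |u x| * ‖fderiv ℝ u x‖) := by
    intro k
    refine (hCF k (htK k) _ _ (hF k) (hF0 k)).trans ?_
    rw [mul_assoc]
    refine mul_le_mul_of_nonneg_left ?_ (hC k (htK k))
    rw [← integral_const_mul]
    have hi := integrableOn_norm_fderiv_pow (hF k) h.volume_ne_top 1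
    simp only [pow_one] at hi
    refine setIntegral_mono_ae hi (h_int.const_mul _) ?_
    filter_upwards [hu.ae_differentiableAt (μ := volume)] with x hx
    have hχd := ((hχ k).1.differentiable (by norm_num) x).hasFDerivAt
    have hd : HasFDerivAt (fun x => χ k x * (u x * u x)) (χ k x •
        (u x • fderiv ℝ u x + u x • fderiv ℝ u x) + (u x * u x) • fderiv ℝ (χ k) x) x :=
      hχd.mul (hx.hasFDerivAt.mul hx.hasFDerivAt)
    rw [hd.fderiv]
    have n1 := norm_fderiv_le_of_lipschitz ℝ (hL k) (x₀ := x)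
    have n2 := hB k x
    have hBk := (B k).coe_nonneg
    have hLk := (L k).coe_nonneg
    calc _ ≤ |χ k x| * (|u x| * ‖fderiv ℝ u x‖ + |u x| * ‖fderiv ℝ u x‖)
          + |u x * u x| * ‖fderiv ℝ (χ k) x‖ := by
          refine (norm_add_le _ _).trans ?_
          rw [norm_smul, norm_smul]
          refine add_le_add (mul_le_mul_of_nonneg_left ((norm_add_le _ _).trans ?_)
            (abs_nonneg _)) le_rfl
          rw [norm_smul]; exact le_rfl
      _ ≤ B k * (2 * |u x| * ‖fderiv ℝ u x‖) + u x ^ 2 * L k := by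
          rw [abs_mul_self, ← pow_two, ← two_mul, ← mul_assoc (2 : ℝ) |u x|]
          have := norm_nonneg (fderiv ℝ u x)
          gcongr
      _ ≤ _ := by
          have : 0 ≤ 2 * |u x| * ‖fderiv ℝ u x‖ := by positivity
          nlinarith [sq_nonneg (u x)]
  have e := h.integral_frontier (f := fun x => u x ^ 2) (hu.continuous.pow 2)
  rw [e, Finset.sum_mul]
  refine le_trans (le_of_eq ?_) (Finset.sum_le_sum fun k _ => hk k)
  rw [Finset.sum_comm]
  refine Finset.sum_congr rfl fun i _ => ?_
  rw [← Finset.mul_sum, ← intervalIntegral.integral_finsetSum]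
  · congr 1
    refine intervalIntegral.integral_congr fun s _ => ?_
    change u (γ i s) ^ 2 = ∑ k, χ k (γ i s) * (u (γ i s) * u (γ i s))
    rw [← Finset.sum_mul, hsum _ (h.mem_frontier i s), one_mul, pow_two]
  · intro k _
    have : Continuous fun s => χ k (γ i s) * (u (γ i s) * u (γ i s)) :=
      (hF k).continuous.comp (h.curve i).continuous
    exact this.intervalIntegrable _ _

lemma bddBelow_robinRayleighSet (h : CurveDomain Ω γ γ' ℓ) (α : ℝ) :
    BddBelow (robinRayleighSet 2 α Ω) := by
  obtain ⟨C, hC, hCu⟩ := h.exists_trace_bound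
  refine ⟨-(|α| * C + (|α| * C) ^ 2), fun q hq => ?_⟩
  refine le_of_mem_robinRayleighSet h.isOpen h.isBounded (fun u K M hu hM => ?_) hq
  have i1 : IntegrableOn (fun x => u x ^ 2) Ω :=
    integrableOn_of_bounded_continuous (hu.continuous.pow 2) h.isBounded
  have i2 := integrableOn_norm_fderiv_pow hu h.volume_ne_top 2
  have hT : 0 ≤ ∫ x in frontier Ω, u x ^ 2 ∂μH[1] := integral_nonneg fun _ => sq_nonneg _
  have h1 : -(|α| * ∫ x in frontier Ω, u x ^ 2 ∂μH[1])
      ≤ α * ∫ x in frontier Ω, u x ^ 2 ∂μH[1] := by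
    rw [← neg_mul]
    exact mul_le_mul_of_nonneg_right (neg_abs_le α) hT
  have h2 := mul_le_mul_of_nonneg_left (hCu u K M hu hM) (abs_nonneg α)
  have h3 : |α| * (C * ∫ x in Ω, (u x ^ 2 + 2 * |u x| * ‖fderiv ℝ u x‖))
      ≤ (∫ x in Ω, ‖fderiv ℝ u x‖ ^ 2) + (|α| * C + (|α| * C) ^ 2) * ∫ x in Ω, u x ^ 2 := by
    rw [← mul_assoc, ← integral_const_mul, ← integral_const_mul,
      ← integral_add i2 (i1.const_mul _)]
    refine integral_mono_of_nonneg (ae_of_all _ fun x => ?_) (i2.add (i1.const_mul _))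
      (ae_of_all _ fun x => ?_)
    · change (0 : ℝ) ≤ _
      positivity
    · change |α| * C * (u x ^ 2 + 2 * |u x| * ‖fderiv ℝ u x‖)
        ≤ ‖fderiv ℝ u x‖ ^ 2 + (|α| * C + (|α| * C) ^ 2) * u x ^ 2
      have := sq_nonneg (‖fderiv ℝ u x‖ - |α| * C * |u x|)
      rw [← sq_abs (u x)]
      nlinarith
  linarith

end CurveDomain

/-- The function `r ↦ r φ'(r) / φ(r)` for the radial profile `φ(r) = besselSeries 0 (k r²)`. -/
def radialWeight (k r : ℝ) : ℝ :=
  2 * (k * r ^ 2) * besselSeries 1 (k * r ^ 2) / besselSeries 0 (k * r ^ 2)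

lemma hasDerivAt_radialWeight {k : ℝ} (hk : 0 ≤ k) {r : ℝ} (hr : r ≠ 0) :
    HasDerivAt (radialWeight k) (4 * k * r - radialWeight k r ^ 2 / r) r := by
  have hz : 0 ≤ k * r ^ 2 := by positivity
  have h0 := (besselSeries_pos 0 hz).ne'
  have hzd : HasDerivAt (fun r : ℝ => k * r ^ 2) (k * (2 * r)) r := by
    simpa using (hasDerivAt_pow 2 r).const_mul k
  have hE (m : ℕ) : HasDerivAt (fun r => besselSeries m (k * r ^ 2))
      (besselSeries (m + 1) (k * r ^ 2) * (k * (2 * r))) r :=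
    HasDerivAt.comp (h₂ := besselSeries m) (h := fun r => k * r ^ 2) r
      (hasDerivAt_besselSeries m (k * r ^ 2)) hzd
  have hd : HasDerivAt (radialWeight k) _ r := ((hzd.const_mul 2).mul (hE 1)).div (hE 0) h0
  refine hd.congr_deriv ?_
  have hrec := besselSeries_zero_eq (k * r ^ 2)
  simp only [radialWeight, Pi.mul_apply]
  norm_num
  field_simp
  have h2 : k * r ^ 2 * besselSeries 2 (k * r ^ 2)
      = besselSeries 0 (k * r ^ 2) - besselSeries 1 (k * r ^ 2) := by linarith
  linear_combination (4 * k * besselSeries 0 (k * r ^ 2)) * h2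

lemma contDiff_radialWeight {k : ℝ} (hk : 0 ≤ k) : ContDiff ℝ 1 (radialWeight k) := by
  have hz : ContDiff ℝ 1 fun r : ℝ => k * r ^ 2 := by fun_prop
  exact ((contDiff_const.mul hz).mul ((contDiff_besselSeries 1).comp hz)).div
    ((contDiff_besselSeries 0).comp hz) fun r => (besselSeries_pos 0 (by positivity)).ne'

/-- The one-dimensional inequality along rays of a disk. -/
lemma radial_inequality {k : ℝ} (hk : 0 ≤ k) {R : ℝ} (hR : 0 ≤ R) {g : ℝ → ℝ} {K : NNReal}
    (hg : LipschitzWith K g) :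
    radialWeight k R * g R ^ 2
      ≤ ∫ r in Set.Ioo 0 R, r * ((deriv g r) ^ 2 + 4 * k * g r ^ 2) := by
  have hgA := (hg.lipschitzOnWith (s := Set.uIcc 0 R)).absolutelyContinuousOnInterval
  have hPA := ((contDiff_radialWeight hk).contDiffOn (s := Set.uIcc 0 R)).absolutelyContinuousOnInterval
  have hGA := hPA.fun_mul (hgA.fun_mul hgA)
  have e := hGA.integral_deriv_eq_sub
  have h0 : radialWeight k 0 = 0 := by simp [radialWeight]
  rw [h0, zero_mul, sub_zero] at e
  rw [pow_two, ← e, ← integral_Ioc_eq_integral_Ioo, ← intervalIntegral.integral_of_le hR]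
  refine intervalIntegral.integral_mono_ae_restrict hR hGA.intervalIntegrable_deriv ?_ ?_
  · rw [intervalIntegrable_iff_integrableOn_Icc_of_le hR]
    refine Integrable.add (f := fun r => r * deriv g r ^ 2) (g := fun r => r * (4 * k * g r ^ 2))
      ?_ ?_ |>.congr (ae_of_all _ fun r => by simp; ring)
    · refine Integrable.mono' (g := fun _ => R * (K : ℝ) ^ 2)
        (integrableOn_const isCompact_Icc.measure_lt_top.ne) ?_ ?_
      · exact (measurable_id.mul ((measurable_deriv g).pow_const 2)).aestronglyMeasurable
      · refine (ae_restrict_iff' measurableSet_Icc).2 (ae_of_all _ fun r hr => ?_)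
        rw [norm_mul, norm_pow, Real.norm_of_nonneg hr.1]
        have := norm_deriv_le_of_lipschitz hg (x₀ := r)
        gcongr
        exact hr.2
    · have : Continuous fun r => r * (4 * k * g r ^ 2) := by
        have := hg.continuous
        fun_prop
      exact this.integrableOn_Icc
  · have hne : ∀ᵐ r : ℝ, r ≠ 0 := by
      simp [ae_iff]
    filter_upwards [ae_restrict_of_ae hg.ae_differentiableAt_real, ae_restrict_of_ae hne,
      ae_restrict_mem measurableSet_Icc] with r hr hr0 hrI
    have hd := (hasDerivAt_radialWeight hk hr0).mul (hr.hasDerivAt.mul hr.hasDerivAt)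
    have hd' : deriv (fun x => radialWeight k x * (g x * g x)) r = _ := hd.deriv
    rw [hd']
    have hr' : 0 < r := lt_of_le_of_ne hrI.1 (Ne.symm hr0)
    have key : r * (deriv g r ^ 2 + 4 * k * g r ^ 2)
        - ((4 * k * r - radialWeight k r ^ 2 / r) * (g * g) r
          + radialWeight k r * (deriv g r * g r + g r * deriv g r))
        = (r * deriv g r - radialWeight k r * g r) ^ 2 / r := by
      simp only [Pi.mul_apply]
      field_simp
      ring
    have : 0 ≤ (r * deriv g r - radialWeight k r * g r) ^ 2 / r := by positivity
    linarith

/-- The unit vector of angle `θ`. -/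
def unitVec (θ : ℝ) : Eu 2 := !₂[cos θ, sin θ]

@[simp] lemma unitVec_apply_zero (θ : ℝ) : unitVec θ 0 = cos θ := rfl
@[simp] lemma unitVec_apply_one (θ : ℝ) : unitVec θ 1 = sin θ := rfl

@[simp] lemma norm_unitVec (θ : ℝ) : ‖unitVec θ‖ = 1 := by
  have h : ‖unitVec θ‖ ^ 2 = 1 := by
    rw [Eu.norm_sq_eq]
    simp
  nlinarith [norm_nonneg (unitVec θ)]

lemma hasDerivAt_unitVec (θ : ℝ) : HasDerivAt unitVec (!₂[-sin θ, cos θ] : Eu 2) θ := by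
  rw [hasDerivAt_iff_hasFDerivAt, ← hasFDerivWithinAt_univ, hasFDerivWithinAt_euclidean]
  intro i
  rw [hasFDerivWithinAt_univ]
  fin_cases i
  · exact hasDerivAt_cos θ
  · exact hasDerivAt_sin θ

lemma continuous_unitVec : Continuous unitVec :=
  continuous_iff_continuousAt.2 fun θ => (hasDerivAt_unitVec θ).continuousAt

lemma unitVec_injOn : Set.InjOn unitVec (Set.Ico (-π) π) := by
  intro a ha b hb h
  have h0 : cos a = cos b := congrArg (fun x : Eu 2 => x 0) h
  have h1 : sin a = sin b := congrArg (fun x : Eu 2 => x 1) h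
  obtain ⟨n, hn⟩ := Real.Angle.angle_eq_iff_two_pi_dvd_sub.1 (Real.Angle.cos_sin_inj h0 h1)
  have hπ := pi_pos
  have hn1 : (n : ℝ) < 1 := by
    by_contra! hc
    nlinarith [ha.2, hb.1]
  have hn2 : (-1 : ℝ) < n := by
    by_contra! hc
    nlinarith [ha.1, hb.2]
  have : n = 0 := by
    have h1 : n < 1 := by exact_mod_cast hn1
    have h2 : -1 < n := by exact_mod_cast hn2
    omega
  rw [this] at hn
  simp at hn
  linarith

lemma exists_unitVec (x : Eu 2) : ∃ θ ∈ Set.Ico (-π) π, x = ‖x‖ • unitVec θ := by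
  obtain ⟨θ, hθ, he⟩ : ∃ θ ∈ Set.Ioc (-π) π, x = ‖x‖ • unitVec θ := by
    refine ⟨Complex.arg ⟨x 0, x 1⟩, Complex.arg_mem_Ioc _, ?_⟩
    have hn : ‖(⟨x 0, x 1⟩ : ℂ)‖ = ‖x‖ := by
      rw [← sq_eq_sq₀ (norm_nonneg _) (norm_nonneg _), Eu.norm_sq_eq, Complex.sq_norm,
        Complex.normSq_mk]
      ring
    rw [← hn]
    ext i
    fin_cases i
    · simp
    · simp
  rcases hθ.2.lt_or_eq with h | h
  · exact ⟨θ, ⟨hθ.1.le, h⟩, he⟩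
  · refine ⟨-π, ⟨le_rfl, by linarith [pi_pos]⟩, ?_⟩
    rw [he, h, norm_smul]
    ext i
    fin_cases i <;> simp

lemma integral_sphere {R : ℝ} (hR : 0 < R) {f : Eu 2 → ℝ} (hf : Continuous f) :
    ∫ x in sphere (0 : Eu 2) R, f x ∂μH[1] = R * ∫ θ in -π..π, f (R • unitVec θ) := by
  set γ : ℝ → Eu 2 := fun t => R • unitVec (2 * π * t - π) with hγ
  set γ' : ℝ → Eu 2 := fun t =>
    (R * (2 * π)) • (!₂[-sin (2 * π * t - π), cos (2 * π * t - π)] : Eu 2) with hγ'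
  have hc : ClosedCurve γ γ' (2 * π * R) := by
    refine ⟨fun t => ?_, ?_, fun t => ?_, fun t => ?_⟩
    · have h1 : HasDerivAt (fun t : ℝ => 2 * π * t - π) (2 * π) t := by
        simpa using ((hasDerivAt_id t).const_mul (2 * π)).sub_const π
      have h2 : HasDerivAt γ _ t :=
        ((hasDerivAt_unitVec (2 * π * t - π)).scomp t h1).const_smul R
      exact h2.congr_deriv (smul_smul _ _ _)
    · rw [hγ']
      fun_prop
    · have : 2 * π * (t + 1) - π = 2 * π * t - π + 2 * π := by ring
      simp only [hγ, this]
      ext i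
      fin_cases i <;> simp
    · have h : ‖γ' t‖ ^ 2 = (2 * π * R) ^ 2 := by
        rw [Eu.norm_sq_eq]
        simp only [hγ', PiLp.smul_apply, smul_eq_mul, Matrix.cons_val_zero,
          Matrix.cons_val_one]
        linear_combination (2 * π * R) ^ 2 * sin_sq_add_cos_sq (2 * π * t - π)
      exact (sq_eq_sq₀ (norm_nonneg _) (by positivity)).1 h
  have hinj : Set.InjOn γ (Set.Ico 0 1) := by
    intro a ha b hb h
    have h' := smul_right_injective (Eu 2) hR.ne' h
    have := unitVec_injOn ⟨by nlinarith [pi_pos, ha.1], by nlinarith [pi_pos, ha.2]⟩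
      ⟨by nlinarith [pi_pos, hb.1], by nlinarith [pi_pos, hb.2]⟩ h'
    have h2 : 2 * π * a = 2 * π * b := by linarith
    exact mul_left_cancel₀ (by positivity) h2
  have hrange : Set.range γ = sphere (0 : Eu 2) R := by
    ext x
    rw [mem_sphere_zero_iff_norm]
    constructor
    · rintro ⟨t, rfl⟩
      simp [hγ, norm_smul, abs_of_pos hR]
    · rintro hx
      obtain ⟨θ, -, he⟩ := exists_unitVec x
      refine ⟨(θ + π) / (2 * π), ?_⟩
      have : 2 * π * ((θ + π) / (2 * π)) - π = θ := by
        field_simp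
        ring
      simp only [hγ, this]
      rw [he, hx]
  rw [← hrange, (hc.integral_range (by positivity) hinj hf).2]
  have := intervalIntegral.smul_integral_comp_mul_sub (a := 0) (b := 1)
    (f := fun θ => f (R • unitVec θ)) (2 * π) π
  rw [smul_eq_mul] at this
  simp only [hγ]
  rw [mul_comm (2 * π) R, mul_assoc, this]
  congr 2 <;> ring

lemma integral_ball_polar (R : ℝ) (f : Eu 2 → ℝ) :
    ∫ x in ball (0 : Eu 2) R, f x
      = ∫ p in Set.Ioo 0 R ×ˢ Set.Ioo (-π) π, p.1 * f (p.1 • unitVec p.2) := by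
  rw [← integral_indicator measurableSet_ball,
    ← measurePreserving_euEquiv.integral_comp euEquiv.measurableEmbedding,
    ← integral_comp_polarCoord_symm]
  have hsub : Set.Ioo 0 R ×ˢ Set.Ioo (-π) π ⊆ polarCoord.target :=
    Set.prod_mono Set.Ioo_subset_Ioi_self le_rfl
  have he (p : ℝ × ℝ) : euEquiv (polarCoord.symm p) = p.1 • unitVec p.2 := by
    ext i
    fin_cases i <;> simp
  simp only [he, smul_eq_mul]
  rw [setIntegral_eq_of_subset_of_forall_sdiff_eq_zero
    (s := Set.Ioo 0 R ×ˢ Set.Ioo (-π) π) polarCoord.open_target.measurableSet hsub]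
  · refine setIntegral_congr_fun (measurableSet_Ioo.prod measurableSet_Ioo)
      fun p hp => ?_
    have : p.1 • unitVec p.2 ∈ ball (0 : Eu 2) R := by
      rw [mem_ball_zero_iff, norm_smul, norm_unitVec, mul_one, Real.norm_of_nonneg hp.1.1.le]
      exact hp.1.2
    simp only [Set.indicator_of_mem this]
  · rintro p ⟨hp, hp'⟩
    have h1 : 0 < p.1 := hp.1
    have : p.1 • unitVec p.2 ∉ ball (0 : Eu 2) R := by
      rw [mem_ball_zero_iff, norm_smul, norm_unitVec, mul_one, Real.norm_of_nonneg h1.le]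
      exact fun h => hp' ⟨⟨h1, h⟩, hp.2⟩
    rw [Set.indicator_of_notMem this, mul_zero]

lemma radialWeight_nonneg {k : ℝ} (hk : 0 ≤ k) (r : ℝ) : 0 ≤ radialWeight k r := by
  have h1 := besselSeries_pos 1 (z := k * r ^ 2) (by positivity)
  have h0 := besselSeries_pos 0 (z := k * r ^ 2) (by positivity)
  unfold radialWeight
  positivity

lemma radialWeight_mul_integral_sphere_le {k : ℝ} (hk : 0 ≤ k) {R : ℝ} (hR : 0 < R)
    {w : Eu 2 → ℝ} {K : NNReal} {M : ℝ} (hw : LipschitzWith K w) (hM : ∀ x, |w x| ≤ M) :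
    radialWeight k R / R * ∫ x in sphere (0 : Eu 2) R, w x ^ 2 ∂μH[1]
      ≤ (∫ x in ball (0 : Eu 2) R, ‖fderiv ℝ w x‖ ^ 2)
        + 4 * k * ∫ x in ball (0 : Eu 2) R, w x ^ 2 := by
  have hwc := hw.continuous
  have hM0 : 0 ≤ M := (abs_nonneg _).trans (hM 0)
  set D : Eu 2 → ℝ := fun x => lineDeriv ℝ w x (‖x‖⁻¹ • x) with hD
  have hDm : Measurable D :=
    (measurable_lineDeriv_uncurry (𝕜 := ℝ) hwc).comp
      (measurable_id.prodMk (measurable_norm.inv.smul measurable_id))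
  have hnorm (x : Eu 2) : ‖‖x‖⁻¹ • x‖ ≤ 1 := by
    rw [norm_smul, norm_inv, norm_norm]
    exact inv_mul_le_one
  have hDK (x : Eu 2) : |D x| ≤ K := by
    refine (norm_lineDeriv_le_of_lipschitz ℝ hw).trans ?_
    exact mul_le_of_le_one_right K.2 (hnorm x)
  have hsq (x : Eu 2) : D x ^ 2 ≤ (K : ℝ) ^ 2 := sq_le_sq' (by linarith [abs_le.1 (hDK x)])
    (abs_le.1 (hDK x)).2
  have hwsq (x : Eu 2) : w x ^ 2 ≤ M ^ 2 := sq_le_sq' (by linarith [abs_le.1 (hM x)])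
    (abs_le.1 (hM x)).2
  have hball : volume (ball (0 : Eu 2) R) ≠ ⊤ := measure_ball_lt_top.ne
  have hiw : IntegrableOn (fun x => w x ^ 2) (ball (0 : Eu 2) R) :=
    integrableOn_of_bounded_continuous (by fun_prop) isBounded_ball
  have hig : IntegrableOn (fun x => ‖fderiv ℝ w x‖ ^ 2) (ball (0 : Eu 2) R) :=
    integrableOn_norm_fderiv_pow hw hball 2
  have hiD : IntegrableOn (fun x => D x ^ 2) (ball (0 : Eu 2) R) := by
    refine Integrable.mono' (g := fun _ => (K : ℝ) ^ 2) (integrableOn_const hball)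
      (hDm.pow_const 2).aestronglyMeasurable (ae_of_all _ fun x => ?_)
    rw [Real.norm_of_nonneg (sq_nonneg _)]
    exact hsq x
  have hD_le : ∫ x in ball (0 : Eu 2) R, D x ^ 2 ≤ ∫ x in ball (0 : Eu 2) R, ‖fderiv ℝ w x‖ ^ 2 := by
    refine integral_mono_ae hiD hig ?_
    filter_upwards [ae_restrict_of_ae hw.ae_differentiableAt] with x hx
    have h1 : |D x| ≤ ‖fderiv ℝ w x‖ := by
      simp only [hD, hx.lineDeriv_eq_fderiv]
      exact ((fderiv ℝ w x).le_opNorm _).trans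
        (mul_le_of_le_one_right (norm_nonneg _) (hnorm x))
    calc D x ^ 2 = |D x| ^ 2 := (sq_abs _).symm
      _ ≤ ‖fderiv ℝ w x‖ ^ 2 := by gcongr
  have hsum : ∫ x in ball (0 : Eu 2) R, (D x ^ 2 + 4 * k * w x ^ 2)
      = (∫ x in ball (0 : Eu 2) R, D x ^ 2) + 4 * k * ∫ x in ball (0 : Eu 2) R, w x ^ 2 := by
    rw [integral_add hiD (hiw.const_mul _), integral_const_mul]
  suffices h : radialWeight k R / R * ∫ x in sphere (0 : Eu 2) R, w x ^ 2 ∂μH[1]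
      ≤ ∫ x in ball (0 : Eu 2) R, (D x ^ 2 + 4 * k * w x ^ 2) by linarith
  have hπ : -π ≤ π := by linarith [pi_pos]
  have hu := continuous_unitVec
  set F : ℝ × ℝ → ℝ := fun p =>
    p.1 * (D (p.1 • unitVec p.2) ^ 2 + 4 * k * w (p.1 • unitVec p.2) ^ 2) with hF
  have hFi : Integrable F ((volume.restrict (Set.Ioo 0 R)).prod
      (volume.restrict (Set.Ioo (-π) π))) := by
    rw [Measure.prod_restrict]
    have hc : Continuous fun p : ℝ × ℝ => p.1 • unitVec p.2 := by fun_prop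
    have hm : Measurable F := measurable_fst.mul
      (((hDm.comp hc.measurable).pow_const 2).add
        (((hwc.comp hc).measurable.pow_const 2).const_mul _))
    refine Integrable.mono' (g := fun _ => R * ((K : ℝ) ^ 2 + 4 * k * M ^ 2)) ?_
      hm.aestronglyMeasurable ?_
    · refine integrableOn_const ?_
      rw [Measure.prod_prod]
      exact ENNReal.mul_ne_top measure_Ioo_lt_top.ne measure_Ioo_lt_top.ne
    · refine (ae_restrict_iff' (measurableSet_Ioo.prod measurableSet_Ioo)).2
        (ae_of_all _ fun p hp => ?_)
      have h1 : 0 < p.1 := hp.1.1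
      rw [Real.norm_of_nonneg (by positivity)]
      have h2 := hsq (p.1 • unitVec p.2)
      have h3 := hwsq (p.1 • unitVec p.2)
      have h4 : p.1 ≤ R := hp.1.2.le
      simp only [hF]
      gcongr
  rw [integral_sphere hR (f := fun x => w x ^ 2) (by fun_prop), integral_ball_polar,
    intervalIntegral.integral_of_le hπ, integral_Ioc_eq_integral_Ioo, ← mul_assoc,
    div_mul_cancel₀ _ hR.ne', ← integral_const_mul, Measure.volume_eq_prod,
    ← Measure.prod_restrict, integral_prod_symm _ hFi]
  have hRW := radialWeight_nonneg hk R
  refine integral_mono_of_nonneg (ae_of_all _ fun θ => by positivity) hFi.integral_prod_right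
    (ae_of_all _ fun θ => ?_)
  have hg : LipschitzWith K fun r : ℝ => w (r • unitVec θ) := by
    refine LipschitzWith.of_dist_le_mul fun a b => (hw.dist_le_mul _ _).trans_eq ?_
    rw [dist_eq_norm, ← sub_smul, norm_smul, norm_unitVec, mul_one, dist_eq_norm]
  refine (radial_inequality hk hR.le hg).trans_eq ?_
  refine setIntegral_congr_fun measurableSet_Ioo fun r hr => ?_
  have h1 : ‖r • unitVec θ‖⁻¹ • r • unitVec θ = unitVec θ := by
    rw [norm_smul, norm_unitVec, mul_one, Real.norm_of_nonneg hr.1.le, smul_smul,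
      inv_mul_cancel₀ hr.1.ne', one_smul]
  have h2 := deriv_comp_line w 0 (unitVec θ) r
  simp only [zero_add] at h2
  simp only [hF, hD, h1, h2]

lemma le_robinEig_ball {k : ℝ} (hk : 0 ≤ k) {R : ℝ} (hR : 0 < R) :
    -(4 * k) ≤ robinEig 2 (-(radialWeight k R / R)) (ball (0 : Eu 2) R) := by
  refine le_csInf ⟨_, fun _ => 1, 0, ?_, ?_, rfl⟩ fun q hq => ?_
  · exact (LipschitzWith.const 1).lipschitzOnWith
  · simpa [Measure.real, ENNReal.toReal_eq_zero_iff] using ⟨hR, pi_pos⟩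
  · refine le_of_mem_robinRayleighSet isOpen_ball isBounded_ball (fun w K M hw hM => ?_) hq
    have := radialWeight_mul_integral_sphere_le hk hR hw hM
    rw [frontier_ball _ hR.ne']
    linarith

lemma hasFDerivAt_norm_sub_sq (c y : Eu 2) :
    HasFDerivAt (fun y => ‖y - c‖ ^ 2) (2 • innerSL ℝ (y - c)) y := by
  simpa using ((hasFDerivAt_id y).sub_const c).norm_sq

/-- The divergence theorem for the radial field `W(|y - c|²) (y - c)`. -/
lemma CurveDomain.integral_radial_divergence {N : ℕ} {Ω : Set (Eu 2)} {γ γ' : Fin N → ℝ → Eu 2}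
    {ℓ : Fin N → ℝ} (h : CurveDomain Ω γ γ' ℓ) {σ : Fin N → ℝ}
    (hσ : ∀ f : Eu 2 → ℝ, ContDiff ℝ 1 f → ∀ w, ∫ x in Ω, fderiv ℝ f x w
      = ∑ i, σ i * ∫ t in (0 : ℝ)..1, f (γ i t) * cross w (γ' i t))
    {W W' : ℝ → ℝ} (hW : ∀ s, HasDerivAt W (W' s) s) (hW' : Continuous W') (c : Eu 2) :
    ∫ y in Ω, (2 * W (‖y - c‖ ^ 2) + 2 * ‖y - c‖ ^ 2 * W' (‖y - c‖ ^ 2))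
      = ∑ i, σ i * ∫ t in (0 : ℝ)..1, W (‖γ i t - c‖ ^ 2) * cross (γ i t - c) (γ' i t) := by
  have hWd : Continuous W := continuous_iff_continuousAt.2 fun s => (hW s).continuousAt
  have hWc : ContDiff ℝ 1 W := by
    rw [contDiff_one_iff_deriv]
    exact ⟨fun s => (hW s).differentiableAt, by rwa [funext fun s => (hW s).deriv]⟩
  set f : Fin 2 → Eu 2 → ℝ := fun j y => W (‖y - c‖ ^ 2) * (y j - c j) with hf
  have hfc (j) : ContDiff ℝ 1 (f j) := by
    have h1 : ContDiff ℝ 1 fun y : Eu 2 => ‖y - c‖ ^ 2 := (contDiff_id.sub contDiff_const).norm_sq ℝ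
    have h2 : ContDiff ℝ 1 fun y : Eu 2 => y j - c j := by fun_prop
    exact (hWc.comp h1).mul h2
  have hfd (j : Fin 2) (y : Eu 2) : fderiv ℝ (f j) y (EuclideanSpace.single j 1)
      = W (‖y - c‖ ^ 2) + 2 * (y j - c j) ^ 2 * W' (‖y - c‖ ^ 2) := by
    have h1 : HasFDerivAt (fun y => W (‖y - c‖ ^ 2)) (W' (‖y - c‖ ^ 2) • (2 • innerSL ℝ (y - c))) y :=
      (hW _).comp_hasFDerivAt y (hasFDerivAt_norm_sub_sq c y)
    have h2 : HasFDerivAt (fun y : Eu 2 => y j - c j) (EuclideanSpace.proj j : Eu 2 →L[ℝ] ℝ) y :=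
      (EuclideanSpace.proj j : Eu 2 →L[ℝ] ℝ).hasFDerivAt.sub_const (c j)
    have h3 : HasFDerivAt (f j) _ y := h1.mul h2
    rw [h3.fderiv]
    simp [EuclideanSpace.inner_single_right]
    ring
  have hfi (j) : IntegrableOn (fun y => fderiv ℝ (f j) y (EuclideanSpace.single j 1)) Ω := by
    refine integrableOn_of_bounded_continuous ?_ h.isBounded
    exact ((hfc j).continuous_fderiv one_ne_zero).clm_apply continuous_const
  have e (y : Eu 2) : 2 * W (‖y - c‖ ^ 2) + 2 * ‖y - c‖ ^ 2 * W' (‖y - c‖ ^ 2)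
      = fderiv ℝ (f 0) y (EuclideanSpace.single 0 1)
        + fderiv ℝ (f 1) y (EuclideanSpace.single 1 1) := by
    rw [hfd, hfd, Eu.norm_sq_eq (y - c)]
    simp
    ring
  simp only [e]
  rw [integral_add (hfi 0) (hfi 1), hσ _ (hfc 0), hσ _ (hfc 1), ← Finset.sum_add_distrib]
  refine Finset.sum_congr rfl fun i _ => ?_
  have hγ := (h.curve i).continuous
  have hγ' := (h.curve i).cont
  have hi (j : Fin 2) (w : Eu 2) : Continuous fun t => f j (γ i t) * cross w (γ' i t) :=
    ((hfc j).continuous.comp hγ).mul (continuous_cross continuous_const hγ')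
  rw [← mul_add, ← intervalIntegral.integral_add ((hi 0 _).intervalIntegrable _ _)
    ((hi 1 _).intervalIntegrable _ _)]
  congr 2
  ext t
  simp [hf, cross]
  ring

lemma CurveDomain.two_mul_area {N : ℕ} {Ω : Set (Eu 2)} {γ γ' : Fin N → ℝ → Eu 2}
    {ℓ : Fin N → ℝ} (h : CurveDomain Ω γ γ' ℓ) {σ : Fin N → ℝ}
    (hσ : ∀ f : Eu 2 → ℝ, ContDiff ℝ 1 f → ∀ w, ∫ x in Ω, fderiv ℝ f x w
      = ∑ i, σ i * ∫ t in (0 : ℝ)..1, f (γ i t) * cross w (γ' i t)) (c : Eu 2) :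
    2 * (volume Ω).toReal = ∑ i, σ i * ∫ t in (0 : ℝ)..1, cross (γ i t - c) (γ' i t) := by
  have := h.integral_radial_divergence hσ (fun s => hasDerivAt_const s (1 : ℝ)) continuous_const c
  simp only [one_mul] at this
  rw [← this]
  simp [Measure.real, mul_comm]

/-- A hyperplane meeting a bounded planar set meets its frontier. -/
lemma exists_mem_frontier_inner_eq {Ω : Set (Eu 2)} (hb : Bornology.IsBounded Ω) {e z : Eu 2}
    (he : e ≠ 0) (hz : z ∈ Ω) : ∃ y ∈ frontier Ω, inner ℝ e y = inner ℝ e z := by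
  obtain ⟨d, hd0, hd⟩ : ∃ d : Eu 2, d ≠ 0 ∧ inner ℝ e d = 0 := by
    refine ⟨!₂[-e 1, e 0], fun h => he ?_, ?_⟩
    · have h0 := congrArg (fun x : Eu 2 => x 0) h
      have h1 := congrArg (fun x : Eu 2 => x 1) h
      ext i
      fin_cases i
      · simpa using h1
      · simpa using h0
    · simp [PiLp.inner_apply]
      ring
  set line : ℝ → Eu 2 := fun s => z + s • d with hline
  have hcl : Continuous line := by fun_prop
  by_contra! hne
  have hdisj : ∀ x ∈ Set.range line, x ∉ frontier Ω := by
    rintro x ⟨s, rfl⟩ hx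
    refine hne _ hx ?_
    simp [hline, inner_add_right, inner_smul_right, hd]
  have hsub : Set.range line ⊆ Ω := by
    by_contra hns
    obtain ⟨s, hs⟩ : (frontier (line ⁻¹' Ω)).Nonempty := by
      refine nonempty_frontier_iff.2 ⟨⟨0, by simpa [hline] using hz⟩, fun hu => hns ?_⟩
      rintro _ ⟨s, rfl⟩
      exact hu.symm.subset (Set.mem_univ s)
    exact hdisj _ ⟨s, rfl⟩ (hcl.frontier_preimage_subset Ω hs)
  obtain ⟨C, hC⟩ := hb.exists_norm_le
  have h1 := hC _ (hsub ⟨(C + ‖z‖ + 1) / ‖d‖, rfl⟩)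
  have h2 : ‖((C + ‖z‖ + 1) / ‖d‖) • d‖ = C + ‖z‖ + 1 := by
    have hC0 : 0 ≤ C := (norm_nonneg z).trans (hC z hz)
    rw [norm_smul, norm_div, norm_norm, div_mul_cancel₀ _ (norm_ne_zero_iff.2 hd0),
      Real.norm_of_nonneg (by positivity)]
  have h3 := norm_sub_norm_le (((C + ‖z‖ + 1) / ‖d‖) • d) (-z)
  rw [sub_neg_eq_add, norm_neg, h2, add_comm _ z] at h3
  linarith

namespace CurveDomain

variable {N : ℕ} {Ω : Set (Eu 2)} {γ γ' : Fin N → ℝ → Eu 2} {ℓ : Fin N → ℝ}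

/-- The frontier of a connected domain has diameter at most its length. -/
lemma dist_le_sum_length (h : CurveDomain Ω γ γ' ℓ) {x y : Eu 2} (hx : x ∈ frontier Ω)
    (hy : y ∈ frontier Ω) : dist x y ≤ ∑ i, ℓ i := by
  rcases eq_or_ne x y with rfl | hxy
  · rw [dist_self]
    exact Finset.sum_nonneg fun i _ => (h.pos i).le
  set e : Eu 2 := ‖x - y‖⁻¹ • (x - y) with he
  have hn : ‖x - y‖ ≠ 0 := norm_ne_zero_iff.2 (sub_ne_zero.2 hxy)
  have he1 : ‖e‖ = 1 := by rw [he, norm_smul, norm_inv, norm_norm, inv_mul_cancel₀ hn]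
  have he0 : e ≠ 0 := norm_ne_zero_iff.1 (by rw [he1]; exact one_ne_zero)
  set p : Eu 2 → ℝ := fun z => inner ℝ e z with hp
  have hpc : Continuous p := by fun_prop
  have hpl (a b : Eu 2) : |p a - p b| ≤ ‖a - b‖ := by
    simp only [hp, ← inner_sub_right]
    simpa [he1] using abs_real_inner_le_norm e (a - b)
  have hpxy : p x - p y = dist x y := by
    simp only [hp]
    rw [← inner_sub_right, he, real_inner_smul_left, real_inner_self_eq_norm_sq, dist_eq_norm]
    field_simp
  have hcover : Set.Icc (p y) (p x) ⊆ ⋃ i, Set.Icc (p (γ i (1 / 2)) - ℓ i / 2)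
      (p (γ i (1 / 2)) + ℓ i / 2) := by
    intro s hs
    have hfr : ∃ z ∈ frontier Ω, p z = s := by
      obtain ⟨z, hz, rfl⟩ := (h.isConnected.isPreconnected.closure).intermediate_value
        (frontier_subset_closure hy) (frontier_subset_closure hx) hpc.continuousOn hs
      by_cases hzΩ : z ∈ Ω
      · exact exists_mem_frontier_inner_eq h.isBounded he0 hzΩ
      · exact ⟨z, by rw [h.isOpen.frontier_eq]; exact ⟨hz, hzΩ⟩, rfl⟩
    obtain ⟨z, hz, rfl⟩ := hfr
    rw [h.frontier_eq] at hz
    obtain ⟨i, t, rfl⟩ := Set.mem_iUnion.1 hz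
    refine Set.mem_iUnion.2 ⟨i, ?_⟩
    have hr := Set.mem_range_self (f := γ i) t
    rw [(h.curve i).range_eq_image] at hr
    obtain ⟨t', ht', hte⟩ := hr
    rw [← hte]
    have h0 : ‖γ i t' - γ i (1 / 2)‖ ≤ ℓ i * |t' - 1 / 2| := (h.curve i).lipschitz (1 / 2) t'
    have h1 := (hpl (γ i t') (γ i (1 / 2))).trans h0
    have h2 : |t' - 1 / 2| ≤ 1 / 2 := abs_le.2 ⟨by linarith [ht'.1], by linarith [ht'.2]⟩
    have h3 := h1.trans (mul_le_mul_of_nonneg_left h2 (h.pos i).le)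
    have h4 := abs_le.1 h3
    constructor <;> linarith [h4.1, h4.2]
  have hv := (measure_mono (μ := volume) hcover).trans (measure_iUnion_fintype_le _ _)
  simp only [Real.volume_Icc] at hv
  rw [← ENNReal.ofReal_sum_of_nonneg (fun i _ => by have := h.pos i; linarith),
    ENNReal.ofReal_le_ofReal_iff (Finset.sum_nonneg fun i _ => by have := h.pos i; linarith),
    hpxy] at hv
  refine hv.trans_eq (Finset.sum_congr rfl fun i _ => by ring)

lemma norm_sub_mean_le (h : CurveDomain Ω γ γ' ℓ) (i j : Fin N) (t : ℝ) :
    ‖γ i t - curveMean (γ j)‖ ≤ 2 * ∑ i, ℓ i := by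
  have h1 := h.dist_le_sum_length (h.mem_frontier i t) (h.mem_frontier j 0)
  have h2 := (h.curve j).norm_sub_mean_le (t := 0) ⟨le_rfl, zero_le_one⟩
  have h3 : ℓ j ≤ ∑ i, ℓ i :=
    Finset.single_le_sum (f := ℓ) (fun i _ => (h.pos i).le) (Finset.mem_univ j)
  have h4 := norm_add_le (γ i t - γ j 0) (γ j 0 - curveMean (γ j))
  rw [sub_add_sub_cancel] at h4
  rw [dist_eq_norm] at h1
  linarith

end CurveDomain

/-- Quantitative isoperimetric inequality: the length is at least that of the disk of the same
area, and when it is close to it, a single boundary curve carries almost all of it. -/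
lemma CurveDomain.exists_main_curve {N : ℕ} {Ω : Set (Eu 2)} {γ γ' : Fin N → ℝ → Eu 2}
    {ℓ : Fin N → ℝ} (h : CurveDomain Ω γ γ' ℓ) {σ : Fin N → ℝ} (hσ1 : ∀ i, |σ i| ≤ 1)
    (hσ : ∀ f : Eu 2 → ℝ, ContDiff ℝ 1 f → ∀ w, ∫ x in Ω, fderiv ℝ f x w
      = ∑ i, σ i * ∫ t in (0 : ℝ)..1, f (γ i t) * cross w (γ' i t))
    {R : ℝ} (hR : 0 < R) (hA : (volume Ω).toReal = π * R ^ 2) :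
    ∃ δ, 0 ≤ δ ∧ ∑ i, ℓ i = 2 * π * R + δ ∧ (δ ≤ 2 * π * R → ∃ i₀,
      ∑ i ∈ Finset.univ.erase i₀, ℓ i ≤ 2 * δ ∧ |ℓ i₀ - 2 * π * R| ≤ 2 * δ ∧
      ∃ ς : ℝ, ς ^ 2 = 1 ∧ ℓ i₀ ^ 2 - 2 * π * (ς * curveArea (γ i₀) (γ' i₀)) ≤ 6 * π * R * δ) := by
  have hπ := pi_pos
  set a : Fin N → ℝ := fun i => curveArea (γ i) (γ' i) with ha
  have ha1 (i) : 2 * π * |a i| ≤ ℓ i ^ 2 := (h.curve i).two_pi_abs_area_le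
  have h2A : 2 * (π * R ^ 2) ≤ ∑ i, |a i| := by
    rw [← hA, h.two_mul_area hσ 0]
    refine Finset.sum_le_sum fun i _ => ?_
    rw [(h.curve i).integral_cross_sub]
    refine (le_abs_self _).trans ?_
    rw [abs_mul]
    exact mul_le_of_le_one_left (abs_nonneg _) (hσ1 i)
  have hpos (i) := (h.pos i).le
  have hne : Nonempty (Fin N) := by
    by_contra hc
    rw [not_nonempty_iff] at hc
    rw [Finset.univ_eq_empty, Finset.sum_empty] at h2A
    have : 0 < 2 * (π * R ^ 2) := by positivity
    linarith
  obtain ⟨i₀, -, hmax⟩ := Finset.exists_max_image Finset.univ ℓ Finset.univ_nonempty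
  set L := ∑ i, ℓ i with hL
  have hsplit : ℓ i₀ + ∑ i ∈ Finset.univ.erase i₀, ℓ i = L :=
    Finset.add_sum_erase _ _ (Finset.mem_univ i₀)
  have hm0 : 0 ≤ ∑ i ∈ Finset.univ.erase i₀, ℓ i := Finset.sum_nonneg fun i _ => hpos i
  have hsq : ∑ i, ℓ i ^ 2 ≤ ℓ i₀ * L := by
    rw [hL, Finset.mul_sum]
    refine Finset.sum_le_sum fun i hi => ?_
    rw [pow_two]
    exact mul_le_mul_of_nonneg_right (hmax i hi) (hpos i)
  have hsq2 : (2 * π * R) ^ 2 ≤ ∑ i, 2 * π * |a i| := by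
    rw [← Finset.mul_sum]
    nlinarith
  have hsum : ∑ i, 2 * π * |a i| ≤ ∑ i, ℓ i ^ 2 := Finset.sum_le_sum fun i _ => ha1 i
  have hℓ0 := h.pos i₀
  have hLB : 0 < 2 * π * R := by positivity
  have hLL : 2 * π * R ≤ L := by
    have : ℓ i₀ * L ≤ L ^ 2 := by nlinarith
    exact le_of_sq_le_sq (by linarith) (by linarith)
  refine ⟨L - 2 * π * R, by linarith, by ring, fun hδ => ⟨i₀, ?_, ?_, ?_⟩⟩
  all_goals
    have hm : ∑ i ∈ Finset.univ.erase i₀, ℓ i ≤ 2 * (L - 2 * π * R) := by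
      have hL0 : 0 < L := by linarith
      refine le_of_mul_le_mul_right ?_ hL0
      nlinarith
  · exact hm
  · rw [abs_le]
    constructor <;> linarith
  · have hrest : ∑ i ∈ Finset.univ.erase i₀, 2 * π * |a i| ≤ ∑ i ∈ Finset.univ.erase i₀, ℓ i ^ 2 :=
      Finset.sum_le_sum fun i _ => ha1 i
    have hs1 := Finset.add_sum_erase Finset.univ (fun i => 2 * π * |a i|) (Finset.mem_univ i₀)
    have hs2 := Finset.add_sum_erase Finset.univ (fun i => ℓ i ^ 2) (Finset.mem_univ i₀)
    have key : ℓ i₀ ^ 2 - 2 * π * |a i₀| ≤ 6 * π * R * (L - 2 * π * R) := by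
      have : ℓ i₀ * L ≤ L ^ 2 := by nlinarith
      nlinarith
    rcases le_total 0 (a i₀) with h0 | h0
    · rw [abs_of_nonneg h0] at key
      exact ⟨1, by norm_num, by rwa [one_mul]⟩
    · rw [abs_of_nonpos h0] at key
      exact ⟨-1, by norm_num, by rwa [neg_one_mul]⟩

lemma exists_taylor_bounds {f f' f'' : ℝ → ℝ} (hf : ∀ x, HasDerivAt f (f' x) x)
    (hf' : ∀ x, HasDerivAt f' (f'' x) x) (hf'' : Continuous f'') (S : ℝ) :
    ∃ C, 1 ≤ C ∧ ∀ x ∈ Set.Icc 0 S, |f x| ≤ C ∧ |f' x| ≤ C ∧ ∀ y ∈ Set.Icc 0 S,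
      |f y - f x| ≤ C * |y - x| ∧ |f y - f x - f' x * (y - x)| ≤ C * (y - x) ^ 2 := by
  have hfc : Continuous f := continuous_iff_continuousAt.2 fun s => (hf s).continuousAt
  have hfc' : Continuous f' := continuous_iff_continuousAt.2 fun s => (hf' s).continuousAt
  obtain ⟨C0, h0⟩ := (isCompact_Icc (a := 0) (b := S)).exists_bound_of_continuousOn hfc.continuousOn
  obtain ⟨C1, h1⟩ := (isCompact_Icc (a := 0) (b := S)).exists_bound_of_continuousOn hfc'.continuousOn
  obtain ⟨C2, h2⟩ := (isCompact_Icc (a := 0) (b := S)).exists_bound_of_continuousOn hf''.continuousOn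
  set C := max 1 (max C0 (max C1 C2)) with hC
  have hC1 : 1 ≤ C := le_max_left _ _
  have hC0 : C0 ≤ C := (le_max_left _ _).trans (le_max_right _ _)
  have hC1' : C1 ≤ C := (le_max_left _ _).trans ((le_max_right _ _).trans (le_max_right _ _))
  have hC2 : C2 ≤ C := (le_max_right _ _).trans ((le_max_right _ _).trans (le_max_right _ _))
  have hlip (g g' : ℝ → ℝ) (hg : ∀ x, HasDerivAt g (g' x) x) {s : Set ℝ} (hs : Convex ℝ s)
      {D : ℝ} (hD : ∀ x ∈ s, |g' x| ≤ D) {x y : ℝ} (hx : x ∈ s) (hy : y ∈ s) :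
      |g y - g x| ≤ D * |y - x| :=
    hs.norm_image_sub_le_of_norm_hasDerivWithin_le (f := g) (f' := g')
      (fun x _ => (hg x).hasDerivWithinAt) hD hx hy
  refine ⟨C, hC1, fun x hx => ⟨(h0 x hx).trans hC0, (h1 x hx).trans hC1', fun y hy => ⟨?_, ?_⟩⟩⟩
  · exact hlip f f' hf (convex_Icc 0 S) (fun z hz => (h1 z hz).trans hC1') hx hy
  · have hsub : Set.uIcc x y ⊆ Set.Icc 0 S := Set.OrdConnected.uIcc_subset Set.ordConnected_Icc hx hy
    have hd (z : ℝ) : HasDerivAt (fun z => f z - f' x * z) (f' z - f' x) z := by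
      have h := (hf z).sub ((hasDerivAt_id z).const_mul (f' x))
      rw [mul_one] at h
      exact h
    have := hlip _ _ hd (convex_uIcc x y) (D := C * |y - x|) (fun z hz => by
      refine (hlip f' f'' hf' (convex_Icc 0 S) (fun z hz => (h2 z hz).trans hC2) hx
        (hsub hz)).trans ?_
      exact mul_le_mul_of_nonneg_left (Set.abs_sub_left_of_mem_uIcc hz) (by linarith))
      Set.left_mem_uIcc Set.right_mem_uIcc
    calc |f y - f x - f' x * (y - x)| = |f y - f' x * y - (f x - f' x * x)| := by ring_nf
      _ ≤ C * |y - x| * |y - x| := this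
      _ = C * (y - x) ^ 2 := by rw [mul_assoc, ← pow_two, sq_abs]

/-- The radial profile of the gradient of `besselSeries 0 (k|x|²)²`, up to a factor. -/
def fluxProfile (z : ℝ) : ℝ := besselSeries 0 z * besselSeries 1 z

/-- The derivative of `fluxProfile`. -/
def fluxProfileDeriv (z : ℝ) : ℝ :=
  besselSeries 1 z * besselSeries 1 z + besselSeries 0 z * besselSeries 2 z

lemma hasDerivAt_fluxProfile (z : ℝ) : HasDerivAt fluxProfile (fluxProfileDeriv z) z :=
  (hasDerivAt_besselSeries 0 z).mul (hasDerivAt_besselSeries 1 z)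

lemma continuous_fluxProfileDeriv : Continuous fluxProfileDeriv := by
  have h (m) : Continuous (besselSeries m) := continuous_besselSeries m
  unfold fluxProfileDeriv
  have := h 0
  have := h 1
  have := h 2
  fun_prop

lemma continuous_fluxProfile : Continuous fluxProfile :=
  (continuous_besselSeries 0).mul (continuous_besselSeries 1)

lemma exists_fluxProfile_bounds (S : ℝ) : ∃ C, 1 ≤ C ∧ ∀ x ∈ Set.Icc 0 S,
    fluxProfile x ≤ C ∧ |fluxProfileDeriv x| ≤ C ∧ ∀ y ∈ Set.Icc 0 S,
      |fluxProfile y - fluxProfile x| ≤ C * |y - x| ∧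
      |fluxProfile y - fluxProfile x - fluxProfileDeriv x * (y - x)| ≤ C * (y - x) ^ 2 := by
  have h (m) : Continuous (besselSeries m) := continuous_besselSeries m
  have hd (z : ℝ) : HasDerivAt fluxProfileDeriv
      ((besselSeries 2 z * besselSeries 1 z + besselSeries 1 z * besselSeries 2 z)
        + (besselSeries 1 z * besselSeries 2 z + besselSeries 0 z * besselSeries 3 z)) z :=
    ((hasDerivAt_besselSeries 1 z).mul (hasDerivAt_besselSeries 1 z)).add
      ((hasDerivAt_besselSeries 0 z).mul (hasDerivAt_besselSeries 2 z))
  have hc : Continuous fun z =>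
      ((besselSeries 2 z * besselSeries 1 z + besselSeries 1 z * besselSeries 2 z)
        + (besselSeries 1 z * besselSeries 2 z + besselSeries 0 z * besselSeries 3 z)) := by
    have := h 0
    have := h 1
    have := h 2
    have := h 3
    fun_prop
  obtain ⟨C, hC, H⟩ := exists_taylor_bounds hasDerivAt_fluxProfile hd hc S
  exact ⟨C, hC, fun x hx => ⟨(le_abs_self _).trans (H x hx).1, (H x hx).2⟩⟩

lemma one_le_besselSeries_zero {z : ℝ} (hz : 0 ≤ z) : 1 ≤ besselSeries 0 z := by
  simpa using one_div_factorial_le_besselSeries 0 hz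

lemma one_le_besselSeries_one {z : ℝ} (hz : 0 ≤ z) : 1 ≤ besselSeries 1 z := by
  simpa using one_div_factorial_le_besselSeries 1 hz

lemma one_le_fluxProfile {z : ℝ} (hz : 0 ≤ z) : 1 ≤ fluxProfile z :=
  one_le_mul_of_one_le_of_one_le (one_le_besselSeries_zero hz) (one_le_besselSeries_one hz)

set_option maxHeartbeats 1000000 in
/-- For small `k`, the flux through the boundary of the radial eigenfunction of the disk, centred
suitably, is dominated by its boundary energy. -/
lemma exists_flux_le {R : ℝ} (hR : 0 < R) : ∃ k₀, 0 < k₀ ∧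
    ∀ (N : ℕ) (Ω : Set (Eu 2)) (γ γ' : Fin N → ℝ → Eu 2) (ℓ σ : Fin N → ℝ) (δ : ℝ),
      CurveDomain Ω γ γ' ℓ → (∀ i, |σ i| ≤ 1) →
      (∀ f : Eu 2 → ℝ, ContDiff ℝ 1 f → ∀ w, ∫ x in Ω, fderiv ℝ f x w
        = ∑ i, σ i * ∫ t in (0 : ℝ)..1, f (γ i t) * cross w (γ' i t)) →
      (volume Ω).toReal = π * R ^ 2 → ∑ i, ℓ i = 2 * π * R + δ → 0 ≤ δ → δ ≤ 2 * π * R →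
      ∀ i₀, ∑ i ∈ Finset.univ.erase i₀, ℓ i ≤ 2 * δ → |ℓ i₀ - 2 * π * R| ≤ 2 * δ →
      ∀ ς : ℝ, ς ^ 2 = 1 → ℓ i₀ ^ 2 - 2 * π * (ς * curveArea (γ i₀) (γ' i₀)) ≤ 6 * π * R * δ →
      ∀ k ∈ Set.Icc 0 k₀,
        ∑ i, σ i * ∫ t in (0 : ℝ)..1, fluxProfile (k * ‖γ i t - curveMean (γ i₀)‖ ^ 2)
            * cross (γ i t - curveMean (γ i₀)) (γ' i t)
          ≤ R * (besselSeries 1 (k * R ^ 2) / besselSeries 0 (k * R ^ 2))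
            * ∑ i, ℓ i * ∫ t in (0 : ℝ)..1,
                besselSeries 0 (k * ‖γ i t - curveMean (γ i₀)‖ ^ 2) ^ 2 := by
  have hπ := pi_pos
  have hπ3 := pi_gt_three
  obtain ⟨D, hD, hstab⟩ := curve_stability hR
  set S := (8 * π * R) ^ 2 with hS
  have hS0 : 0 ≤ S := by positivity
  obtain ⟨C, hC1, hC⟩ := exists_fluxProfile_bounds S
  have hC0 : 0 ≤ C := by linarith
  set K := C * D + 16 * π * R * S * C + 2 * R * C * (6 * π * R * D + 2 * R ^ 2) with hK
  have hK0 : 0 < K := by positivity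
  refine ⟨min 1 (R / K), by positivity, ?_⟩
  intro N Ω γ γ' ℓ σ δ h hσ1 hσ hA hL hδ0 hδ i₀ hrest hmain ς hς hdef k hk
  have hk0 : 0 ≤ k := hk.1
  have hk1 : k ≤ 1 := hk.2.trans (min_le_left _ _)
  have hkK : k * K ≤ R := by
    have := hk.2.trans (min_le_right _ _)
    rwa [le_div_iff₀ hK0] at this
  set c := curveMean (γ i₀) with hc
  set s : Fin N → ℝ → ℝ := fun i t => ‖γ i t - c‖ ^ 2 with hs
  have hnorm (i t) : ‖γ i t - c‖ ≤ 8 * π * R := by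
    have := h.norm_sub_mean_le i i₀ t
    rw [hL] at this
    linarith
  have hsS (i t) : s i t ≤ S := pow_le_pow_left₀ (norm_nonneg _) (hnorm i t) 2
  have hs0 (i t) : 0 ≤ s i t := by positivity
  have hRS : R ^ 2 ≤ S := pow_le_pow_left₀ hR.le (by nlinarith) 2
  have hmem {z : ℝ} (h0 : 0 ≤ z) (h1 : z ≤ S) : k * z ∈ Set.Icc 0 S :=
    ⟨by positivity, (mul_le_of_le_one_left h0 hk1).trans h1⟩
  have hzR := hmem (sq_nonneg R) hRS
  obtain ⟨hwC, hbC, hCy⟩ := hC _ hzR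
  set w := fluxProfile (k * R ^ 2) with hw
  have hw1 : 1 ≤ w := one_le_fluxProfile hzR.1
  set E₀ := besselSeries 0 (k * R ^ 2) with hE₀
  set E₁ := besselSeries 1 (k * R ^ 2) with hE₁
  have hE₀1 : 1 ≤ E₀ := one_le_besselSeries_zero hzR.1
  have hγc (i) : Continuous (γ i) := (h.curve i).continuous
  have hγc' (i) : Continuous (γ' i) := (h.curve i).cont
  have hsc (i) : Continuous (s i) := by
    have := hγc i
    fun_prop
  have hcr (i) : Continuous fun t => cross (γ i t - c) (γ' i t) :=
    continuous_cross ((hγc i).sub continuous_const) (hγc' i)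
  have hPc (i) : Continuous fun t => fluxProfile (k * s i t) :=
    continuous_fluxProfile.comp (continuous_const.mul (hsc i))
  have hEc (i) : Continuous fun t => besselSeries 0 (k * s i t) ^ 2 :=
    ((continuous_besselSeries 0).comp (continuous_const.mul (hsc i))).pow 2
  have hℓ0 : ℓ i₀ ≤ 6 * π * R := by linarith [(abs_le.1 hmain).2]
  set X : Fin N → ℝ := fun i =>
    ∫ t in (0 : ℝ)..1, (fluxProfile (k * s i t) - w) * cross (γ i t - c) (γ' i t) with hX
  set Y : Fin N → ℝ := fun i => ∫ t in (0 : ℝ)..1, (besselSeries 0 (k * s i t) ^ 2 - E₀ ^ 2) with hY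
  obtain ⟨hst1, hst2⟩ := hstab _ _ _ ς δ (h.curve i₀) hς hδ0 hδ hmain hdef
  have hX0 : |X i₀| ≤ D * (C * k) * δ := by
    refine hst2 (fun z => fluxProfile (k * z)) (C * k) (k * fluxProfileDeriv (k * R ^ 2)) w
      (continuous_fluxProfile.comp (continuous_const.mul continuous_id)) (by positivity) ?_ ?_
    · rw [abs_mul, abs_of_nonneg hk0, mul_comm]
      gcongr
    · intro z hz
      have hzS : z ≤ S := hz.2.trans (pow_le_pow_left₀ (by positivity) (by nlinarith) 2)
      obtain ⟨h1, h2⟩ := hCy _ (hmem hz.1 hzS)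
      rw [← mul_sub] at h1 h2
      rw [abs_mul, abs_of_nonneg hk0] at h1
      refine ⟨by rwa [mul_assoc], ?_⟩
      rw [mul_comm k (fluxProfileDeriv _), mul_assoc]
      refine h2.trans ?_
      rw [mul_pow, mul_assoc]
      have : k ^ 2 ≤ k := by nlinarith
      gcongr
  have hXi (i) : |X i| ≤ C * k * S * (8 * π * R) * ℓ i := by
    have := intervalIntegral.norm_integral_le_of_norm_le_const (a := 0) (b := 1)
      (f := fun t => (fluxProfile (k * s i t) - w) * cross (γ i t - c) (γ' i t))
      (C := C * k * S * (8 * π * R) * ℓ i) fun t _ => ?_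
    · simpa using this
    · have h1 := (hCy _ (hmem (hs0 i t) (hsS i t))).1
      rw [← mul_sub, abs_mul, abs_of_nonneg hk0] at h1
      have h2 : |s i t - R ^ 2| ≤ S :=
        abs_le.2 ⟨by linarith [hs0 i t], by linarith [hsS i t, sq_nonneg R]⟩
      have h3 := abs_cross_le (γ i t - c) (γ' i t)
      rw [(h.curve i).speed] at h3
      rw [norm_mul]
      calc |fluxProfile (k * s i t) - w| * |cross (γ i t - c) (γ' i t)|
          ≤ (C * (k * S)) * (8 * π * R * ℓ i) := by
            refine mul_le_mul (h1.trans (by gcongr)) (h3.trans ?_) (abs_nonneg _) (by positivity)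
            exact mul_le_mul_of_nonneg_right (hnorm i t) (h.pos i).le
        _ = _ := by ring
  have hYi (i) : 2 * w * k * ∫ t in (0 : ℝ)..1, (s i t - R ^ 2) ≤ Y i := by
    rw [← intervalIntegral.integral_const_mul]
    refine intervalIntegral.integral_mono_on zero_le_one
      (Continuous.intervalIntegrable (by have := hsc i; fun_prop) _ _)
      (((hEc i).sub continuous_const).intervalIntegrable _ _) fun t _ => ?_
    have h1 := besselSeries_zero_tangent hzR.1 (hmem (hs0 i t) (hsS i t)).1
    have h2 : w = E₀ * E₁ := rfl
    have h3 : E₀ * (E₁ * (k * s i t - k * R ^ 2)) ≤ E₀ * (besselSeries 0 (k * s i t) - E₀) :=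
      mul_le_mul_of_nonneg_left (by linarith) (by linarith)
    rw [h2]
    have h4 := sq_nonneg (besselSeries 0 (k * s i t) - E₀)
    linear_combination 2 * h3 + h4
  have hY0 : -(2 * w * k * (D * δ)) ≤ Y i₀ := by
    refine le_trans ?_ (hYi i₀)
    rw [← mul_neg]
    exact mul_le_mul_of_nonneg_left (abs_le.1 hst1).1 (by positivity)
  have hY1 (i) : -(2 * w * k * R ^ 2) ≤ Y i := by
    refine le_trans ?_ (hYi i)
    rw [← mul_neg]
    refine mul_le_mul_of_nonneg_left ?_ (by positivity)
    have := intervalIntegral.integral_mono_on (μ := volume) (f := fun _ => -R ^ 2)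
      (g := fun t => s i t - R ^ 2) zero_le_one (by simp)
      (((hsc i).sub continuous_const).intervalIntegrable _ _) fun t _ => by linarith [hs0 i t]
    simpa using this
  have hXsum : ∑ i, σ i * X i ≤ k * (C * D + 16 * π * R * S * C) * δ := by
    calc ∑ i, σ i * X i ≤ ∑ i, |X i| := by
          refine Finset.sum_le_sum fun i _ => (le_abs_self _).trans ?_
          rw [abs_mul]
          exact mul_le_of_le_one_left (abs_nonneg _) (hσ1 i)
      _ = |X i₀| + ∑ i ∈ Finset.univ.erase i₀, |X i| :=
          (Finset.add_sum_erase _ _ (Finset.mem_univ i₀)).symm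
      _ ≤ D * (C * k) * δ + ∑ i ∈ Finset.univ.erase i₀, C * k * S * (8 * π * R) * ℓ i :=
          add_le_add hX0 (Finset.sum_le_sum fun i _ => hXi i)
      _ ≤ D * (C * k) * δ + C * k * S * (8 * π * R) * (2 * δ) := by
          rw [← Finset.mul_sum]
          gcongr
      _ = _ := by ring
  have hYsum : -(2 * w * k * (6 * π * R * D + 2 * R ^ 2) * δ) ≤ ∑ i, ℓ i * Y i := by
    rw [← Finset.add_sum_erase _ _ (Finset.mem_univ i₀)]
    have h1 : ∑ i ∈ Finset.univ.erase i₀, ℓ i * -(2 * w * k * R ^ 2)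
        ≤ ∑ i ∈ Finset.univ.erase i₀, ℓ i * Y i :=
      Finset.sum_le_sum fun i _ => mul_le_mul_of_nonneg_left (hY1 i) (h.pos i).le
    rw [← Finset.sum_mul] at h1
    have h2 := mul_le_mul_of_nonneg_left hY0 (h.pos i₀).le
    have h3 := mul_le_mul_of_nonneg_right hrest (show 0 ≤ 2 * w * k * R ^ 2 by positivity)
    have h4 := mul_le_mul_of_nonneg_right hℓ0 (show 0 ≤ 2 * w * k * (D * δ) by positivity)
    linarith
  have hsumX : ∑ i, σ i * (∫ t in (0 : ℝ)..1, fluxProfile (k * s i t) * cross (γ i t - c) (γ' i t))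
      = (∑ i, σ i * X i) + w * (2 * (π * R ^ 2)) := by
    rw [← hA, h.two_mul_area hσ c, Finset.mul_sum, ← Finset.sum_add_distrib]
    refine Finset.sum_congr rfl fun i _ => ?_
    have : X i = (∫ t in (0 : ℝ)..1, fluxProfile (k * s i t) * cross (γ i t - c) (γ' i t))
        - w * ∫ t in (0 : ℝ)..1, cross (γ i t - c) (γ' i t) := by
      have i1 : Continuous fun t => fluxProfile (k * s i t) * cross (γ i t - c) (γ' i t) :=
        (hPc i).mul (hcr i)
      have i2 : Continuous fun t => w * cross (γ i t - c) (γ' i t) := (hcr i).const_mul w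
      rw [← intervalIntegral.integral_const_mul, ← intervalIntegral.integral_sub
        (i1.intervalIntegrable _ _) (i2.intervalIntegrable _ _)]
      simp only [hX, sub_mul]
    rw [this]
    ring
  have hsumY : ∑ i, ℓ i * (∫ t in (0 : ℝ)..1, besselSeries 0 (k * s i t) ^ 2)
      = (∑ i, ℓ i * Y i) + E₀ ^ 2 * (2 * π * R + δ) := by
    rw [← hL, Finset.mul_sum, ← Finset.sum_add_distrib]
    refine Finset.sum_congr rfl fun i _ => ?_
    have : Y i = (∫ t in (0 : ℝ)..1, besselSeries 0 (k * s i t) ^ 2) - E₀ ^ 2 := by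
      simp only [hY]
      rw [intervalIntegral.integral_sub ((hEc i).intervalIntegrable _ _) (by simp)]
      simp
    rw [this]
    ring
  rw [hsumX, hsumY]
  set Z := 2 * w * k * (6 * π * R * D + 2 * R ^ 2) * δ with hZ
  have hZ0 : 0 ≤ Z := by positivity
  have hwE : R * (E₁ / E₀) = R * w / E₀ ^ 2 := by
    have : w = E₀ * E₁ := rfl
    rw [this]
    field_simp
  rw [hwE, mul_add]
  have h1 : -(R * w * Z) ≤ R * w / E₀ ^ 2 * ∑ i, ℓ i * Y i := by
    calc -(R * w * Z) ≤ R * w / E₀ ^ 2 * (-Z) := by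
          rw [mul_neg]
          refine neg_le_neg (mul_le_mul_of_nonneg_right ?_ hZ0)
          exact div_le_self (by positivity) (one_le_pow₀ hE₀1)
      _ ≤ _ := mul_le_mul_of_nonneg_left hYsum (by positivity)
  have h2 : R * w / E₀ ^ 2 * (E₀ ^ 2 * (2 * π * R + δ)) = R * w * (2 * π * R + δ) := by
    field_simp
  rw [h2]
  have h3 : R * w * Z ≤ w * δ * (k * (2 * R * C * (6 * π * R * D + 2 * R ^ 2))) := by
    rw [hZ]
    have := mul_le_mul_of_nonneg_right hwC
      (show 0 ≤ w * δ * (k * (2 * R * (6 * π * R * D + 2 * R ^ 2))) by positivity)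
    linarith
  have h4 : k * (C * D + 16 * π * R * S * C) * δ ≤ w * δ * (k * (C * D + 16 * π * R * S * C)) := by
    have := mul_le_mul_of_nonneg_right hw1
      (show 0 ≤ δ * (k * (C * D + 16 * π * R * S * C)) by positivity)
    linarith
  have h5 := mul_le_mul_of_nonneg_left hkK (show 0 ≤ w * δ by positivity)
  rw [hK] at h5
  linarith

lemma radialWeight_div {k R : ℝ} (hR : R ≠ 0) : radialWeight k R / R
    = 2 * k * (R * (besselSeries 1 (k * R ^ 2) / besselSeries 0 (k * R ^ 2))) := by
  unfold radialWeight
  field_simp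

lemma continuousOn_radialWeight_left (R : ℝ) :
    ContinuousOn (fun k => radialWeight k R) (Set.Ici 0) := by
  have h (m) : Continuous fun k : ℝ => besselSeries m (k * R ^ 2) :=
    (continuous_besselSeries m).comp (by fun_prop)
  have h1 : Continuous fun k : ℝ => 2 * (k * R ^ 2) * besselSeries 1 (k * R ^ 2) :=
    Continuous.mul (by fun_prop) (h 1)
  refine h1.continuousOn.div (h 0).continuousOn fun k (hk : 0 ≤ k) => ?_
  exact (besselSeries_pos 0 (by positivity)).ne'

namespace CurveDomain

variable {N : ℕ} {Ω : Set (Eu 2)} {γ γ' : Fin N → ℝ → Eu 2} {ℓ : Fin N → ℝ}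

lemma robinEig_le (h : CurveDomain Ω γ γ' ℓ) {α m : ℝ} {u : Eu 2 → ℝ} (hu : ContDiff ℝ 1 u)
    (hpos : 0 < ∫ x in Ω, u x ^ 2)
    (hle : (∫ x in Ω, ‖fderiv ℝ u x‖ ^ 2) + α * ∑ i, ℓ i * ∫ t in (0 : ℝ)..1, u (γ i t) ^ 2
      ≤ m * ∫ x in Ω, u x ^ 2) : robinEig 2 α Ω ≤ m := by
  obtain ⟨r, hr⟩ := h.isBounded.closure.subset_closedBall (0 : Eu 2)
  obtain ⟨K, hK⟩ := hu.contDiffOn.exists_lipschitzOnWith one_ne_zero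
    (convex_closedBall (0 : Eu 2) r) (isCompact_closedBall 0 r)
  refine (csInf_le (h.bddBelow_robinRayleighSet α) ⟨u, K, hK.mono hr, hpos.ne', rfl⟩).trans ?_
  have hd : (((2 : ℕ) : ℝ) - 1) = 1 := by norm_num
  rw [div_le_iff₀ hpos, hd, h.integral_frontier (f := fun x => u x ^ 2) (hu.continuous.pow 2)]
  exact hle

/-- Energy of the radial eigenfunction of the disk, as a boundary flux. -/
lemma integral_energy_eq (h : CurveDomain Ω γ γ' ℓ) {σ : Fin N → ℝ}
    (hσ : ∀ f : Eu 2 → ℝ, ContDiff ℝ 1 f → ∀ w, ∫ x in Ω, fderiv ℝ f x w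
      = ∑ i, σ i * ∫ t in (0 : ℝ)..1, f (γ i t) * cross w (γ' i t)) (k : ℝ) (c : Eu 2) :
    (∫ y in Ω, ‖fderiv ℝ (fun y => besselSeries 0 (k * ‖y - c‖ ^ 2)) y‖ ^ 2)
      + 4 * k * ∫ y in Ω, besselSeries 0 (k * ‖y - c‖ ^ 2) ^ 2
      = 2 * k * ∑ i, σ i * ∫ t in (0 : ℝ)..1, fluxProfile (k * ‖γ i t - c‖ ^ 2)
            * cross (γ i t - c) (γ' i t) := by
  have hW (s : ℝ) : HasDerivAt (fun s => fluxProfile (k * s)) (k * fluxProfileDeriv (k * s)) s := by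
    have h1 : HasDerivAt (fun s : ℝ => k * s) k s := by simpa using (hasDerivAt_id s).const_mul k
    rw [mul_comm]
    exact HasDerivAt.comp (h₂ := fluxProfile) (h := fun s => k * s) s (hasDerivAt_fluxProfile _) h1
  have hW' : Continuous fun s => k * fluxProfileDeriv (k * s) := by
    have := continuous_fluxProfileDeriv
    fun_prop
  rw [← h.integral_radial_divergence hσ hW hW' c]
  have hc (m) : Continuous fun y : Eu 2 => besselSeries m (k * ‖y - c‖ ^ 2) :=
    (continuous_besselSeries m).comp (by fun_prop)
  have hfd (y : Eu 2) : ‖fderiv ℝ (fun y => besselSeries 0 (k * ‖y - c‖ ^ 2)) y‖ ^ 2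
      = 4 * k ^ 2 * ‖y - c‖ ^ 2 * besselSeries 1 (k * ‖y - c‖ ^ 2) ^ 2 := by
    have h1 : HasFDerivAt (fun y => besselSeries 0 (k * ‖y - c‖ ^ 2))
        (besselSeries 1 (k * ‖y - c‖ ^ 2) • (k • (2 • innerSL ℝ (y - c)))) y :=
      (hasDerivAt_besselSeries 0 _).comp_hasFDerivAt y
        ((hasFDerivAt_norm_sub_sq c y).const_mul k)
    have h2 : ‖(2 : ℕ) • innerSL ℝ (y - c)‖ = 2 * ‖y - c‖ := by
      rw [← Nat.cast_smul_eq_nsmul ℝ, norm_smul, innerSL_apply_norm]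
      simp
    rw [h1.fderiv, norm_smul, norm_smul, h2, mul_pow, mul_pow, mul_pow, Real.norm_eq_abs,
      Real.norm_eq_abs, sq_abs, sq_abs]
    ring
  have i1 : IntegrableOn
      (fun y => 4 * k ^ 2 * ‖y - c‖ ^ 2 * besselSeries 1 (k * ‖y - c‖ ^ 2) ^ 2) Ω := by
    have := hc 1
    exact integrableOn_of_bounded_continuous (by fun_prop) h.isBounded
  have i2 : IntegrableOn (fun y => 4 * k * besselSeries 0 (k * ‖y - c‖ ^ 2) ^ 2) Ω := by
    have := hc 0
    exact integrableOn_of_bounded_continuous (by fun_prop) h.isBounded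
  simp only [hfd]
  rw [← integral_const_mul, ← integral_const_mul, ← integral_add i1 i2]
  congr 1
  ext y
  have := besselSeries_zero_eq (k * ‖y - c‖ ^ 2)
  simp only [fluxProfile, fluxProfileDeriv]
  linear_combination (4 * k * besselSeries 0 (k * ‖y - c‖ ^ 2)) * this

end CurveDomain

/-- Uniform comparison with the disk, with `α` parametrised by the eigenvalue `-4k`. -/
lemma exists_robinEig_le {R : ℝ} (hR : 0 < R) : ∃ k₀, 0 < k₀ ∧ ∀ Ω : Set (Eu 2), IsC2Domain Ω →
    (volume Ω).toReal = π * R ^ 2 → ∀ k ∈ Set.Icc 0 k₀,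
      robinEig 2 (-(radialWeight k R / R)) Ω ≤ -(4 * k) := by
  have hπ := pi_pos
  obtain ⟨k₁, hk₁, hflux⟩ := exists_flux_le hR
  obtain ⟨C, hC⟩ := (isCompact_Icc (a := 0) (b := R ^ 2)).exists_bound_of_continuousOn
    (continuous_besselSeries 2).continuousOn
  have hC0 : 0 ≤ C := (norm_nonneg _).trans (hC 0 ⟨le_rfl, sq_nonneg R⟩)
  refine ⟨min k₁ (min 1 (1 / (R ^ 2 * (C + 1)))), by positivity, ?_⟩
  intro Ω hΩ hA k hk
  have hk0 : 0 ≤ k := hk.1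
  have hkk₁ : k ≤ k₁ := hk.2.trans (min_le_left _ _)
  have hk1 : k ≤ 1 := hk.2.trans ((min_le_right _ _).trans (min_le_left _ _))
  have hkC : k * (R ^ 2 * (C + 1)) ≤ 1 := by
    have := hk.2.trans ((min_le_right _ _).trans (min_le_right _ _))
    rwa [le_div_iff₀ (by positivity)] at this
  obtain ⟨N, γ, γ', ℓ, h⟩ := hΩ.exists_curveDomain
  obtain ⟨σ, hσ1, hσ⟩ := h.exists_gauss_green
  obtain ⟨δ, hδ0, hL, hδ⟩ := h.exists_main_curve hσ1 hσ hR hA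
  have hz : 0 ≤ k * R ^ 2 := by positivity
  rw [radialWeight_div hR.ne']
  set q := besselSeries 1 (k * R ^ 2) / besselSeries 0 (k * R ^ 2) with hq
  have hvol : ∫ _ in Ω, (1 : ℝ) = π * R ^ 2 := by simpa [Measure.real] using hA
  rcases le_total δ (2 * π * R) with hδL | hδL
  · obtain ⟨i₀, hrest, hmain, ς, hς, hdef⟩ := hδ hδL
    have key := hflux N Ω γ γ' ℓ σ δ h hσ1 hσ hA hL hδ0 hδL i₀ hrest hmain ς hς hdef k ⟨hk0, hkk₁⟩
    set c := curveMean (γ i₀)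
    have hcd : ContDiff ℝ 1 fun y : Eu 2 => besselSeries 0 (k * ‖y - c‖ ^ 2) :=
      (contDiff_besselSeries 0).comp
        (contDiff_const.mul ((contDiff_id.sub contDiff_const).norm_sq ℝ))
    refine h.robinEig_le hcd ?_ ?_
    · have h1 : ∫ _ in Ω, (1 : ℝ) ≤ ∫ y in Ω, besselSeries 0 (k * ‖y - c‖ ^ 2) ^ 2 :=
        integral_mono (integrableOn_const h.volume_ne_top)
          (integrableOn_of_bounded_continuous (hcd.continuous.pow 2) h.isBounded)
          fun y => one_le_pow₀ (one_le_besselSeries_zero (by positivity))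
      rw [hvol] at h1
      have : 0 < π * R ^ 2 := by positivity
      linarith
    · have h1 := h.integral_energy_eq hσ k c
      have h2 := mul_le_mul_of_nonneg_left key (show 0 ≤ 2 * k by positivity)
      linarith
  · have hq2 : 1 / 2 ≤ q := by
      have h0 := one_le_besselSeries_zero hz
      have h1 := one_le_besselSeries_one hz
      have h2 := besselSeries_zero_eq (k * R ^ 2)
      have h3 := (le_abs_self _).trans
        (hC (k * R ^ 2) ⟨hz, mul_le_of_le_one_left (sq_nonneg R) hk1⟩)
      have h4 := mul_le_mul_of_nonneg_left h3 hz
      rw [hq, le_div_iff₀ (by linarith)]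
      nlinarith
    refine h.robinEig_le (u := fun _ => 1) contDiff_const ?_ ?_
    · simp only [one_pow, hvol]
      positivity
    · simp only [one_pow, hvol, intervalIntegral.integral_const, sub_zero, smul_eq_mul, mul_one, hL]
      simp only [fderiv_fun_const, Pi.zero_apply, norm_zero]
      have h1 : 1 / 2 * (4 * π * R) ≤ q * (2 * π * R + δ) :=
        mul_le_mul hq2 (by linarith) (by positivity) (by linarith)
      have h2 := mul_le_mul_of_nonneg_left h1 (show 0 ≤ 2 * k * R by positivity)
      simp
      linarith

theorem disk_maximises_for_small_alpha_uniformly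
    (A₀ : ℝ) (hA₀ : 0 < A₀) :
    ∃ αs : ℝ, αs < 0 ∧
      ∀ Ω : Set (Eu 2), IsC2Domain Ω → (volume Ω).toReal = A₀ →
        ∀ α ∈ Set.Icc αs (0 : ℝ),
          robinEig 2 α Ω ≤
            robinEig 2 α (Metric.ball (0 : Eu 2) (Real.sqrt (A₀ / π))) := by
  set R := Real.sqrt (A₀ / π) with hR_def
  have hR : 0 < R := Real.sqrt_pos.2 (by positivity)
  have hA : A₀ = π * R ^ 2 := by
    rw [hR_def, Real.sq_sqrt (by positivity)]
    field_simp
  obtain ⟨k₀, hk₀, hk⟩ := exists_robinEig_le hR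
  have hz : 0 ≤ k₀ * R ^ 2 := by positivity
  have hpos : 0 < radialWeight k₀ R / R := by
    have h0 := besselSeries_pos 0 hz
    have h1 := besselSeries_pos 1 hz
    rw [radialWeight_div hR.ne']
    positivity
  refine ⟨-(radialWeight k₀ R / R), neg_lt_zero.2 hpos, fun Ω hΩ hvol α hα => ?_⟩
  have hcont : ContinuousOn (fun k => radialWeight k R / R) (Set.Icc 0 k₀) :=
    ((continuousOn_radialWeight_left R).mono Set.Icc_subset_Ici_self).div_const R
  have hzero : radialWeight 0 R / R = 0 := by simp [radialWeight_div hR.ne']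
  obtain ⟨k, hkmem, hkα⟩ := intermediate_value_Icc hk₀.le hcont
    (show -α ∈ Set.Icc (radialWeight 0 R / R) (radialWeight k₀ R / R) from
      ⟨by linarith [hα.2], by linarith [hα.1]⟩)
  obtain rfl : α = -(radialWeight k R / R) := by
    have : radialWeight k R / R = -α := hkα
    linarith
  exact (hk Ω hΩ (hvol.trans hA) k hkmem).trans (le_robinEig_ball hkmem.1 hR)

end
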